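/- For every ε > 0 there exists ρ_ε > 0 such that for every integer ρ > ρ_ε one has liminf_{n→∞} (q_{n+ρ} − q_n) ≤ exp(2(2+ε)ρ / (3 log ρ)). (This is unconditional, since both the primes and the E₂-numbers have level of distribution 1/2 by the theorems of Bombieri–Vinogradov and Motohashi.) -/

import Mathlib

open Filter

set_option linter.unusedSectionVars false

/-- An `E₂`-number: a product of two distinct primes. -/
def IsE2 (n : ℕ) : Prop := ∃ p q : ℕ, p.Prime ∧ q.Prime ∧ p ≠ q ∧ n = p * q

section PeriodicSums

variable {E : Type*} [NormedAddCommGroup E] [NormedSpace ℝ E]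

/-- Partial summation against a nonnegative antitone weight. -/
theorem norm_sum_Ioc_smul_le_of_antitone {g : ℕ → E} {ω : ℕ → ℝ} {X : ℕ} {C : ℝ}
    (hg : ∀ m, ‖∑ n ∈ Finset.Ioc X m, g n‖ ≤ C)
    (hω : ∀ m n, X < m → m ≤ n → ω n ≤ ω m) (hω0 : ∀ m, X < m → 0 ≤ ω m) (Y : ℕ) :
    ‖∑ n ∈ Finset.Ioc X Y, ω n • g n‖ ≤ C * ω (X + 1) := by
  have hC : 0 ≤ C := (norm_nonneg _).trans (hg X)
  rcases Nat.lt_or_ge X Y with hXY | hXY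
  swap
  · rw [Finset.Ioc_eq_empty_of_le hXY]
    simpa using mul_nonneg hC (hω0 _ (Nat.lt_succ_self X))
  have key : ∀ Y, X + 1 ≤ Y →
      ‖∑ n ∈ Finset.Ioc X Y, ω n • g n - ω Y • ∑ n ∈ Finset.Ioc X Y, g n‖
        ≤ C * (ω (X + 1) - ω Y) := by
    intro Y hY
    induction Y, hY using Nat.le_induction with
    | base => simp
    | succ Y hY ih =>
      rw [Finset.sum_Ioc_succ_top (by lia), Finset.sum_Ioc_succ_top (by lia)]
      have e : ∑ n ∈ Finset.Ioc X Y, ω n • g n + ω (Y + 1) • g (Y + 1)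
          - ω (Y + 1) • (∑ n ∈ Finset.Ioc X Y, g n + g (Y + 1))
          = (∑ n ∈ Finset.Ioc X Y, ω n • g n - ω Y • ∑ n ∈ Finset.Ioc X Y, g n)
            + (ω Y - ω (Y + 1)) • ∑ n ∈ Finset.Ioc X Y, g n := by
        module
      rw [e]
      have h0 : 0 ≤ ω Y - ω (Y + 1) := sub_nonneg.2 (hω _ _ (by lia) (by lia))
      calc _ ≤ C * (ω (X + 1) - ω Y) + (ω Y - ω (Y + 1)) * C := by
            refine norm_add_le_of_le ih ?_
            rw [norm_smul, Real.norm_of_nonneg h0]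
            exact mul_le_mul_of_nonneg_left (hg Y) h0
        _ = _ := by ring
  have h1 := key Y hXY
  have h2 : ‖ω Y • ∑ n ∈ Finset.Ioc X Y, g n‖ ≤ ω Y * C := by
    rw [norm_smul, Real.norm_of_nonneg (hω0 _ hXY)]
    exact mul_le_mul_of_nonneg_left (hg Y) (hω0 _ hXY)
  calc _ = ‖(∑ n ∈ Finset.Ioc X Y, ω n • g n - ω Y • ∑ n ∈ Finset.Ioc X Y, g n)
        + ω Y • ∑ n ∈ Finset.Ioc X Y, g n‖ := by rw [sub_add_cancel]
    _ ≤ C * (ω (X + 1) - ω Y) + ω Y * C := norm_add_le_of_le h1 h2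
    _ = _ := by ring

/-- Partial sums of a periodic function of mean zero are bounded. -/
theorem norm_sum_Ioc_le_of_periodic {g : ℕ → E} {q : ℕ} (hq : 0 < q) {B : ℝ}
    (hper : Function.Periodic g q) (hmean : ∑ n ∈ Finset.range q, g n = 0)
    (hB : ∀ n, ‖g n‖ ≤ B) (X Y : ℕ) :
    ‖∑ n ∈ Finset.Ioc X Y, g n‖ ≤ 2 * q * B := by
  have hB0 : 0 ≤ B := (norm_nonneg _).trans (hB 0)
  have hstep : ∀ n, ∑ m ∈ Finset.range (n + q), g m = ∑ m ∈ Finset.range n, g m := by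
    intro n
    rw [add_comm, Finset.sum_range_add, hmean, zero_add]
    refine Finset.sum_congr rfl fun m _ => ?_
    rw [add_comm, hper m]
  have hrange : ∀ n, ‖∑ m ∈ Finset.range n, g m‖ ≤ q * B := by
    intro n
    induction n using Nat.strong_induction_on with
    | _ n ih =>
      rcases Nat.lt_or_ge n q with h | h
      · calc _ ≤ ∑ m ∈ Finset.range n, B := norm_sum_le_of_le _ fun m _ => hB m
          _ = n * B := by simp
          _ ≤ _ := by gcongr
      · obtain ⟨m, rfl⟩ := Nat.exists_eq_add_of_le' h
        rw [hstep]
        exact ih m (by lia)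
  rcases Nat.lt_or_ge X Y with h | h
  · have : ∑ n ∈ Finset.Ioc X Y, g n
        = ∑ m ∈ Finset.range (Y + 1), g m - ∑ m ∈ Finset.range (X + 1), g m := by
      rw [← Finset.sum_Ico_eq_sub _ (by lia)]
      refine Finset.sum_congr ?_ fun _ _ => rfl
      ext n
      simp only [Finset.mem_Ioc, Finset.mem_Ico]
      lia
    rw [this]
    calc _ ≤ q * B + q * B := norm_sub_le_of_le (hrange _) (hrange _)
      _ = _ := by ring
  · rw [Finset.Ioc_eq_empty_of_le h]
    simp only [Finset.sum_empty, norm_zero]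
    positivity

theorem norm_sum_Ioc_inv_smul_le_of_periodic {g : ℕ → E} {q : ℕ} (hq : 0 < q) {B : ℝ}
    (hper : Function.Periodic g q) (hmean : ∑ n ∈ Finset.range q, g n = 0)
    (hB : ∀ n, ‖g n‖ ≤ B) (X Y : ℕ) :
    ‖∑ n ∈ Finset.Ioc X Y, (1 / (n : ℝ)) • g n‖ ≤ 2 * q * B * (1 / ((X + 1 : ℕ) : ℝ)) := by
  refine norm_sum_Ioc_smul_le_of_antitone (ω := fun n : ℕ => 1 / (n : ℝ))
    (fun m => norm_sum_Ioc_le_of_periodic hq hper hmean hB X m) ?_ ?_ Y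
  · intro m n hm hmn
    have : (0 : ℝ) < m := by exact_mod_cast (by lia : 0 < m)
    exact one_div_le_one_div_of_le this (by exact_mod_cast hmn)
  · intro m _
    positivity

end PeriodicSums

section LocalFunctions

variable {𝕜 : Type*} [RCLike 𝕜]

/-- The mean value of a function on `ℤ/qℤ`. -/
noncomputable def zmodMean {q : ℕ} [NeZero q] (f : ZMod q → 𝕜) : 𝕜 :=
  (∑ x, f x) / q

theorem norm_zmodMean_le {q : ℕ} [NeZero q] {f : ZMod q → 𝕜} (hf : ∀ x, ‖f x‖ ≤ 1) :
    ‖zmodMean f‖ ≤ 1 := by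
  have hq : (0 : ℝ) < q := by exact_mod_cast Nat.pos_of_neZero q
  rw [zmodMean, norm_div, RCLike.norm_natCast, div_le_one hq]
  calc _ ≤ ∑ x : ZMod q, (1 : ℝ) := norm_sum_le_of_le _ fun x _ => hf x
    _ = q := by simp [ZMod.card]

theorem sum_range_natCast_zmod {q : ℕ} [NeZero q] (f : ZMod q → 𝕜) :
    ∑ n ∈ Finset.range q, f n = ∑ x, f x := by
  refine Finset.sum_bij (fun n _ => (n : ZMod q)) (fun _ _ => Finset.mem_univ _) ?_ ?_
    (fun _ _ => rfl)
  · intro a ha b hb hab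
    rw [ZMod.natCast_eq_natCast_iff'] at hab
    rwa [Nat.mod_eq_of_lt (Finset.mem_range.1 ha), Nat.mod_eq_of_lt (Finset.mem_range.1 hb)]
      at hab
  · intro x _
    exact ⟨x.val, Finset.mem_range.2 x.val_lt, ZMod.natCast_zmod_val x⟩

/-- Logarithmic averages of a product of functions modulo pairwise coprime moduli. -/
theorem norm_sum_inv_mul_prod_sub_le {κ : Type*} (T : Finset κ) (a : κ → ℕ)
    [∀ i, NeZero (a i)] (ha : ∀ i ∈ T, ∀ j ∈ T, i ≠ j → Nat.Coprime (a i) (a j))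
    (f : ∀ i, ZMod (a i) → 𝕜) (hf : ∀ i x, ‖f i x‖ ≤ 1) (X Y : ℕ) :
    ‖∑ n ∈ Finset.Ioc X Y, (1 / (n : ℝ)) • ∏ i ∈ T, f i n
      - (∑ n ∈ Finset.Ioc X Y, 1 / (n : ℝ)) • ∏ i ∈ T, zmodMean (f i)‖
      ≤ 4 * (∏ i ∈ T, a i : ℕ) / (X + 1) := by
  classical
  set q := ∏ i ∈ T, a i with hq
  have hq0 : q ≠ 0 := Finset.prod_ne_zero_iff.2 fun i _ => NeZero.ne _
  have : NeZero q := ⟨hq0⟩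
  set μ := ∏ i ∈ T, zmodMean (f i) with hμ
  have hprod : ∀ n : ℕ, ‖∏ i ∈ T, f i n‖ ≤ 1 := fun n => by
    rw [norm_prod]
    exact Finset.prod_le_one (fun _ _ => norm_nonneg _) fun i _ => hf i _
  have hμ1 : ‖μ‖ ≤ 1 := by
    rw [hμ, norm_prod]
    exact Finset.prod_le_one (fun _ _ => norm_nonneg _) fun i _ => norm_zmodMean_le (hf i)
  have hsum : ∑ n ∈ Finset.range q, ∏ i ∈ T, f i n = q * μ := by
    have hcop : Pairwise (Function.onFun Nat.Coprime fun i : T => a i) := by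
      intro i j hij
      exact ha i i.2 j j.2 fun h => hij (Subtype.ext h)
    have hq' : ∏ i : T, a i = q := by rw [hq, Finset.prod_coe_sort]
    have : NeZero (∏ i : T, a i) := ⟨hq' ▸ hq0⟩
    have e1 : ∑ n ∈ Finset.range q, ∏ i ∈ T, f i n
        = ∑ x : ZMod (∏ i : T, a i), ∏ i : T, f i (ZMod.prodEquivPi (fun i : T => a i) hcop x i) := by
      rw [← sum_range_natCast_zmod (fun x : ZMod (∏ i : T, a i) =>
        ∏ i : T, f i (ZMod.prodEquivPi (fun i : T => a i) hcop x i))]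
      refine Finset.sum_congr (by rw [hq']) fun n _ => ?_
      rw [← Finset.prod_coe_sort]
      refine Finset.prod_congr rfl fun i _ => ?_
      rw [map_natCast, Pi.natCast_apply]
    refine e1.trans ((Equiv.sum_comp (ZMod.prodEquivPi (fun i : T => a i) hcop).toEquiv
      (fun z : (∀ i : T, ZMod (a i)) => ∏ i : T, f i (z i))).trans ?_)
    rw [← Fintype.piFinset_univ,
      ← Finset.prod_univ_sum (fun i : T => (Finset.univ : Finset (ZMod (a i))))
        (fun i x => f i x), hμ, ← Finset.prod_coe_sort T (fun i => zmodMean (f i)), hq,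
      ← Finset.prod_coe_sort T, Nat.cast_prod, ← Finset.prod_mul_distrib]
    refine Finset.prod_congr rfl fun i _ => ?_
    have : ((a i : ℕ) : 𝕜) ≠ 0 := by exact_mod_cast NeZero.ne (a i)
    rw [zmodMean]
    field_simp
  have hper : Function.Periodic (fun n : ℕ => ∏ i ∈ T, f i n - μ) q := by
    intro n
    simp only
    congr 1
    refine Finset.prod_congr rfl fun i hi => ?_
    have : ((q : ℕ) : ZMod (a i)) = 0 := by
      rw [ZMod.natCast_eq_zero_iff]
      exact Finset.dvd_prod_of_mem _ hi
    rw [Nat.cast_add, this, add_zero]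
  have hmean : ∑ n ∈ Finset.range q, (∏ i ∈ T, f i n - μ) = 0 := by
    rw [Finset.sum_sub_distrib, hsum]
    simp
  have hB : ∀ n : ℕ, ‖∏ i ∈ T, f i n - μ‖ ≤ 2 := fun n =>
    (norm_sub_le_of_le (hprod n) hμ1).trans (by norm_num)
  have main := norm_sum_Ioc_inv_smul_le_of_periodic (Nat.pos_of_ne_zero hq0) hper hmean hB X Y
  have e : ∑ n ∈ Finset.Ioc X Y, (1 / (n : ℝ)) • (∏ i ∈ T, f i n - μ)
      = ∑ n ∈ Finset.Ioc X Y, (1 / (n : ℝ)) • ∏ i ∈ T, f i n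
        - (∑ n ∈ Finset.Ioc X Y, 1 / (n : ℝ)) • μ := by
    rw [Finset.sum_smul, ← Finset.sum_sub_distrib]
    exact Finset.sum_congr rfl fun n _ => smul_sub _ _ _
  rw [e] at main
  refine main.trans (le_of_eq ?_)
  push_cast
  ring

end LocalFunctions

section Mertens

theorem DirichletCharacter.norm_sum_Ioc_smul_le {W : ℕ} [NeZero W]
    {χ : DirichletCharacter ℂ W} (hχ : χ ≠ 1) {ω : ℕ → ℝ} {X : ℕ}
    (hω : ∀ m n, X < m → m ≤ n → ω n ≤ ω m) (hω0 : ∀ m, X < m → 0 ≤ ω m) (Y : ℕ) :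
    ‖∑ n ∈ Finset.Ioc X Y, ω n • χ n‖ ≤ 2 * W * ω (X + 1) := by
  refine norm_sum_Ioc_smul_le_of_antitone (g := fun n : ℕ => χ n) (fun m => ?_) hω hω0 Y
  have := norm_sum_Ioc_le_of_periodic (g := fun n : ℕ => χ n) (q := W) (B := 1)
    (Nat.pos_of_neZero W) (fun n => by simp) ?_ (fun n => χ.norm_le_one _) X m
  · simpa using this
  · rw [sum_range_natCast_zmod (fun x => χ x)]
    exact MulChar.sum_eq_zero_of_ne_one hχ

/-- The partial sums of the series defining `L(1, χ)` converge to it with an explicit rate. -/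
theorem DirichletCharacter.norm_LFunction_one_sub_sum_le {W : ℕ} [NeZero W]
    {χ : DirichletCharacter ℂ W} (hχ : χ ≠ 1) (X : ℕ) :
    ‖χ.LFunction 1 - ∑ n ∈ Finset.Ioc 0 X, χ n / n‖ ≤ 2 * W / (X + 1) := by
  have step : ∀ s : ℝ, 1 < s →
      ‖χ.LFunction s - ∑ n ∈ Finset.Ioc 0 X, χ n / (n : ℂ) ^ (s : ℂ)‖ ≤ 2 * W / (X + 1) := by
    intro s hs
    have hs' : 1 < (s : ℂ).re := by simpa using hs
    have hsum : HasSum (LSeries.term (fun n : ℕ => χ n) s) (χ.LFunction s) := by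
      rw [χ.LFunction_eq_LSeries hs']
      exact (χ.LSeriesSummable_of_one_lt_re hs').hasSum
    have hlim : Tendsto (fun Y : ℕ => ∑ n ∈ Finset.Ioc 0 Y, χ n / (n : ℂ) ^ (s : ℂ)) atTop
        (nhds (χ.LFunction s)) := by
      have h1 := (tendsto_add_atTop_iff_nat 1).2 hsum.tendsto_sum_nat
      refine h1.congr fun Y => ?_
      rw [Finset.range_eq_Ico, Finset.sum_eq_sum_Ico_succ_bot (by lia)]
      simp only [LSeries.term_zero, zero_add]
      refine Finset.sum_congr (by ext n; simp; lia) fun n hn => ?_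
      rw [LSeries.term_of_ne_zero (by simp at hn; lia)]
    have hbound : ∀ᶠ Y : ℕ in atTop, ‖∑ n ∈ Finset.Ioc 0 Y, χ n / (n : ℂ) ^ (s : ℂ)
        - ∑ n ∈ Finset.Ioc 0 X, χ n / (n : ℂ) ^ (s : ℂ)‖ ≤ 2 * W / (X + 1) := by
      filter_upwards [eventually_ge_atTop X] with Y hY
      have h2 := DirichletCharacter.norm_sum_Ioc_smul_le hχ (ω := fun n : ℕ => ((n : ℝ) ^ s)⁻¹)
        (X := X) (fun m n hm hmn => by
          have : (0 : ℝ) < m := by exact_mod_cast (by lia : 0 < m)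
          have h3 : (m : ℝ) ≤ n := by exact_mod_cast hmn
          gcongr) (fun m _ => by positivity) Y
      have e : ∑ n ∈ Finset.Ioc 0 Y, χ n / (n : ℂ) ^ (s : ℂ)
          - ∑ n ∈ Finset.Ioc 0 X, χ n / (n : ℂ) ^ (s : ℂ)
          = ∑ n ∈ Finset.Ioc X Y, ((n : ℝ) ^ s)⁻¹ • χ n := by
        rw [sub_eq_iff_eq_add, ← Finset.Ioc_union_Ioc_eq_Ioc (Nat.zero_le X) hY,
          Finset.sum_union (Finset.Ioc_disjoint_Ioc_of_le le_rfl), add_comm]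
        congr 1
        refine Finset.sum_congr rfl fun n _ => ?_
        rw [Complex.real_smul, Complex.ofReal_inv, Complex.ofReal_cpow (Nat.cast_nonneg n),
          Complex.ofReal_natCast]
        ring
      rw [e]
      refine h2.trans ?_
      have hX : (1 : ℝ) ≤ ((X + 1 : ℕ) : ℝ) := by exact_mod_cast Nat.le_add_left 1 X
      have h4 : ((X + 1 : ℕ) : ℝ) ≤ ((X + 1 : ℕ) : ℝ) ^ s := Real.self_le_rpow_of_one_le hX hs.le
      rw [div_eq_mul_inv]
      gcongr
      exact_mod_cast h4
    exact le_of_tendsto ((hlim.sub_const _).norm) hbound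
  have hcont : Tendsto (fun s : ℝ => ‖χ.LFunction s
      - ∑ n ∈ Finset.Ioc 0 X, χ n / (n : ℂ) ^ (s : ℂ)‖) (nhdsWithin 1 (Set.Ioi 1))
      (nhds ‖χ.LFunction 1 - ∑ n ∈ Finset.Ioc 0 X, χ n / n‖) := by
    have h1 : Continuous fun s : ℝ => χ.LFunction s :=
      (differentiable_LFunction hχ).continuous.comp Complex.continuous_ofReal
    have h2 : Continuous fun s : ℝ => ∑ n ∈ Finset.Ioc 0 X, χ n / (n : ℂ) ^ (s : ℂ) := by
      refine continuous_finsetSum _ fun n hn => ?_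
      have hn0 : (n : ℂ) ≠ 0 := by
        simp only [Finset.mem_Ioc] at hn
        exact_mod_cast (by lia : n ≠ 0)
      refine continuous_const.div ?_ fun s => by simp [Complex.cpow_eq_zero_iff, hn0]
      exact Complex.continuous_ofReal.const_cpow (Or.inl hn0)
    have h3 := ((h1.sub h2).norm.tendsto 1).mono_left (nhdsWithin_le_nhds (s := Set.Ioi (1 : ℝ)))
    simpa using h3
  exact le_of_tendsto hcont (eventually_nhdsWithin_of_forall fun s hs => step s hs)

theorem antitone_log_div {m n : ℕ} (hm : 3 ≤ m) (hmn : m ≤ n) :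
    Real.log n / n ≤ Real.log m / m := by
  have h3 : (3 : ℝ) ≤ m := by exact_mod_cast hm
  have h4 : (m : ℝ) ≤ n := by exact_mod_cast hmn
  have he : Real.exp 1 < 3 := Real.exp_one_lt_three
  exact Real.log_div_self_antitoneOn (by simp; linarith) (by simp; linarith) h4

open ArithmeticFunction in
theorem DirichletCharacter.exists_norm_sum_vonMangoldt_div_le {W : ℕ} [NeZero W]
    {χ : DirichletCharacter ℂ W} (hχ : χ ≠ 1) :
    ∃ C : ℝ, ∀ x : ℕ, ‖∑ n ∈ Finset.Ioc 0 x, χ n * (vonMangoldt n : ℂ) / n‖ ≤ C := by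
  set ℓ := χ.LFunction 1 with hℓ
  have hℓ0 : 0 < ‖ℓ‖ := norm_pos_iff.2 (LFunction_apply_one_ne_zero hχ)
  let F : ArithmeticFunction ℂ := ⟨fun n => χ n * (vonMangoldt n : ℂ) / n, by simp⟩
  let G : ArithmeticFunction ℂ := ⟨fun n => χ n / n, by simp⟩
  have hFG : ∀ n, (F * G) n = χ n * (Real.log n : ℂ) / n := by
    intro n
    rw [ArithmeticFunction.mul_apply, ← vonMangoldt_sum, Nat.sum_divisorsAntidiagonal
      (f := fun a b => F a * G b), Complex.ofReal_sum, Finset.mul_sum, Finset.sum_div]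
    refine Finset.sum_congr rfl fun d hd => ?_
    have hdn := (Nat.mem_divisors.1 hd).1
    have hd0 : d ≠ 0 := (Nat.pos_of_mem_divisors hd).ne'
    obtain ⟨e, rfl⟩ := hdn
    have he0 : e ≠ 0 := fun h => by simp [h] at hd
    rw [Nat.mul_div_cancel_left _ (Nat.pos_of_ne_zero hd0)]
    have hd0' : (d : ℂ) ≠ 0 := by exact_mod_cast hd0
    have he0' : (e : ℂ) ≠ 0 := by exact_mod_cast he0
    simp only [F, G, ArithmeticFunction.coe_mk, Nat.cast_mul, map_mul]
    field_simp
  obtain ⟨C₁, hC₁⟩ : ∃ C₁ : ℝ, ∀ x : ℕ,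
      ‖∑ n ∈ Finset.Ioc 0 x, χ n * (Real.log n : ℂ) / n‖ ≤ C₁ := by
    refine ⟨‖∑ n ∈ (Finset.Ioc 0 2 : Finset ℕ), χ n * (Real.log n : ℂ) / n‖ + 2 * W * (Real.log 3 / 3)
      + ‖∑ n ∈ (Finset.Ioc 0 1 : Finset ℕ), χ n * (Real.log n : ℂ) / n‖
      + ‖∑ n ∈ (Finset.Ioc 0 0 : Finset ℕ), χ n * (Real.log n : ℂ) / n‖, fun x => ?_⟩
    rcases Nat.lt_or_ge x 2 with h | h
    · have : 0 ≤ 2 * W * (Real.log 3 / 3) := by positivity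
      interval_cases x
      · linarith [norm_nonneg (∑ n ∈ (Finset.Ioc 0 2 : Finset ℕ), χ n * (Real.log n : ℂ) / n),
          norm_nonneg (∑ n ∈ (Finset.Ioc 0 1 : Finset ℕ), χ n * (Real.log n : ℂ) / n)]
      · linarith [norm_nonneg (∑ n ∈ (Finset.Ioc 0 2 : Finset ℕ), χ n * (Real.log n : ℂ) / n),
          norm_nonneg (∑ n ∈ (Finset.Ioc 0 0 : Finset ℕ), χ n * (Real.log n : ℂ) / n)]
    · rw [← Finset.Ioc_union_Ioc_eq_Ioc (Nat.zero_le 2) h,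
        Finset.sum_union (Finset.Ioc_disjoint_Ioc_of_le le_rfl)]
      have h2 := DirichletCharacter.norm_sum_Ioc_smul_le hχ
        (ω := fun n : ℕ => Real.log n / n) (X := 2)
        (fun m n hm hmn => antitone_log_div hm hmn)
        (fun m hm => div_nonneg (Real.log_natCast_nonneg m) (Nat.cast_nonneg m)) x
      have e : ∑ n ∈ Finset.Ioc 2 x, χ n * (Real.log n : ℂ) / n
          = ∑ n ∈ Finset.Ioc 2 x, (Real.log n / n) • χ n := by
        refine Finset.sum_congr rfl fun n _ => ?_
        rw [Complex.real_smul]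
        push_cast
        ring
      rw [e]
      refine (norm_add_le_of_le le_rfl h2).trans ?_
      norm_num
  refine ⟨(C₁ + 2 * W * (Real.log 4 + 4)) / ‖ℓ‖, fun x => ?_⟩
  have hsum := ArithmeticFunction.sum_Ioc_mul_eq_sum_sum F G x
  simp only [hFG] at hsum
  have hdiff : ‖(∑ n ∈ Finset.Ioc 0 x, F n) * ℓ - ∑ n ∈ Finset.Ioc 0 x,
      χ n * (Real.log n : ℂ) / n‖ ≤ 2 * W * (Real.log 4 + 4) := by
    rw [hsum, Finset.sum_mul, ← Finset.sum_sub_distrib]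
    rcases Nat.eq_zero_or_pos x with rfl | hx
    · simp only [Finset.Ioc_self, Finset.sum_empty, norm_zero]
      have := Real.log_nonneg (by norm_num : (1 : ℝ) ≤ 4)
      positivity
    have hx' : (0 : ℝ) < x := by exact_mod_cast hx
    calc _ ≤ ∑ n ∈ Finset.Ioc 0 x, 2 * W * (vonMangoldt n / x) := by
          refine norm_sum_le_of_le _ fun n hn => ?_
          have hn0 : 0 < n := (Finset.mem_Ioc.1 hn).1
          have hn0' : (0 : ℝ) < n := by exact_mod_cast hn0
          rw [← mul_sub, norm_mul]
          have h1 := DirichletCharacter.norm_LFunction_one_sub_sum_le hχ (x / n)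
          have h2 : ‖F n‖ ≤ vonMangoldt n / n := by
            simp only [F, ArithmeticFunction.coe_mk, norm_div, norm_mul, Complex.norm_natCast,
              Complex.norm_real, Real.norm_of_nonneg vonMangoldt_nonneg]
            gcongr
            exact mul_le_of_le_one_left vonMangoldt_nonneg (χ.norm_le_one _)
          have h3 : (x : ℝ) ≤ n * ((x / n : ℕ) + 1) := by
            exact_mod_cast (Nat.lt_mul_div_succ x hn0).le
          have h0 : 0 ≤ vonMangoldt n := vonMangoldt_nonneg
          calc _ ≤ vonMangoldt n / n * (2 * W / ((x / n : ℕ) + 1)) :=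
                mul_le_mul h2 h1 (norm_nonneg _) (by positivity)
            _ = 2 * W * (vonMangoldt n / (n * ((x / n : ℕ) + 1))) := by
                field_simp
            _ ≤ _ := by gcongr
      _ = 2 * W * (Chebyshev.psi x / x) := by
          rw [Chebyshev.psi, Nat.floor_natCast, ← Finset.mul_sum, Finset.sum_div]
      _ ≤ _ := by
          gcongr
          rw [div_le_iff₀ hx']
          exact Chebyshev.psi_le_const_mul_self hx'.le
  rw [le_div_iff₀ hℓ0, ← norm_mul]
  have e : ∑ n ∈ Finset.Ioc 0 x, χ n * (vonMangoldt n : ℂ) / n = ∑ n ∈ Finset.Ioc 0 x, F n := rfl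
  rw [e, ← sub_add_cancel ((∑ n ∈ Finset.Ioc 0 x, F n) * ℓ)
    (∑ n ∈ Finset.Ioc 0 x, χ n * (Real.log n : ℂ) / n)]
  exact (norm_add_le_of_le hdiff (hC₁ x)).trans (by linarith)

open ArithmeticFunction in
theorem exists_abs_sum_vonMangoldt_div_sub_log_le :
    ∃ C : ℝ, ∀ x : ℕ, 0 < x →
      |∑ n ∈ Finset.Ioc 0 x, vonMangoldt n / n - Real.log x| ≤ C := by
  refine ⟨Real.log 4 + 6, fun x hx => ?_⟩
  have hx' : (0 : ℝ) < x := by exact_mod_cast hx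
  have hlogfac : Real.log (x.factorial) = ∑ n ∈ Finset.Ioc 0 x, vonMangoldt n * (x / n : ℕ) := by
    rw [← ArithmeticFunction.sum_Ioc_mul_zeta_eq_sum, vonMangoldt_mul_zeta]
    have : ∀ x : ℕ, Real.log (x.factorial) = ∑ n ∈ Finset.Ioc 0 x, Real.log n := by
      intro x
      induction x with
      | zero => simp
      | succ x ih =>
        rw [Finset.sum_Ioc_succ_top (by lia), ← ih, Nat.factorial_succ, Nat.cast_mul,
          Real.log_mul (by positivity) (by positivity), add_comm]
    rw [this]
    rfl
  have h1 : Real.log (x.factorial) ≤ x * Real.log x := by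
    rw [← Real.log_pow]
    exact Real.log_le_log (by positivity) (by exact_mod_cast Nat.factorial_le_pow x)
  have h2 : x * Real.log x - x ≤ Real.log (x.factorial) := by
    have := Stirling.le_log_factorial_stirling hx.ne'
    have h3 : 0 ≤ Real.log x := Real.log_natCast_nonneg x
    have h4 : 0 ≤ Real.log (2 * Real.pi) :=
      Real.log_nonneg (by linarith [Real.pi_gt_three])
    linarith
  have hψ : ∑ n ∈ Finset.Ioc 0 x, vonMangoldt n ≤ (Real.log 4 + 4) * x := by
    have := Chebyshev.psi_le_const_mul_self hx'.le
    rwa [Chebyshev.psi, Nat.floor_natCast] at this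
  have h5 : x * ∑ n ∈ Finset.Ioc 0 x, vonMangoldt n / n
      ≤ Real.log (x.factorial) + ∑ n ∈ Finset.Ioc 0 x, vonMangoldt n := by
    rw [hlogfac, ← Finset.sum_add_distrib, Finset.mul_sum]
    refine Finset.sum_le_sum fun n hn => ?_
    have hn0 : 0 < n := (Finset.mem_Ioc.1 hn).1
    have hn0' : (0 : ℝ) < n := by exact_mod_cast hn0
    have h3 : (x : ℝ) ≤ n * ((x / n : ℕ) + 1) := by
      exact_mod_cast (Nat.lt_mul_div_succ x hn0).le
    have h4 : (x : ℝ) / n ≤ (x / n : ℕ) + 1 := by rw [div_le_iff₀ hn0']; linarith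
    have h0 : 0 ≤ vonMangoldt n := vonMangoldt_nonneg
    calc _ = vonMangoldt n * (x / n) := by ring
      _ ≤ vonMangoldt n * ((x / n : ℕ) + 1) := by gcongr
      _ = _ := by ring
  have h6 : Real.log (x.factorial) ≤ x * ∑ n ∈ Finset.Ioc 0 x, vonMangoldt n / n := by
    rw [hlogfac, Finset.mul_sum]
    refine Finset.sum_le_sum fun n hn => ?_
    have h0 : 0 ≤ vonMangoldt n := vonMangoldt_nonneg
    calc _ ≤ vonMangoldt n * (x / n) := by
          gcongr
          exact Nat.cast_div_le
      _ = _ := by ring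
  have h7 : 0 < Real.log 4 := Real.log_pos (by norm_num)
  rw [abs_le]
  constructor
  · have : x * (Real.log x - 1) ≤ x * ∑ n ∈ Finset.Ioc 0 x, vonMangoldt n / n := by linarith
    have := le_of_mul_le_mul_left this hx'
    linarith
  · have : x * ∑ n ∈ Finset.Ioc 0 x, vonMangoldt n / n ≤ x * (Real.log x + (Real.log 4 + 4)) := by
      linarith
    have := le_of_mul_le_mul_left this hx'
    linarith

open ArithmeticFunction in
theorem exists_sum_not_prime_vonMangoldt_div_le :
    ∃ C : ℝ, ∀ x : ℕ, ∑ n ∈ (Finset.Ioc 0 x).filter (fun n => ¬ n.Prime), vonMangoldt n / n ≤ C := by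
  have hs := ArithmeticFunction.vonMangoldt.summable_residueClass_non_primes_div (q := 1) (a := 0)
  refine ⟨_, fun x => le_trans (le_of_eq ?_) (hs.sum_le_tsum (Finset.Ioc 0 x) fun n _ => ?_)⟩
  · rw [Finset.sum_filter]
    refine Finset.sum_congr rfl fun n _ => ?_
    have h : (n : ZMod 1) = 0 := Subsingleton.elim _ _
    by_cases hp : n.Prime
    · simp [hp]
    · simp [hp, ArithmeticFunction.vonMangoldt.residueClass, Set.indicator, h]
  · split_ifs
    · simp
    · exact div_nonneg (ArithmeticFunction.vonMangoldt.residueClass_nonneg _ _) (Nat.cast_nonneg n)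

/-- **Mertens' first theorem.** -/
theorem exists_abs_sum_prime_log_div_sub_log_le :
    ∃ C : ℝ, ∀ x : ℕ, 0 < x →
      |∑ p ∈ (Finset.Ioc 0 x).filter Nat.Prime, Real.log p / p - Real.log x| ≤ C := by
  obtain ⟨C₁, h₁⟩ := exists_abs_sum_vonMangoldt_div_sub_log_le
  obtain ⟨C₂, h₂⟩ := exists_sum_not_prime_vonMangoldt_div_le
  refine ⟨C₁ + C₂, fun x hx => ?_⟩
  have h3 := h₁ x hx
  have h4 := h₂ x
  rw [← Finset.sum_filter_add_sum_filter_not _ Nat.Prime] at h3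
  have e : ∑ p ∈ (Finset.Ioc 0 x).filter Nat.Prime, Real.log p / p
      = ∑ p ∈ (Finset.Ioc 0 x).filter Nat.Prime, ArithmeticFunction.vonMangoldt p / p :=
    Finset.sum_congr rfl fun p hp => by
      rw [ArithmeticFunction.vonMangoldt_apply_prime (Finset.mem_filter.1 hp).2]
  rw [e]
  have h5 : 0 ≤ ∑ n ∈ (Finset.Ioc 0 x).filter (fun n => ¬ n.Prime),
      ArithmeticFunction.vonMangoldt n / n :=
    Finset.sum_nonneg fun n _ =>
      div_nonneg ArithmeticFunction.vonMangoldt_nonneg (Nat.cast_nonneg n)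
  rw [abs_le] at h3 ⊢
  constructor <;> linarith

theorem DirichletCharacter.exists_norm_sum_prime_log_div_le {W : ℕ} [NeZero W]
    {χ : DirichletCharacter ℂ W} (hχ : χ ≠ 1) :
    ∃ C : ℝ, ∀ x : ℕ,
      ‖∑ p ∈ (Finset.Ioc 0 x).filter Nat.Prime, χ p * (Real.log p : ℂ) / p‖ ≤ C := by
  obtain ⟨C₁, h₁⟩ := exists_norm_sum_vonMangoldt_div_le hχ
  obtain ⟨C₂, h₂⟩ := exists_sum_not_prime_vonMangoldt_div_le
  refine ⟨C₁ + C₂, fun x => ?_⟩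
  have h3 := h₁ x
  have h4 : ‖∑ n ∈ (Finset.Ioc 0 x).filter (fun n => ¬ n.Prime),
      χ n * (ArithmeticFunction.vonMangoldt n : ℂ) / n‖ ≤ C₂ := by
    refine (norm_sum_le_of_le _ fun n _ => ?_).trans (h₂ x)
    rw [norm_div, norm_mul, Complex.norm_natCast, Complex.norm_real,
      Real.norm_of_nonneg ArithmeticFunction.vonMangoldt_nonneg]
    gcongr
    exact mul_le_of_le_one_left ArithmeticFunction.vonMangoldt_nonneg (χ.norm_le_one _)
  rw [← Finset.sum_filter_add_sum_filter_not _ Nat.Prime] at h3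
  have e : ∑ p ∈ (Finset.Ioc 0 x).filter Nat.Prime, χ p * (Real.log p : ℂ) / p
      = ∑ p ∈ (Finset.Ioc 0 x).filter Nat.Prime,
        χ p * (ArithmeticFunction.vonMangoldt p : ℂ) / p :=
    Finset.sum_congr rfl fun p hp => by
      rw [ArithmeticFunction.vonMangoldt_apply_prime (Finset.mem_filter.1 hp).2]
  rw [e, ← add_sub_cancel_right (∑ p ∈ (Finset.Ioc 0 x).filter Nat.Prime,
        χ p * (ArithmeticFunction.vonMangoldt p : ℂ) / p)
        (∑ n ∈ (Finset.Ioc 0 x).filter (fun n => ¬ n.Prime),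
      χ n * (ArithmeticFunction.vonMangoldt n : ℂ) / n)]
  exact norm_sub_le_of_le h3 h4

end Mertens

section ProductSums

variable {ι β : Type*} [Fintype ι] [DecidableEq ι] [Fintype β]

theorem Fintype.sum_prod_pi {R : Type*} [CommSemiring R] (u : ι → β → R) :
    ∑ s : ι → β, ∏ i, u i (s i) = ∏ i, ∑ o, u i o := by
  rw [Finset.prod_univ_sum, Fintype.piFinset_univ]

theorem Fintype.sum_pi_le_of_update {A B : (ι → β) → ℝ} {c : ℝ} (a : ι)
    (h : ∀ s, ∑ o, A (Function.update s a o) ≤ c * ∑ o, B (Function.update s a o)) :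
    ∑ s, A s ≤ c * ∑ s, B s := by
  have split : ∀ G : (ι → β) → ℝ, ∑ s, G s
      = ∑ r : {j // j ≠ a} → β, ∑ o, G ((Equiv.funSplitAt a β).symm (o, r)) := by
    intro G
    rw [← Equiv.sum_comp (Equiv.funSplitAt a β).symm G, Fintype.sum_prod_type, Finset.sum_comm]
  rw [split A, split B, Finset.mul_sum]
  refine Finset.sum_le_sum fun r _ => ?_
  rcases isEmpty_or_nonempty β with hβ | ⟨⟨o₀⟩⟩
  · rw [Fintype.sum_empty, Fintype.sum_empty, mul_zero]
  · have hup : ∀ o, (Equiv.funSplitAt a β).symm (o, r)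
        = Function.update ((Equiv.funSplitAt a β).symm (o₀, r)) a o := by
      intro o
      ext j
      by_cases hj : j = a
      · rw [hj, Function.update_self, Equiv.funSplitAt_symm_apply, dif_pos rfl]
      · rw [Function.update_of_ne hj, Equiv.funSplitAt_symm_apply,
          Equiv.funSplitAt_symm_apply, dif_neg hj, dif_neg hj]
    have := h ((Equiv.funSplitAt a β).symm (o₀, r))
    simpa only [← hup] using this

/-- Replacing product weights one coordinate at a time. -/
theorem Fintype.sum_mul_prod_pi_le {F : (ι → β) → ℝ} {u v : ι → β → ℝ} {c : ι → ℝ}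
    (hu : ∀ i o, 0 ≤ u i o) (hv : ∀ i o, 0 ≤ v i o) (hc : ∀ i, 0 ≤ c i)
    (h : ∀ i s, ∑ o, F (Function.update s i o) * u i o
      ≤ c i * ∑ o, F (Function.update s i o) * v i o) :
    ∑ s, F s * ∏ i, u i (s i) ≤ (∏ i, c i) * ∑ s, F s * ∏ i, v i (s i) := by
  have key : ∀ A : Finset ι, ∑ s, F s * ∏ i, (if i ∈ A then u i (s i) else v i (s i))
      ≤ (∏ i ∈ A, c i) * ∑ s, F s * ∏ i, v i (s i) := by
    intro A
    induction A using Finset.induction_on with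
    | empty => simp
    | insert a A ha ih =>
      rw [Finset.prod_insert ha, mul_assoc]
      refine le_trans ?_ (mul_le_mul_of_nonneg_left ih (hc a))
      refine Fintype.sum_pi_le_of_update a fun s => ?_
      have hR : 0 ≤ ∏ i ∈ Finset.univ.erase a, (if i ∈ A then u i (s i) else v i (s i)) :=
        Finset.prod_nonneg fun i _ => by split_ifs <;> [exact hu _ _; exact hv _ _]
      have e1 : ∀ o, ∏ i, (if i ∈ insert a A then u i (Function.update s a o i)
            else v i (Function.update s a o i))
          = u a o * ∏ i ∈ Finset.univ.erase a, (if i ∈ A then u i (s i) else v i (s i)) := by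
        intro o
        rw [← Finset.mul_prod_erase _ _ (Finset.mem_univ a)]
        congr 1
        · simp
        · refine Finset.prod_congr rfl fun i hi => ?_
          have hia := Finset.ne_of_mem_erase hi
          simp [hia]
      have e2 : ∀ o, ∏ i, (if i ∈ A then u i (Function.update s a o i)
            else v i (Function.update s a o i))
          = v a o * ∏ i ∈ Finset.univ.erase a, (if i ∈ A then u i (s i) else v i (s i)) := by
        intro o
        rw [← Finset.mul_prod_erase _ _ (Finset.mem_univ a)]
        congr 1
        · simp [ha]
        · refine Finset.prod_congr rfl fun i hi => ?_
          have hia := Finset.ne_of_mem_erase hi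
          simp [Function.update_of_ne hia]
      simp only [e1, e2, ← mul_assoc]
      rw [← Finset.sum_mul, ← Finset.sum_mul, ← mul_assoc]
      exact mul_le_mul_of_nonneg_right (h a s) hR
  simpa using key Finset.univ

/-- Product measures: expectations of products. -/
theorem Fintype.sum_prod_mul_prod_le {m ψ : ι → β → ℝ} {c : ι → ℝ}
    (hm : ∀ i o, 0 ≤ m i o) (hψ : ∀ i o, 0 ≤ ψ i o)
    (h : ∀ i, ∑ o, m i o * ψ i o ≤ c i * ∑ o, m i o) :
    ∑ s : ι → β, (∏ i, m i (s i)) * ∏ i, ψ i (s i) ≤ (∏ i, c i) * ∏ i, ∑ o, m i o := by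
  simp_rw [← Finset.prod_mul_distrib]
  rw [Fintype.sum_prod_pi fun i o => m i o * ψ i o]
  exact Finset.prod_le_prod (fun i _ => Finset.sum_nonneg fun o _ => mul_nonneg (hm i o) (hψ i o))
    fun i _ => h i

/-- A function on `ι → β` which does not increase when a coordinate is moved away from `b`. -/
def IsDecr (b : β) (F : (ι → β) → ℝ) : Prop :=
  ∀ s i o, F (Function.update s i o) ≤ F (Function.update s i b)

theorem IsDecr.mul {b : β} {F G : (ι → β) → ℝ} (hF : IsDecr b F) (hG : IsDecr b G)
    (hF0 : ∀ s, 0 ≤ F s) (hG0 : ∀ s, 0 ≤ G s) : IsDecr b fun s => F s * G s :=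
  fun s i o => mul_le_mul (hF s i o) (hG s i o) (hG0 _) (hF0 _)

theorem IsDecr.prod {b : β} {κ : Type*} (T : Finset κ) {F : κ → (ι → β) → ℝ}
    (hF : ∀ l ∈ T, IsDecr b (F l)) (hF0 : ∀ l ∈ T, ∀ s, 0 ≤ F l s) :
    IsDecr b fun s => ∏ l ∈ T, F l s :=
  fun s i o => Finset.prod_le_prod (fun l hl => hF0 l hl _) fun l hl => hF l hl s i o

theorem IsDecr.comp {γ : Type*} {b : β} {F : (ι → β) → ℝ} (hF : IsDecr b F) {f : γ → β} {c : γ}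
    (hf : f c = b) : IsDecr c fun s : ι → γ => F (f ∘ s) := by
  intro s i o
  simp only [Function.comp_update, hf]
  exact hF _ _ _

/-- For decreasing functions, local weights may be replaced at a controlled cost. -/
theorem IsDecr.sum_mul_prod_le [DecidableEq β] {b : β} {F : (ι → β) → ℝ} (hF : IsDecr b F)
    (hF0 : ∀ s, 0 ≤ F s) {u v : ι → β → ℝ} {c : ι → ℝ}
    (hu : ∀ i o, 0 ≤ u i o) (hv : ∀ i o, 0 ≤ v i o) (hc : ∀ i, 0 ≤ c i)
    (huv : ∀ i, u i b + ∑ o ∈ Finset.univ.erase b, max (u i o - c i * v i o) 0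
      ≤ c i * v i b) :
    ∑ s, F s * ∏ i, u i (s i) ≤ (∏ i, c i) * ∑ s, F s * ∏ i, v i (s i) := by
  refine Fintype.sum_mul_prod_pi_le hu hv hc fun i s => ?_
  rw [← Finset.add_sum_erase _ _ (Finset.mem_univ b), ← Finset.add_sum_erase _ _
    (Finset.mem_univ b)]
  set f0 := F (Function.update s i b) with hf0
  have h1 : ∀ o, F (Function.update s i o) * u i o
      ≤ f0 * max (u i o - c i * v i o) 0 + c i * (F (Function.update s i o) * v i o) := by
    intro o
    have h2 := mul_le_mul_of_nonneg_left (le_max_left (u i o - c i * v i o) 0)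
      (hF0 (Function.update s i o))
    have h3 := mul_le_mul_of_nonneg_right (hF s i o) (le_max_right (u i o - c i * v i o) 0)
    linarith
  have h4 := Finset.sum_le_sum fun o (_ : o ∈ Finset.univ.erase b) => h1 o
  rw [Finset.sum_add_distrib, ← Finset.mul_sum, ← Finset.mul_sum] at h4
  have h5 := mul_le_mul_of_nonneg_left (huv i) (hF0 (Function.update s i b))
  rw [← hf0] at h5
  linarith

/-- Comparison of products of perturbed factors. -/
theorem Finset.two_mul_prod_sub_prod_le {κ : Type*} (T : Finset κ) {x y : κ → ℝ}
    (hx : ∀ l ∈ T, 0 ≤ x l) :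
    2 * ∏ l ∈ T, x l - ∏ l ∈ T, (x l + |y l - x l|) ≤ ∏ l ∈ T, y l := by
  classical
  have key : |∏ l ∈ T, y l - ∏ l ∈ T, x l| ≤ ∏ l ∈ T, (x l + |y l - x l|) - ∏ l ∈ T, x l := by
    induction T using Finset.induction_on with
    | empty => simp
    | insert a T ha ih =>
      have ih := ih fun l hl => hx l (Finset.mem_insert_of_mem hl)
      have hxa := hx a (Finset.mem_insert_self _ _)
      have hT : 0 ≤ ∏ l ∈ T, x l :=
        Finset.prod_nonneg fun l hl => hx l (Finset.mem_insert_of_mem hl)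
      rw [Finset.prod_insert ha, Finset.prod_insert ha, Finset.prod_insert ha]
      have e : y a * ∏ l ∈ T, y l - x a * ∏ l ∈ T, x l
          = (y a - x a) * (∏ l ∈ T, y l) + x a * (∏ l ∈ T, y l - ∏ l ∈ T, x l) := by ring
      rw [e]
      refine (abs_add_le _ _).trans ?_
      rw [abs_mul, abs_mul, abs_of_nonneg hxa]
      have h1 : |∏ l ∈ T, y l| ≤ ∏ l ∈ T, (x l + |y l - x l|) := by
        have := abs_sub_abs_le_abs_sub (∏ l ∈ T, y l) (∏ l ∈ T, x l)
        rw [abs_of_nonneg hT] at this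
        linarith
      have h2 := mul_le_mul_of_nonneg_left h1 (abs_nonneg (y a - x a))
      have h3 := mul_le_mul_of_nonneg_left ih hxa
      linarith
  have := neg_abs_le (∏ l ∈ T, y l - ∏ l ∈ T, x l)
  linarith

end ProductSums

section Tuples

variable {ι J : Type*} [Fintype ι] [DecidableEq ι] [Fintype J] [DecidableEq J]

/-- A map `s : ι → Option J` encodes a `J`-tuple of disjoint subsets of `ι`. -/
def entrySet (s : ι → Option J) (j : J) : Finset ι := Finset.univ.filter fun i => s i = some j

/-- The product of the numbers `P i` over a set of indices. -/
def setProd (P : ι → ℕ) (S : Finset ι) : ℕ := ∏ i ∈ S, P i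

/-- The product of all entries of the tuple encoded by `s`. -/
def tupleSize (P : ι → ℕ) (s : ι → Option J) : ℕ :=
  setProd P (Finset.univ.filter fun i => s i ≠ none)

/-- The `j`-th entry of the tuple encoded by `s`. -/
def tupleEntry (P : ι → ℕ) (s : ι → Option J) (j : J) : ℕ := setProd P (entrySet s j)

variable {P : ι → ℕ}

theorem setProd_pos (hP : ∀ i, 0 < P i) (S : Finset ι) : 0 < setProd P S :=
  Finset.prod_pos fun i _ => hP i

theorem setProd_mono (hP : ∀ i, 0 < P i) {S T : Finset ι} (h : S ⊆ T) :
    setProd P S ≤ setProd P T :=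
  Finset.prod_le_prod_of_subset_of_one_le' h fun i _ _ => hP i

theorem tupleSize_pos (hP : ∀ i, 0 < P i) (s : ι → Option J) : 0 < tupleSize P s :=
  setProd_pos hP _

theorem entrySet_injective : Function.Injective (entrySet : (ι → Option J) → J → Finset ι) := by
  intro s t h
  ext i j
  have := Finset.ext_iff.1 (congrFun h j) i
  simpa [entrySet] using this

theorem prod_tupleEntry (P : ι → ℕ) (s : ι → Option J) :
    ∏ j, tupleEntry P s j = tupleSize P s := by
  simp only [tupleEntry, tupleSize, setProd, entrySet, Finset.prod_filter]
  rw [Finset.prod_comm]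
  refine Finset.prod_congr rfl fun i _ => ?_
  rcases hs : s i with _ | j <;> simp [Finset.prod_ite_eq]

theorem one_div_tupleSize (P : ι → ℕ) (s : ι → Option J) :
    (1 : ℝ) / tupleSize P s = ∏ i, if s i = none then (1 : ℝ) else 1 / P i := by
  rw [tupleSize, setProd, Nat.cast_prod, one_div, ← Finset.prod_inv_distrib, Finset.prod_filter]
  refine Finset.prod_congr rfl fun i _ => ?_
  by_cases h : s i = none <;> simp [h]

theorem isDecr_entry (hP : ∀ i, 0 < P i) {g : ℕ → ℝ} (hg : Antitone g) (j : J) :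
    IsDecr none fun s : ι → Option J => g (tupleEntry P s j) := by
  intro s i o
  refine hg (setProd_mono hP fun l hl => ?_)
  simp only [entrySet, Finset.mem_filter, Finset.mem_univ, true_and] at hl ⊢
  by_cases h : l = i
  · subst h; simp at hl
  · rwa [Function.update_of_ne h] at hl ⊢

theorem isDecr_size (hP : ∀ i, 0 < P i) {g : ℕ → ℝ} (hg : Antitone g) :
    IsDecr none fun s : ι → Option J => g (tupleSize P s) := by
  intro s i o
  refine hg (setProd_mono hP fun l hl => ?_)
  simp only [Finset.mem_filter, Finset.mem_univ, true_and] at hl ⊢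
  by_cases h : l = i
  · subst h; simp at hl
  · rwa [Function.update_of_ne h] at hl ⊢

/-- The sum of `G n / n` over the numbers `n` composed of distinct `P i`. -/
noncomputable def setSum (P : ι → ℕ) (G : ℕ → ℝ) : ℝ :=
  ∑ S : Finset ι, G (setProd P S) / setProd P S

theorem setSum_nonneg {G : ℕ → ℝ} (hG : ∀ n, 0 ≤ G n) : 0 ≤ setSum P G :=
  Finset.sum_nonneg fun _ _ => div_nonneg (hG _) (Nat.cast_nonneg _)

theorem le_setSum {G : ℕ → ℝ} (hG : ∀ n, 0 ≤ G n) : G 1 ≤ setSum P G := by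
  have := Finset.single_le_sum (f := fun S : Finset ι => G (setProd P S) / setProd P S)
    (fun S _ => div_nonneg (hG _) (Nat.cast_nonneg _)) (Finset.mem_univ ∅)
  simpa [setProd, setSum] using this

theorem prod_setSum (G : J → ℕ → ℝ) :
    ∏ j, setSum P (G j)
      = ∑ S : J → Finset ι, ∏ j, G j (setProd P (S j)) / setProd P (S j) := by
  simp only [setSum]
  rw [Finset.prod_univ_sum, Fintype.piFinset_univ]

theorem prod_tupleEntry_div (G : J → ℕ → ℝ) (s : ι → Option J) :
    ∏ j, G j (setProd P (entrySet s j)) / setProd P (entrySet s j)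
      = (∏ j, G j (tupleEntry P s j)) / tupleSize P s := by
  rw [Finset.prod_div_distrib, ← prod_tupleEntry, Nat.cast_prod]
  rfl

theorem sum_prod_tupleEntry_div_le {G : J → ℕ → ℝ} (hG : ∀ j n, 0 ≤ G j n) :
    ∑ s : ι → Option J, (∏ j, G j (tupleEntry P s j)) / tupleSize P s
      ≤ ∏ j, setSum P (G j) := by
  rw [prod_setSum]
  simp_rw [← prod_tupleEntry_div]
  rw [← Finset.sum_image (s := Finset.univ)
    (f := fun S : J → Finset ι => ∏ j, G j (setProd P (S j)) / setProd P (S j))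
    fun a _ b _ h => entrySet_injective h]
  exact Finset.sum_le_univ_sum_of_nonneg fun S =>
    Finset.prod_nonneg fun j _ => div_nonneg (hG _ _) (Nat.cast_nonneg _)

theorem exists_entrySet_eq {S : J → Finset ι} (hS : ∀ j j', j ≠ j' → Disjoint (S j) (S j')) :
    ∃ s : ι → Option J, entrySet s = S := by
  classical
  refine ⟨fun i => if h : ∃ j, i ∈ S j then some h.choose else none, ?_⟩
  funext j
  ext i
  simp only [entrySet, Finset.mem_filter, Finset.mem_univ, true_and]
  constructor
  · intro h
    split_ifs at h with hi
    rw [Option.some.injEq] at h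
    exact h ▸ hi.choose_spec
  · intro h
    have hi : ∃ j, i ∈ S j := ⟨j, h⟩
    rw [dif_pos hi, Option.some.injEq]
    by_contra hne
    exact Finset.disjoint_left.1 (hS _ _ hne) hi.choose_spec h

theorem sum_mem_div_le (hP : ∀ i, 0 < P i) {G : ℕ → ℝ} (hG0 : ∀ n, 0 ≤ G n) (hG : Antitone G)
    (i : ι) :
    ∑ S : Finset ι, G (setProd P S) / setProd P S * (if i ∈ S then 1 else 0)
      ≤ 1 / P i * setSum P G := by
  simp_rw [mul_ite, mul_one, mul_zero]
  rw [← Finset.sum_filter, setSum, Finset.mul_sum]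
  have hinj : Set.InjOn (fun S : Finset ι => S.erase i)
      (Finset.univ.filter fun S : Finset ι => i ∈ S) := by
    intro S hS T hT h
    simp only [Finset.coe_filter, Finset.mem_univ, true_and, Set.mem_ofPred_eq] at hS hT
    rw [← Finset.insert_erase hS, ← Finset.insert_erase hT]
    exact congrArg _ h
  refine le_trans (Finset.sum_le_sum (g := fun S => 1 / (P i : ℝ)
    * (G (setProd P (S.erase i)) / setProd P (S.erase i))) fun S hS => ?_) ?_
  · have hi := (Finset.mem_filter.1 hS).2
    have h1 : setProd P S = P i * setProd P (S.erase i) := (Finset.mul_prod_erase _ _ hi).symm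
    have h2 : G (setProd P S) ≤ G (setProd P (S.erase i)) :=
      hG (setProd_mono hP (Finset.erase_subset _ _))
    have hp1 : (0 : ℝ) < P i := Nat.cast_pos.2 (hP i)
    have hp2 : (0 : ℝ) < setProd P (S.erase i) := Nat.cast_pos.2 (setProd_pos hP _)
    rw [← mul_div_mul_comm, one_mul, ← Nat.cast_mul, ← h1]
    exact div_le_div_of_nonneg_right h2 (Nat.cast_nonneg _)
  · rw [← Finset.sum_image (f := fun S => 1 / (P i : ℝ) * (G (setProd P S) / setProd P S)) hinj]
    exact Finset.sum_le_univ_sum_of_nonneg fun S =>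
      mul_nonneg (by positivity) (div_nonneg (hG0 _) (Nat.cast_nonneg _))

theorem sum_prod_setProd_mul_prod_le {G ψ : J → Finset ι → ℝ} {c : J → ℝ}
    (hG : ∀ j S, 0 ≤ G j S) (hψ : ∀ j S, 0 ≤ ψ j S)
    (h : ∀ j, ∑ S, G j S * ψ j S ≤ c j * ∑ S, G j S) :
    ∑ S : J → Finset ι, (∏ j, G j (S j)) * ∏ j, ψ j (S j)
      ≤ (∏ j, c j) * ∏ j, ∑ S, G j S :=
  Fintype.sum_prod_mul_prod_le hG hψ h

/-- The sum over tuples of bounded size is nearly the unrestricted product of sums. -/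
theorem le_sum_tupleSize_le (hP : ∀ i, 0 < P i) {G : J → ℕ → ℝ} (hG0 : ∀ j n, 0 ≤ G j n)
    (hG : ∀ j, Antitone (G j)) {lam : J → ℝ} {R : ℕ} (hR : 1 < R)
    (hlam : ∀ j, setSum P (fun n => G j n * Real.log n) ≤ lam j * setSum P (G j)) :
    (1 - (∑ j, lam j) / Real.log R - (Fintype.card J : ℝ) ^ 2 * ∑ i, (1 / (P i : ℝ)) ^ 2)
        * ∏ j, setSum P (G j)
      ≤ ∑ s : ι → Option J,
        (if tupleSize P s ≤ R then ∏ j, G j (tupleEntry P s j) else 0) / tupleSize P s := by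
  classical
  have hlogR : 0 < Real.log R := Real.log_pos (by exact_mod_cast hR)
  set w : (J → Finset ι) → ℝ := fun S => ∏ j, G j (setProd P (S j)) / setProd P (S j) with hw
  have hwj : ∀ j S, 0 ≤ G j (setProd P S) / setProd P S := fun j S =>
    div_nonneg (hG0 _ _) (Nat.cast_nonneg _)
  have hw0 : ∀ S, 0 ≤ w S := fun S => Finset.prod_nonneg fun j _ => hwj _ _
  have hwsum : ∑ S, w S = ∏ j, setSum P (G j) := (prod_setSum G).symm
  -- the logarithmic term
  have h1 : ∀ j, ∑ S, w S * Real.log (setProd P (S j)) ≤ lam j * ∏ j, setSum P (G j) := by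
    intro j
    have := sum_prod_setProd_mul_prod_le (G := fun j S => G j (setProd P S) / setProd P S)
      (ψ := fun l S => if l = j then Real.log (setProd P S) else 1)
      (c := fun l => if l = j then lam j else 1) hwj
      (fun l S => by split_ifs <;> [exact Real.log_natCast_nonneg _; exact zero_le_one]) ?_
    · simpa [Finset.prod_ite_eq', hw, setSum] using this
    · intro l
      by_cases hl : l = j
      · subst hl
        simp only [if_true]
        refine le_trans (le_of_eq ?_) (hlam l)
        exact Finset.sum_congr rfl fun S _ => by ring
      · simp [hl]
  -- the disjointness term
  have h2 : ∀ j j', j ≠ j' → ∀ i, ∑ S, w S * (if i ∈ S j ∧ i ∈ S j' then 1 else 0)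
      ≤ (1 / (P i : ℝ)) ^ 2 * ∏ j, setSum P (G j) := by
    intro j j' hjj i
    have := sum_prod_setProd_mul_prod_le (G := fun j S => G j (setProd P S) / setProd P S)
      (ψ := fun l S => if l = j ∨ l = j' then (if i ∈ S then 1 else 0) else 1)
      (c := fun l => if l = j ∨ l = j' then 1 / (P i : ℝ) else 1) hwj
      (fun l S => by split_ifs <;> norm_num) ?_
    · have e : ∀ f : J → ℝ, ∏ l, (if l = j ∨ l = j' then f l else 1) = f j * f j' := by
        intro f
        rw [← Finset.prod_filter]
        have : (Finset.univ.filter fun l => l = j ∨ l = j') = {j, j'} := by ext; simp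
        rw [this, Finset.prod_pair hjj]
      rw [e (fun _ => 1 / (P i : ℝ)), ← sq] at this
      refine le_trans (le_of_eq (Finset.sum_congr rfl fun S _ => ?_)) this
      rw [e (fun l => if i ∈ S l then (1 : ℝ) else 0)]
      congr 1
      by_cases ha : i ∈ S j <;> by_cases hb : i ∈ S j' <;> simp [ha, hb]
    · intro l
      by_cases hl : l = j ∨ l = j'
      · simp only [hl, if_true]
        exact sum_mem_div_le hP (hG0 l) (hG l) i
      · simp [hl]
  -- the pointwise inequality
  set good : (J → Finset ι) → Prop := fun S =>
    (∀ j j', j ≠ j' → Disjoint (S j) (S j')) ∧ ∏ j, setProd P (S j) ≤ R with hgood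
  have hpt : ∀ S, w S * (1 - (∑ j, Real.log (setProd P (S j))) / Real.log R
      - ∑ jj ∈ (Finset.univ : Finset J).offDiag, ∑ i, if i ∈ S jj.1 ∧ i ∈ S jj.2 then 1 else 0)
        ≤ if good S then w S else 0 := by
    intro S
    have hl0 : ∀ j, 0 ≤ Real.log (setProd P (S j)) := fun j => Real.log_natCast_nonneg _
    have hA : 0 ≤ (∑ j, Real.log (setProd P (S j))) / Real.log R :=
      div_nonneg (Finset.sum_nonneg fun j _ => hl0 j) hlogR.le
    have hB : 0 ≤ ∑ jj ∈ (Finset.univ : Finset J).offDiag, ∑ i,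
        if i ∈ S jj.1 ∧ i ∈ S jj.2 then (1 : ℝ) else 0 :=
      Finset.sum_nonneg fun _ _ => Finset.sum_nonneg fun _ _ => by split_ifs <;> norm_num
    split_ifs with hg
    · have := mul_le_mul_of_nonneg_left (show (1 - (∑ j, Real.log (setProd P (S j)))
        / Real.log R - ∑ jj ∈ (Finset.univ : Finset J).offDiag, ∑ i,
          if i ∈ S jj.1 ∧ i ∈ S jj.2 then (1 : ℝ) else 0) ≤ 1 by linarith) (hw0 S)
      simpa using this
    · refine mul_nonpos_of_nonneg_of_nonpos (hw0 S) ?_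
      rw [hgood, not_and_or] at hg
      rcases hg with hg | hg
      · push Not at hg
        obtain ⟨j, j', hjj, hd⟩ := hg
        obtain ⟨i, hi1, hi2⟩ := Finset.not_disjoint_iff.1 hd
        have h3 : (1 : ℝ) ≤ ∑ jj ∈ (Finset.univ : Finset J).offDiag, ∑ i,
            if i ∈ S jj.1 ∧ i ∈ S jj.2 then (1 : ℝ) else 0 := by
          refine le_trans ?_ (Finset.single_le_sum (f := fun jj : J × J => ∑ i,
            if i ∈ S jj.1 ∧ i ∈ S jj.2 then (1 : ℝ) else 0) (fun _ _ => Finset.sum_nonneg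
              fun _ _ => by split_ifs <;> norm_num) (show (j, j') ∈ _ by simpa using hjj))
          refine le_trans ?_ (Finset.single_le_sum (f := fun i =>
            if i ∈ S j ∧ i ∈ S j' then (1 : ℝ) else 0) (fun _ _ => by split_ifs <;> norm_num)
              (Finset.mem_univ i))
          simp [hi1, hi2]
        linarith
      · push Not at hg
        have h3 : 1 ≤ (∑ j, Real.log (setProd P (S j))) / Real.log R := by
          rw [one_le_div hlogR, ← Real.log_prod fun j _ => by
            exact_mod_cast (setProd_pos hP (S j)).ne']
          refine Real.log_le_log (by exact_mod_cast zero_lt_one.trans hR) ?_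
          exact_mod_cast hg.le
        linarith
  have hsum := Finset.sum_le_sum fun S (_ : S ∈ Finset.univ) => hpt S
  -- the sum over good families
  have hupper : ∑ S, (if good S then w S else 0) ≤ ∑ s : ι → Option J,
      (if tupleSize P s ≤ R then ∏ j, G j (tupleEntry P s j) else 0) / tupleSize P s := by
    have e : ∀ s : ι → Option J,
        (if tupleSize P s ≤ R then ∏ j, G j (tupleEntry P s j) else 0) / tupleSize P s
          = (fun S => if ∏ j, setProd P (S j) ≤ R then w S else 0) (entrySet s) := by
      intro s
      have : ∏ j, setProd P (entrySet s j) = tupleSize P s := prod_tupleEntry P s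
      simp only [this, hw, prod_tupleEntry_div]
      split_ifs <;> simp
    rw [Finset.sum_congr rfl fun s _ => e s, ← Finset.sum_image
      (f := fun S => if ∏ j, setProd P (S j) ≤ R then w S else 0)
      fun a _ b _ h => entrySet_injective h, ← Finset.sum_filter, ← Finset.sum_filter]
    refine Finset.sum_le_sum_of_subset_of_nonneg (fun S hS => ?_) fun S _ _ => hw0 S
    obtain ⟨hd, hs⟩ := (Finset.mem_filter.1 hS).2
    obtain ⟨s, hs'⟩ := exists_entrySet_eq hd
    exact Finset.mem_filter.2 ⟨Finset.mem_image.2 ⟨s, Finset.mem_univ _, hs'⟩, hs⟩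
  refine le_trans ?_ (hsum.trans hupper)
  simp_rw [mul_sub, mul_one, Finset.sum_sub_distrib, hwsum]
  have h3 : ∑ S, w S * ((∑ j, Real.log (setProd P (S j))) / Real.log R)
      ≤ (∑ j, lam j) / Real.log R * ∏ j, setSum P (G j) := by
    have : ∑ S, w S * ((∑ j, Real.log (setProd P (S j))) / Real.log R)
        = (∑ j, ∑ S, w S * Real.log (setProd P (S j))) / Real.log R := by
      rw [Finset.sum_comm, Finset.sum_div]
      exact Finset.sum_congr rfl fun S _ => by rw [← Finset.mul_sum, mul_div_assoc]
    rw [this, div_mul_eq_mul_div, Finset.sum_mul]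
    exact div_le_div_of_nonneg_right (Finset.sum_le_sum fun j _ => h1 j) hlogR.le
  have hprod : 0 ≤ ∏ j, setSum P (G j) :=
    Finset.prod_nonneg fun j _ => setSum_nonneg (hG0 j)
  have h4 : ∑ S, w S * (∑ jj ∈ (Finset.univ : Finset J).offDiag, ∑ i,
      if i ∈ S jj.1 ∧ i ∈ S jj.2 then (1 : ℝ) else 0)
      ≤ (Fintype.card J : ℝ) ^ 2 * (∑ i, (1 / (P i : ℝ)) ^ 2) * ∏ j, setSum P (G j) := by
    have : ∑ S, w S * (∑ jj ∈ (Finset.univ : Finset J).offDiag, ∑ i,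
        if i ∈ S jj.1 ∧ i ∈ S jj.2 then (1 : ℝ) else 0)
        = ∑ jj ∈ (Finset.univ : Finset J).offDiag, ∑ i, ∑ S,
          w S * (if i ∈ S jj.1 ∧ i ∈ S jj.2 then (1 : ℝ) else 0) := by
      simp_rw [Finset.mul_sum]
      rw [Finset.sum_comm]
      exact Finset.sum_congr rfl fun jj _ => Finset.sum_comm
    rw [this]
    calc _ ≤ ∑ jj ∈ (Finset.univ : Finset J).offDiag, ∑ i,
          (1 / (P i : ℝ)) ^ 2 * ∏ j, setSum P (G j) :=
        Finset.sum_le_sum fun jj hjj => Finset.sum_le_sum fun i _ =>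
          h2 _ _ (Finset.mem_offDiag.1 hjj).2.2 i
      _ = ((Finset.univ : Finset J).offDiag.card : ℝ)
          * ((∑ i, (1 / (P i : ℝ)) ^ 2) * ∏ j, setSum P (G j)) := by
        rw [Finset.sum_const, nsmul_eq_mul, Finset.sum_mul]
      _ ≤ (Fintype.card J : ℝ) ^ 2 * ((∑ i, (1 / (P i : ℝ)) ^ 2) * ∏ j, setSum P (G j)) := by
        refine mul_le_mul_of_nonneg_right ?_
          (mul_nonneg (Finset.sum_nonneg fun i _ => by positivity) hprod)
        rw [Finset.offDiag_card, Finset.card_univ, sq]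
        exact_mod_cast Nat.sub_le _ _
      _ = _ := by ring
  have e1 : (1 - (∑ j, lam j) / Real.log R - (Fintype.card J : ℝ) ^ 2 * ∑ i, (1 / (P i : ℝ)) ^ 2)
        * ∏ j, setSum P (G j) = ∏ j, setSum P (G j)
      - (∑ j, lam j) / Real.log R * ∏ j, setSum P (G j)
      - (Fintype.card J : ℝ) ^ 2 * (∑ i, (1 / (P i : ℝ)) ^ 2) * ∏ j, setSum P (G j) := by ring
  rw [e1]
  linarith

end Tuples

section PairSums

variable {ι J : Type*} [Fintype ι] [DecidableEq ι] [Fintype J] [DecidableEq J]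

theorem norm_sum_inv_mul_prod_sub_le_of_support {𝕜 κ : Type*} [RCLike 𝕜] [Fintype κ]
    (a : κ → ℕ) [∀ i, NeZero (a i)] (ha : Pairwise (Function.onFun Nat.Coprime a))
    (f : ∀ i, ZMod (a i) → 𝕜) (hf : ∀ i x, ‖f i x‖ ≤ 1) (T : Finset κ)
    (hT : ∀ i ∉ T, ∀ x, f i x = 1) (X Y : ℕ) :
    ‖∑ n ∈ Finset.Ioc X Y, (1 / (n : ℝ)) • ∏ i, f i n
      - (∑ n ∈ Finset.Ioc X Y, 1 / (n : ℝ)) • ∏ i, zmodMean (f i)‖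
      ≤ 4 * (∏ i ∈ T, a i : ℕ) / (X + 1) := by
  have h1 : ∀ n : ℕ, ∏ i, f i n = ∏ i ∈ T, f i n := fun n =>
    (Finset.prod_subset (Finset.subset_univ T) fun i _ hi => hT i hi _).symm
  have h2 : ∏ i, zmodMean (f i) = ∏ i ∈ T, zmodMean (f i) := by
    refine (Finset.prod_subset (Finset.subset_univ T) fun i _ hi => ?_).symm
    have hne : (a i : 𝕜) ≠ 0 := Nat.cast_ne_zero.2 (NeZero.ne _)
    simp [zmodMean, hT i hi, ZMod.card, hne]
  simp_rw [h1, h2]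
  exact norm_sum_inv_mul_prod_sub_le T a (fun i _ j _ hij => ha hij) f hf X Y

/-- Pair sums with local weights close to those of tuples. -/
theorem IsDecr.sum_mul_prod_le_sum_comp_div {K β : Type*} [Fintype K] [DecidableEq K] [Fintype β]
    [DecidableEq β]
    {P : ι → ℕ} {emb : Option K → β} (hemb : Function.Injective emb)
    {F : (ι → β) → ℝ} (hF : IsDecr (emb none) F) (hF0 : ∀ s, 0 ≤ F s)
    {u v : ι → β → ℝ} {c : ι → ℝ} (hu : ∀ i o, 0 ≤ u i o) (hc : ∀ i, 0 ≤ c i)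
    (hv1 : ∀ i, v i (emb none) = 1) (hv2 : ∀ i l, v i (emb (some l)) = 1 / P i)
    (hv3 : ∀ i, ∀ b ∉ Set.range emb, v i b = 0)
    (huv : ∀ i, u i (emb none) + ∑ o ∈ Finset.univ.erase (emb none),
      max (u i o - c i * v i o) 0 ≤ c i) :
    ∑ s, F s * ∏ i, u i (s i) ≤ (∏ i, c i) *
      ∑ t : ι → Option K, F (emb ∘ t) / tupleSize P t := by
  have hv : ∀ i o, 0 ≤ v i o := by
    intro i o
    by_cases ho : o ∈ Set.range emb
    · obtain ⟨l, rfl⟩ := ho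
      rcases l with _ | l
      · rw [hv1]; exact zero_le_one
      · rw [hv2]; positivity
    · rw [hv3 i o ho]
  refine (hF.sum_mul_prod_le hF0 hu hv hc fun i => by rw [hv1, mul_one]; exact huv i).trans
    (le_of_eq ?_)
  congr 1
  symm
  refine Fintype.sum_of_injective (fun t : ι → Option K => emb ∘ t) hemb.comp_left _ _ ?_ ?_
  · intro s hs
    have : ∃ i, s i ∉ Set.range emb := by
      by_contra! h
      choose t ht using h
      exact hs ⟨t, funext ht⟩
    obtain ⟨i, hi⟩ := this
    rw [Finset.prod_eq_zero (Finset.mem_univ i) (hv3 i _ hi), mul_zero]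
  · intro t
    rw [div_eq_mul_one_div, one_div_tupleSize]
    congr 1
    refine Finset.prod_congr rfl fun i _ => ?_
    rcases ht : t i with _ | l <;> simp [ht, hv1, hv2]

theorem sum_mul_sum_eq_sum_pair {R : Type*} [CommSemiring R] {β γ : Type*} [Fintype β]
    [Fintype γ] (F : (ι → β) → (ι → γ) → R) :
    ∑ s, ∑ t, F s t = ∑ σ : ι → β × γ, F (fun i => (σ i).1) (fun i => (σ i).2) := by
  rw [← Fintype.sum_prod_type', ← Equiv.sum_comp (Equiv.arrowProdEquivProdArrow ι (fun _ => β)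
    (fun _ => γ))]
  rfl

theorem IsDecr.fst_mul_snd {J' : Type*} [Fintype J'] {y : (ι → Option J) → ℝ}
    {z : (ι → Option J') → ℝ}
    (hy : IsDecr none y) (hz : IsDecr none z) (hy0 : ∀ s, 0 ≤ y s) (hz0 : ∀ s, 0 ≤ z s) :
    IsDecr (none, none) fun σ : ι → Option J × Option J' =>
      y (fun i => (σ i).1) * z (fun i => (σ i).2) :=
  IsDecr.mul (F := fun σ : ι → Option J × Option J' => y (fun i => (σ i).1))
    (G := fun σ : ι → Option J × Option J' => z (fun i => (σ i).2))
    (hy.comp (f := Prod.fst) (c := (none, none)) rfl)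
    (hz.comp (f := Prod.snd) (c := (none, none)) rfl) (fun _ => hy0 _) (fun _ => hz0 _)

end PairSums

section SieveFactor

variable {J : Type*} [DecidableEq J]

/-- The local factors of the sieve weights. -/
noncomputable def sieveFactor {p : ℕ} (c : J → ZMod p) : Option J → ZMod p → ℝ
  | none, _ => 1
  | some j, x => 1 / p - if x = c j then 1 else 0

theorem abs_sieveFactor_le_one {p : ℕ} (hp : 1 < p) (c : J → ZMod p) (o : Option J)
    (x : ZMod p) : |sieveFactor c o x| ≤ 1 := by
  have hp' : (1 : ℝ) < p := by exact_mod_cast hp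
  have h1 : 1 / (p : ℝ) ≤ 1 := by rw [div_le_one (by linarith)]; exact hp'.le
  have h0 : 0 < 1 / (p : ℝ) := by positivity
  rcases o with _ | j
  · simp [sieveFactor]
  · simp only [sieveFactor]
    split_ifs <;> rw [abs_le] <;> constructor <;> linarith

theorem zmodMean_const {q : ℕ} [NeZero q] (c : ℝ) : zmodMean (fun _ : ZMod q => c) = c := by
  have hne : (q : ℝ) ≠ 0 := Nat.cast_ne_zero.2 (NeZero.ne _)
  simp [zmodMean, ZMod.card, hne]

theorem zmodMean_sieveFactor_mul_self {p : ℕ} [NeZero p] (c : J → ZMod p) (j : J) :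
    zmodMean (fun x => sieveFactor c (some j) x * sieveFactor c (some j) x)
      = 1 / p - 1 / (p : ℝ) ^ 2 := by
  have hne : (p : ℝ) ≠ 0 := Nat.cast_ne_zero.2 (NeZero.ne _)
  have e : ∀ x : ZMod p, sieveFactor c (some j) x * sieveFactor c (some j) x
      = (1 / (p : ℝ)) ^ 2 + (1 - 2 / p) * if x = c j then 1 else 0 := by
    intro x
    simp only [sieveFactor]
    split_ifs <;> ring
  simp only [e, zmodMean, Finset.sum_add_distrib, Finset.sum_const, Finset.card_univ, ZMod.card,
    ← Finset.mul_sum, Finset.sum_ite_eq', Finset.mem_univ, if_true, nsmul_eq_mul]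
  field_simp
  ring

theorem zmodMean_sieveFactor_mul {p : ℕ} [NeZero p] {c : J → ZMod p} (hc : Function.Injective c)
    {j j' : J} (hj : j ≠ j') :
    zmodMean (fun x => sieveFactor c (some j) x * sieveFactor c (some j') x)
      = - (1 / (p : ℝ) ^ 2) := by
  have hne : (p : ℝ) ≠ 0 := Nat.cast_ne_zero.2 (NeZero.ne _)
  have e : ∀ x : ZMod p, sieveFactor c (some j) x * sieveFactor c (some j') x
      = (1 / (p : ℝ)) ^ 2 - 1 / p * (if x = c j then 1 else 0)
        - 1 / p * (if x = c j' then 1 else 0) := by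
    intro x
    simp only [sieveFactor]
    have := hc.ne hj
    split_ifs with h1 h2
    · exact absurd (h1.symm.trans h2) this
    all_goals ring
  simp only [e, zmodMean, Finset.sum_sub_distrib, Finset.sum_const, Finset.card_univ, ZMod.card,
    ← Finset.mul_sum, Finset.sum_ite_eq', Finset.mem_univ, if_true, nsmul_eq_mul]
  field_simp
  ring

theorem zmodMean_sieveFactor {p : ℕ} [NeZero p] (c : J → ZMod p) (j : J) :
    zmodMean (fun x => sieveFactor c (some j) x) = 0 := by
  have hne : (p : ℝ) ≠ 0 := Nat.cast_ne_zero.2 (NeZero.ne _)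
  simp [zmodMean, sieveFactor, Finset.sum_sub_distrib, ZMod.card, hne]

/-- The sieve weight attached to coefficients `y`. -/
noncomputable def sieveWeight {ι : Type*} [Fintype ι] [DecidableEq ι] [Fintype J] {P : ι → ℕ}
    (c : ∀ i, J → ZMod (P i)) (y : (ι → Option J) → ℝ) (x : ∀ i, ZMod (P i)) : ℝ :=
  ∑ s, y s * ∏ i, sieveFactor (c i) (s i) (x i)

variable {ι : Type*} [Fintype ι] [DecidableEq ι] [Fintype J]

theorem sum_zmodMean_mul_le {P : ι → ℕ} [∀ i, NeZero (P i)]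
    {c : ∀ i, J → ZMod (P i)} (hc : ∀ i, Function.Injective (c i))
    {y : (ι → Option J) → ℝ} (hy0 : ∀ s, 0 ≤ y s) (hy : IsDecr none y) :
    ∑ s, ∑ s', y s * y s' *
        ∏ i, zmodMean (fun x => sieveFactor (c i) (s i) x * sieveFactor (c i) (s' i) x)
      ≤ (∏ i, (1 + ((Fintype.card J : ℝ) + 1) ^ 2 * (1 / (P i : ℝ)) ^ 2))
        * ∑ s, y s ^ 2 / tupleSize P s := by
  set u : ι → Option J × Option J → ℝ := fun i o =>
    |zmodMean (fun x => sieveFactor (c i) o.1 x * sieveFactor (c i) o.2 x)| with hu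
  set v : ι → Option J × Option J → ℝ := fun i o =>
    if o.1 = o.2 then (if o.1 = none then 1 else 1 / (P i : ℝ)) else 0 with hv
  set e : ι → ℝ := fun i => ((Fintype.card J : ℝ) + 1) ^ 2 * (1 / (P i : ℝ)) ^ 2 with he
  have he0 : ∀ i, 0 ≤ e i := fun i => by positivity
  have hunn : ∀ i, u i (none, none) = 1 := by
    intro i
    simp [hu, sieveFactor, zmodMean_const]
  have hex : ∀ i o, o ≠ (none, none) →
      max (u i o - (1 + e i) * v i o) 0 ≤ (1 / (P i : ℝ)) ^ 2 := by
    intro i o ho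
    have hP0 : (0 : ℝ) ≤ 1 / P i := by positivity
    have hP1 : (1 / (P i : ℝ)) ^ 2 ≤ 1 / P i := by
      have : (1 : ℝ) ≤ P i := by exact_mod_cast NeZero.one_le
      have : 1 / (P i : ℝ) ≤ 1 := by rw [div_le_one (by linarith)]; exact this
      nlinarith
    refine max_le ?_ (by positivity)
    rcases o with ⟨_ | j, _ | j'⟩
    · exact absurd rfl ho
    · simp [hu, hv, sieveFactor.eq_1, zmodMean_sieveFactor]
    · simp [hu, hv, sieveFactor.eq_1, zmodMean_sieveFactor]
    · by_cases hj : j = j'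
      · subst hj
        simp only [hu, hv, zmodMean_sieveFactor_mul_self, reduceCtorEq, if_true, if_false]
        rw [← one_div_pow, abs_of_nonneg (by linarith)]
        have := mul_nonneg (he0 i) hP0
        nlinarith [sq_nonneg (1 / (P i : ℝ))]
      · simp only [hu, hv, zmodMean_sieveFactor_mul (hc i) hj, Option.some.injEq, hj, if_false,
          mul_zero, sub_zero, abs_neg]
        rw [← one_div_pow, abs_of_nonneg (by positivity)]
  have hF := hy.fst_mul_snd hy hy0 hy0
  have hemb : Function.Injective fun o : Option J => (o, o) := fun a b h => (Prod.ext_iff.1 h).1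
  have main := hF.sum_mul_prod_le_sum_comp_div (P := P) (emb := fun o : Option J => (o, o)) hemb
    (fun σ => mul_nonneg (hy0 _) (hy0 _)) (u := u) (v := v) (c := fun i => 1 + e i)
    (fun i o => abs_nonneg _) (fun i => by linarith [he0 i]) (fun i => by simp [hv])
    (fun i l => by simp [hv])
    (fun i b hb => by
      have : b.1 ≠ b.2 := fun h => hb ⟨b.1, Prod.ext rfl h⟩
      simp [hv, this])
    (fun i => by
      rw [hunn]
      have := Finset.sum_le_sum (s := Finset.univ.erase ((none, none) : Option J × Option J))
        fun o ho => hex i o (Finset.ne_of_mem_erase ho)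
      rw [Finset.sum_const, nsmul_eq_mul] at this
      have hcard : ((Finset.univ.erase ((none, none) : Option J × Option J)).card : ℝ)
          ≤ ((Fintype.card J : ℝ) + 1) ^ 2 := by
        have : (Finset.univ.erase ((none, none) : Option J × Option J)).card
            ≤ (Fintype.card J + 1) ^ 2 := by
          refine (Finset.card_erase_le).trans ?_
          rw [Finset.card_univ, Fintype.card_prod, Fintype.card_option, sq]
        exact_mod_cast this
      have h3 := mul_le_mul_of_nonneg_right hcard (sq_nonneg (1 / (P i : ℝ)))
      linarith)
  refine le_trans ?_ (main.trans (le_of_eq ?_))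
  · rw [sum_mul_sum_eq_sum_pair fun s s' => y s * y s' *
        ∏ i, zmodMean (fun x => sieveFactor (c i) (s i) x * sieveFactor (c i) (s' i) x)]
    refine Finset.sum_le_sum fun σ _ => mul_le_mul_of_nonneg_left ?_
      (mul_nonneg (hy0 _) (hy0 _))
    rw [hu, ← Finset.abs_prod]
    exact le_abs_self _
  · congr 1
    refine Finset.sum_congr rfl fun s _ => ?_
    simp [sq]

/-- The mean square of the sieve weights over an interval. -/
theorem sum_inv_mul_sieveWeight_sq_le {a : Option ι → ℕ} [∀ o, NeZero (a o)]
    (ha : Pairwise (Function.onFun Nat.Coprime a)) (ha1 : ∀ i, 1 < a (some i))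
    {c : ∀ i, J → ZMod (a (some i))} (hc : ∀ i, Function.Injective (c i))
    {y : (ι → Option J) → ℝ} (hy0 : ∀ s, 0 ≤ y s) (hy : IsDecr none y)
    {f : ZMod (a none) → ℝ} (hf0 : ∀ x, 0 ≤ f x) (hf1 : ∀ x, f x ≤ 1) (X Y : ℕ) :
    ∑ n ∈ Finset.Ioc X Y, 1 / (n : ℝ) * (f n * sieveWeight c y (fun _ => n) ^ 2)
      ≤ (∑ n ∈ Finset.Ioc X Y, 1 / (n : ℝ)) * zmodMean f *
          ((∏ i, (1 + ((Fintype.card J : ℝ) + 1) ^ 2 * (1 / (a (some i) : ℝ)) ^ 2))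
            * ∑ s, y s ^ 2 / tupleSize (fun i => a (some i)) s)
        + 4 * a none * (∑ s, y s * tupleSize (fun i => a (some i)) s) ^ 2 / (X + 1) := by
  set φ : (ι → Option J) → (ι → Option J) → ∀ o : Option ι, ZMod (a o) → ℝ := fun s s' o =>
    match o with
    | none => f
    | some i => fun x => sieveFactor (c i) (s i) x * sieveFactor (c i) (s' i) x with hφ
  have hφ1 : ∀ s s' o x, ‖φ s s' o x‖ ≤ 1 := by
    intro s s' o x
    rcases o with _ | i
    · rw [Real.norm_of_nonneg (hf0 x)]; exact hf1 x
    · change |_ * _| ≤ 1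
      rw [abs_mul]
      exact mul_le_one₀ (abs_sieveFactor_le_one (ha1 i) _ _ _) (abs_nonneg _)
        (abs_sieveFactor_le_one (ha1 i) _ _ _)
  have hpair : ∀ s s', ∑ n ∈ Finset.Ioc X Y, 1 / (n : ℝ) * ∏ o, φ s s' o n
      ≤ (∑ n ∈ Finset.Ioc X Y, 1 / (n : ℝ)) * zmodMean f *
          ∏ i, zmodMean (fun x => sieveFactor (c i) (s i) x * sieveFactor (c i) (s' i) x)
        + 4 * a none * (tupleSize (fun i => a (some i)) s * tupleSize (fun i => a (some i)) s')
          / (X + 1) := by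
    intro s s'
    set T : Finset (Option ι) := Finset.insertNone
      ((Finset.univ.filter fun i => s i ≠ none) ∪ (Finset.univ.filter fun i => s' i ≠ none))
    have := norm_sum_inv_mul_prod_sub_le_of_support a ha (φ s s') (hφ1 s s') T (by
      intro o ho x
      rcases o with _ | i
      · simp [T] at ho
      · simp only [T, Finset.some_mem_insertNone, Finset.mem_union, Finset.mem_filter,
          Finset.mem_univ, true_and, not_or, not_not] at ho
        simp [hφ, ho.1, ho.2, sieveFactor]) X Y
    have hT : ∏ o ∈ T, a o ≤ a none * (tupleSize (fun i => a (some i)) s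
        * tupleSize (fun i => a (some i)) s') := by
      rw [Finset.prod_insertNone]
      refine Nat.mul_le_mul_left _ ?_
      rw [tupleSize, tupleSize, setProd, setProd, ← Finset.prod_union_inter]
      exact Nat.le_mul_of_pos_right _ (Finset.prod_pos fun i _ => (ha1 i).le)
    have hT' : (4 * (∏ o ∈ T, a o : ℕ) / (X + 1) : ℝ) ≤ 4 * a none *
        (tupleSize (fun i => a (some i)) s * tupleSize (fun i => a (some i)) s') / (X + 1) := by
      refine div_le_div_of_nonneg_right ?_ (by positivity)
      rw [mul_assoc]
      exact mul_le_mul_of_nonneg_left (by exact_mod_cast hT) (by norm_num)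
    have h2 := (le_abs_self _).trans (this.trans hT')
    rw [Fintype.prod_option] at h2
    simp only [smul_eq_mul] at h2 ⊢
    rw [← mul_assoc] at h2
    linarith
  have hexp : ∀ n : ℕ, f n * sieveWeight c y (fun _ => n) ^ 2
      = ∑ s, ∑ s', y s * y s' * ∏ o, φ s s' o n := by
    intro n
    rw [sieveWeight, sq, Finset.sum_mul_sum, Finset.mul_sum]
    refine Finset.sum_congr rfl fun s _ => ?_
    rw [Finset.mul_sum]
    refine Finset.sum_congr rfl fun s' _ => ?_
    rw [Fintype.prod_option, Finset.prod_mul_distrib]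
    simp only [hφ]
    ring
  calc _ = ∑ s, ∑ s', y s * y s' * ∑ n ∈ Finset.Ioc X Y, 1 / (n : ℝ) * ∏ o, φ s s' o n := by
        simp_rw [hexp, Finset.mul_sum]
        rw [Finset.sum_comm]
        refine Finset.sum_congr rfl fun s _ => ?_
        rw [Finset.sum_comm]
        refine Finset.sum_congr rfl fun s' _ => ?_
        exact Finset.sum_congr rfl fun n _ => by ring
    _ ≤ ∑ s, ∑ s', y s * y s' * ((∑ n ∈ Finset.Ioc X Y, 1 / (n : ℝ)) * zmodMean f *
          ∏ i, zmodMean (fun x => sieveFactor (c i) (s i) x * sieveFactor (c i) (s' i) x)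
        + 4 * a none * (tupleSize (fun i => a (some i)) s * tupleSize (fun i => a (some i)) s')
          / (X + 1)) :=
      Finset.sum_le_sum fun s _ => Finset.sum_le_sum fun s' _ =>
        mul_le_mul_of_nonneg_left (hpair s s') (mul_nonneg (hy0 s) (hy0 s'))
    _ = (∑ n ∈ Finset.Ioc X Y, 1 / (n : ℝ)) * zmodMean f * (∑ s, ∑ s', y s * y s' *
          ∏ i, zmodMean (fun x => sieveFactor (c i) (s i) x * sieveFactor (c i) (s' i) x))
        + 4 * a none * (∑ s, y s * tupleSize (fun i => a (some i)) s) ^ 2 / (X + 1) := by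
      rw [sq, Finset.sum_mul_sum, Finset.mul_sum, Finset.mul_sum, Finset.sum_div,
        ← Finset.sum_add_distrib]
      refine Finset.sum_congr rfl fun s _ => ?_
      rw [Finset.mul_sum, Finset.mul_sum, Finset.sum_div, ← Finset.sum_add_distrib]
      exact Finset.sum_congr rfl fun s' _ => by ring
    _ ≤ _ := by
      gcongr
      · exact mul_nonneg (Finset.sum_nonneg fun n _ => by positivity)
          (div_nonneg (Finset.sum_nonneg fun x _ => hf0 x) (Nat.cast_nonneg _))
      · exact sum_zmodMean_mul_le hc hy0 hy

end SieveFactor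

section LargeSieve

variable {ι : Type*} [Fintype ι] [DecidableEq ι]

/-- Families of characters to the moduli `a o`. -/
abbrev CharFamily (a : Option ι → ℕ) := ∀ o, DirichletCharacter ℂ (a o)

variable {a : Option ι → ℕ}

/-- The product of the values of the characters of a family. -/
noncomputable def charProd (χ : CharFamily a) (n : ℕ) : ℂ := ∏ o, χ o (n : ZMod (a o))

open Classical in
/-- The indices (apart from `none`) where a family of characters is nontrivial. -/
noncomputable def charSupport (χ : CharFamily a) : Finset ι :=
  Finset.univ.filter fun i => χ (some i) ≠ 1

/-- The product of the moduli of the nontrivial characters of a family, except for the one at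
`none`. -/
noncomputable def charCond (χ : CharFamily a) : ℕ := setProd (fun i => a (some i)) (charSupport χ)

open Classical in
/-- The characters of a family, with trivial characters (except the one at `none`) replaced by
the constant `1`. -/
noncomputable def charLocal (χ : CharFamily a) : ∀ o, ZMod (a o) → ℂ
  | none => χ none
  | some i => fun x => if χ (some i) = 1 then 1 else χ (some i) x

theorem charProd_mul (χ : CharFamily a) (m n : ℕ) :
    charProd χ (m * n) = charProd χ m * charProd χ n := by
  simp only [charProd, ← Finset.prod_mul_distrib, Nat.cast_mul, map_mul]

theorem norm_charProd_le_one (χ : CharFamily a) (n : ℕ) : ‖charProd χ n‖ ≤ 1 := by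
  rw [charProd, norm_prod]
  exact Finset.prod_le_one (fun _ _ => norm_nonneg _) fun o _ => (χ o).norm_le_one _

theorem norm_charLocal_le_one (χ : CharFamily a) (o : Option ι) (x : ZMod (a o)) :
    ‖charLocal χ o x‖ ≤ 1 := by
  rcases o with _ | i
  · exact (χ none).norm_le_one _
  · simp only [charLocal]
    split_ifs
    · simp
    · exact (χ (some i)).norm_le_one _

theorem charProd_eq_prod_charLocal (χ : CharFamily a) {n : ℕ}
    (hn : ∀ i, n.Coprime (a (some i))) : charProd χ n = ∏ o, charLocal χ o n := by
  refine Finset.prod_congr rfl fun o _ => ?_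
  rcases o with _ | i
  · rfl
  · simp only [charLocal]
    split_ifs with h
    · rw [h, MulChar.one_apply ((ZMod.isUnit_iff_coprime _ _).2 (hn i))]
    · rfl

theorem zmodMean_eq_zero {𝕜 : Type*} [RCLike 𝕜] {q : ℕ} [NeZero q] (f : ZMod q → 𝕜)
    (hf : ∑ x, f x = 0) : zmodMean f = 0 := by rw [zmodMean, hf, zero_div]

theorem sum_mul_star_eq_zero {q : ℕ} [NeZero q] {χ χ' : DirichletCharacter ℂ q} (h : χ ≠ χ') :
    ∑ x, χ x * star (χ' x) = 0 := by
  simp_rw [MulChar.star_apply', ← MulChar.mul_apply]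
  exact MulChar.sum_eq_zero_of_ne_one fun h' => h (mul_inv_eq_one.1 h')

/-- The local factors of the sieve weights detecting coprimality. -/
noncomputable abbrev zeroResidue (a : Option ι → ℕ) : ∀ i, Unit → ZMod (a (some i)) := fun _ _ => 0

variable [∀ o, NeZero (a o)]

theorem exists_zmodMean_eq_zero (hprime : ∀ i, (a (some i)).Prime) {χ χ' : CharFamily a}
    (hχ : χ ≠ χ') (s s' : ι → Option Unit) :
    zmodMean (fun x => charLocal χ none x * star (charLocal χ' none x)) = 0 ∨
    ∃ i, zmodMean (fun x => ((sieveFactor (zeroResidue a i) (s i) x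
      * sieveFactor (zeroResidue a i) (s' i) x : ℝ) : ℂ)
      * (charLocal χ (some i) x * star (charLocal χ' (some i) x))) = 0 := by
  obtain ⟨o, ho⟩ := Function.ne_iff.1 hχ
  rcases o with _ | i
  · exact Or.inl (zmodMean_eq_zero _ (sum_mul_star_eq_zero ho))
  · refine Or.inr ⟨i, zmodMean_eq_zero _ ?_⟩
    have : Fact (a (some i)).Prime := ⟨hprime i⟩
    have e : ∀ x : ZMod (a (some i)), ((sieveFactor (zeroResidue a i) (s i) x
          * sieveFactor (zeroResidue a i) (s' i) x : ℝ) : ℂ)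
        * (charLocal χ (some i) x * star (charLocal χ' (some i) x))
        = ((sieveFactor (zeroResidue a i) (s i) 1
          * sieveFactor (zeroResidue a i) (s' i) 1 : ℝ) : ℂ)
          * (χ (some i) x * star (χ' (some i) x)) := by
      intro x
      by_cases hx : x = 0
      · subst hx
        rw [MulChar.map_zero, zero_mul, mul_zero]
        by_cases h1 : χ (some i) = 1
        · have h2 : χ' (some i) ≠ 1 := fun h => ho (h1.trans h.symm)
          simp [charLocal, h2, MulChar.map_zero]
        · simp [charLocal, h1, MulChar.map_zero]
      · have hs : ∀ o, sieveFactor (zeroResidue a i) o x = sieveFactor (zeroResidue a i) o 1 := by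
          intro o
          rcases o with _ | j <;> simp [sieveFactor, hx]
        have hu : IsUnit x := isUnit_iff_ne_zero.2 hx
        have hc : ∀ ψ : CharFamily a, charLocal ψ (some i) x = ψ (some i) x := by
          intro ψ
          simp only [charLocal]
          split_ifs with h
          · rw [h, MulChar.one_apply hu]
          · rfl
        rw [hs, hs, hc, hc]
    simp_rw [e]
    rw [← Finset.mul_sum, sum_mul_star_eq_zero ho, mul_zero]

theorem norm_sum_inv_mul_charLocal_le (ha : Pairwise (Function.onFun Nat.Coprime a))
    (hprime : ∀ i, (a (some i)).Prime) {χ χ' : CharFamily a} (hχ : χ ≠ χ')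
    {y : (ι → Option Unit) → ℝ} (hy0 : ∀ s, 0 ≤ y s) (X Y : ℕ) :
    ‖∑ n ∈ Finset.Ioc X Y, ((1 / (n : ℝ) * sieveWeight (zeroResidue a) y (fun _ => n) ^ 2 : ℝ) : ℂ)
        * ((∏ o, charLocal χ o n) * star (∏ o, charLocal χ' o n))‖
      ≤ 4 * a none * (∑ s, y s * tupleSize (fun i => a (some i)) s) ^ 2
        * (charCond χ * charCond χ') / (X + 1) := by
  set φ : (ι → Option Unit) → (ι → Option Unit) → ∀ o : Option ι, ZMod (a o) → ℂ :=
    fun s s' o => match o with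
    | none => fun x => charLocal χ none x * star (charLocal χ' none x)
    | some i => fun x => ((sieveFactor (zeroResidue a i) (s i) x
          * sieveFactor (zeroResidue a i) (s' i) x : ℝ) : ℂ)
        * (charLocal χ (some i) x * star (charLocal χ' (some i) x)) with hφ
  have hcc : ∀ o x, ‖charLocal χ o x * star (charLocal χ' o x)‖ ≤ 1 := by
    intro o x
    rw [norm_mul, norm_star]
    exact mul_le_one₀ (norm_charLocal_le_one _ _ _) (norm_nonneg _) (norm_charLocal_le_one _ _ _)
  have hφ1 : ∀ s s' o x, ‖φ s s' o x‖ ≤ 1 := by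
    intro s s' o x
    rcases o with _ | i
    · exact hcc none x
    · simp only [hφ]
      rw [norm_mul]
      refine mul_le_one₀ ?_ (norm_nonneg _) (hcc _ x)
      rw [Complex.norm_real, Real.norm_eq_abs, abs_mul]
      exact mul_le_one₀ (abs_sieveFactor_le_one (hprime i).one_lt _ _ _) (abs_nonneg _)
        (abs_sieveFactor_le_one (hprime i).one_lt _ _ _)
  have hpair : ∀ s s', ‖∑ n ∈ Finset.Ioc X Y, (1 / (n : ℝ)) • ∏ o, φ s s' o n‖
      ≤ 4 * a none * (tupleSize (fun i => a (some i)) s * tupleSize (fun i => a (some i)) s')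
          * (charCond χ * charCond χ') / (X + 1) := by
    intro s s'
    set T : Finset (Option ι) := Finset.insertNone
      (((Finset.univ.filter fun i => s i ≠ none) ∪ (Finset.univ.filter fun i => s' i ≠ none))
        ∪ (charSupport χ ∪ charSupport χ'))
    have := norm_sum_inv_mul_prod_sub_le_of_support a ha (φ s s') (hφ1 s s') T (by
      intro o ho x
      rcases o with _ | i
      · simp [T] at ho
      · simp only [T, Finset.some_mem_insertNone, Finset.mem_union, Finset.mem_filter,
          Finset.mem_univ, true_and, not_or, not_not, charSupport] at ho
        simp [hφ, ho.1.1, ho.1.2, ho.2.1, ho.2.2, sieveFactor, charLocal]) X Y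
    have hmean : ∏ o, zmodMean (φ s s' o) = 0 := by
      rcases exists_zmodMean_eq_zero hprime hχ s s' with h | ⟨i, h⟩
      · exact Finset.prod_eq_zero (Finset.mem_univ none) h
      · exact Finset.prod_eq_zero (Finset.mem_univ (some i)) h
    rw [hmean, smul_zero, sub_zero] at this
    refine this.trans (div_le_div_of_nonneg_right ?_ (by positivity))
    have hun : ∀ A B : Finset ι, setProd (fun i => a (some i)) (A ∪ B)
        ≤ setProd (fun i => a (some i)) A * setProd (fun i => a (some i)) B := by
      intro A B
      rw [setProd, setProd, setProd, ← Finset.prod_union_inter]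
      exact Nat.le_mul_of_pos_right _ (Finset.prod_pos fun i _ => (hprime i).pos)
    have hT : ∏ o ∈ T, a o ≤ a none * ((tupleSize (fun i => a (some i)) s
        * tupleSize (fun i => a (some i)) s') * (charCond χ * charCond χ')) := by
      rw [Finset.prod_insertNone]
      exact Nat.mul_le_mul_left _ ((hun _ _).trans (Nat.mul_le_mul (hun _ _) (hun _ _)))
    rw [mul_assoc, mul_assoc]
    exact mul_le_mul_of_nonneg_left (by exact_mod_cast hT) (by norm_num)
  have hexp : ∀ n : ℕ,
      ((1 / (n : ℝ) * sieveWeight (zeroResidue a) y (fun _ => n) ^ 2 : ℝ) : ℂ)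
        * ((∏ o, charLocal χ o n) * star (∏ o, charLocal χ' o n))
      = ∑ s, ∑ s', ((y s * y s' : ℝ) : ℂ) * ((1 / (n : ℝ)) • ∏ o, φ s s' o n) := by
    intro n
    have e1 : sieveWeight (zeroResidue a) y (fun _ => n) ^ 2
        = ∑ s, ∑ s', y s * y s' * ∏ i, (sieveFactor (zeroResidue a i) (s i) (n : ZMod (a (some i)))
          * sieveFactor (zeroResidue a i) (s' i) (n : ZMod (a (some i)))) := by
      rw [sieveWeight, sq, Finset.sum_mul_sum]
      refine Finset.sum_congr rfl fun s _ => Finset.sum_congr rfl fun s' _ => ?_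
      rw [Finset.prod_mul_distrib]
      ring
    rw [e1, star_prod, ← Finset.prod_mul_distrib]
    push_cast
    rw [Finset.mul_sum, Finset.sum_mul]
    refine Finset.sum_congr rfl fun s _ => ?_
    rw [Finset.mul_sum, Finset.sum_mul]
    refine Finset.sum_congr rfl fun s' _ => ?_
    rw [Fintype.prod_option, Fintype.prod_option, Complex.real_smul]
    simp only [hφ]
    rw [Finset.prod_mul_distrib (f := fun i => (((sieveFactor (zeroResidue a i) (s i)
      (n : ZMod (a (some i))) * sieveFactor (zeroResidue a i) (s' i)
      (n : ZMod (a (some i))) : ℝ)) : ℂ))]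
    push_cast
    ring
  simp_rw [hexp]
  have hswap : ∑ n ∈ Finset.Ioc X Y, ∑ s, ∑ s',
      ((y s * y s' : ℝ) : ℂ) * ((1 / (n : ℝ)) • ∏ o, φ s s' o n)
      = ∑ s, ∑ s', ((y s * y s' : ℝ) : ℂ)
        * ∑ n ∈ Finset.Ioc X Y, (1 / (n : ℝ)) • ∏ o, φ s s' o n := by
    rw [Finset.sum_comm]
    refine Finset.sum_congr rfl fun s _ => ?_
    rw [Finset.sum_comm]
    exact Finset.sum_congr rfl fun s' _ => by rw [Finset.mul_sum]
  rw [hswap]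
  calc _ ≤ ∑ s, ∑ s', y s * y s' * (4 * a none * (tupleSize (fun i => a (some i)) s
          * tupleSize (fun i => a (some i)) s') * (charCond χ * charCond χ') / (X + 1)) := by
        refine (norm_sum_le _ _).trans (Finset.sum_le_sum fun s _ => ?_)
        refine (norm_sum_le _ _).trans (Finset.sum_le_sum fun s' _ => ?_)
        have h0 := mul_nonneg (hy0 s) (hy0 s')
        rw [norm_mul, Complex.norm_real, Real.norm_of_nonneg h0]
        exact mul_le_mul_of_nonneg_left (hpair s s') h0
    _ = _ := by
        rw [sq, Finset.sum_mul_sum, Finset.mul_sum, Finset.sum_mul, Finset.sum_div]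
        refine Finset.sum_congr rfl fun s _ => ?_
        rw [Finset.mul_sum, Finset.sum_mul, Finset.sum_div]
        exact Finset.sum_congr rfl fun s' _ => by ring

theorem sieveWeight_zeroResidue_of_coprime (y : (ι → Option Unit) → ℝ) {n : ℕ}
    (hprime : ∀ i, (a (some i)).Prime) (hn : ∀ i, n.Coprime (a (some i))) :
    sieveWeight (zeroResidue a) y (fun _ => (n : ZMod _))
      = ∑ s, y s / tupleSize (fun i => a (some i)) s := by
  refine Finset.sum_congr rfl fun s _ => ?_
  rw [div_eq_mul_one_div, one_div_tupleSize]
  congr 1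
  refine Finset.prod_congr rfl fun i _ => ?_
  have : (n : ZMod (a (some i))) ≠ 0 := by
    have : Fact (a (some i)).Prime := ⟨hprime i⟩
    exact ((ZMod.isUnit_iff_coprime _ _).2 (hn i)).ne_zero
  rcases s i with _ | j <;> simp [sieveFactor, this]

theorem zmodMean_isUnit (q : ℕ) [NeZero q] [DecidablePred fun x : ZMod q => IsUnit x] :
    zmodMean (fun x : ZMod q => if IsUnit x then (1 : ℝ) else 0) = q.totient / q := by
  rw [zmodMean, Finset.sum_boole, ← ZMod.card_units_eq_totient]
  congr 2
  rw [← Fintype.card_subtype]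
  exact Fintype.card_congr
    ⟨fun x => x.2.unit, fun u => ⟨u, u.isUnit⟩, fun x => Subtype.ext x.2.unit_spec,
      fun u => Units.ext rfl⟩

/-- The dual large sieve inequality. -/
theorem sum_inv_mul_sieveWeight_sq_mul_norm_sq_le (ha : Pairwise (Function.onFun Nat.Coprime a))
    (hprime : ∀ i, (a (some i)).Prime) {y : (ι → Option Unit) → ℝ} (hy0 : ∀ s, 0 ≤ y s)
    (hy : IsDecr none y) (𝒢 : Finset (CharFamily a)) {Q : ℕ} (hQ : ∀ χ ∈ 𝒢, charCond χ ≤ Q)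
    (b : CharFamily a → ℂ) (X Y : ℕ) :
    ∑ n ∈ Finset.Ioc X Y, 1 / (n : ℝ) * sieveWeight (zeroResidue a) y (fun _ => n) ^ 2
        * ‖∑ χ ∈ 𝒢, b χ * ∏ o, charLocal χ o n‖ ^ 2
      ≤ ((∑ n ∈ Finset.Ioc X Y, 1 / (n : ℝ)) * ((a none).totient / a none) *
          ((∏ i, (1 + 4 * (1 / (a (some i) : ℝ)) ^ 2))
            * ∑ s, y s ^ 2 / tupleSize (fun i => a (some i)) s)
        + 4 * a none * (∑ s, y s * tupleSize (fun i => a (some i)) s) ^ 2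
          * (1 + 𝒢.card * (Q : ℝ) ^ 2) / (X + 1)) * ∑ χ ∈ 𝒢, ‖b χ‖ ^ 2 := by
  classical
  set D : ℝ := ∑ s, y s * tupleSize (fun i => a (some i)) s with hD
  set ω : ℕ → ℝ := fun n => 1 / (n : ℝ) * sieveWeight (zeroResidue a) y (fun _ => n) ^ 2 with hω
  have hω0 : ∀ n, 0 ≤ ω n := fun n => mul_nonneg (by positivity) (sq_nonneg _)
  set V : CharFamily a → ℕ → ℂ := fun χ n => ∏ o, charLocal χ o n with hV
  set E : ℝ := 4 * a none * D ^ 2 * (Q : ℝ) ^ 2 / (X + 1) with hE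
  have hE0 : 0 ≤ E := by positivity
  have hQ0 : ∀ χ ∈ 𝒢, ∀ χ' ∈ 𝒢, (charCond χ : ℝ) * charCond χ' ≤ (Q : ℝ) ^ 2 := by
    intro χ hχ χ' hχ'
    rw [sq]
    exact_mod_cast Nat.mul_le_mul (hQ χ hχ) (hQ χ' hχ')
  have hoff : ∀ χ ∈ 𝒢, ∀ χ' ∈ 𝒢, χ ≠ χ' →
      ‖∑ n ∈ Finset.Ioc X Y, (ω n : ℂ) * (V χ n * star (V χ' n))‖ ≤ E := by
    intro χ hχ χ' hχ' hne
    refine (norm_sum_inv_mul_charLocal_le ha hprime hne hy0 X Y).trans ?_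
    rw [hE]
    gcongr
    exact hQ0 χ hχ χ' hχ'
  set Δ : ℝ := (∑ n ∈ Finset.Ioc X Y, 1 / (n : ℝ)) * ((a none).totient / a none) *
          ((∏ i, (1 + 4 * (1 / (a (some i) : ℝ)) ^ 2))
            * ∑ s, y s ^ 2 / tupleSize (fun i => a (some i)) s)
          + 4 * a none * D ^ 2 / (X + 1) with hΔ
  have hdiag : ∀ χ : CharFamily a,
      ‖∑ n ∈ Finset.Ioc X Y, (ω n : ℂ) * (V χ n * star (V χ n))‖ ≤ Δ := by
    intro χ
    have h1 := sum_inv_mul_sieveWeight_sq_le ha (fun i => (hprime i).one_lt)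
      (c := zeroResidue a) (fun i => Function.injective_of_subsingleton _) hy0 hy
      (f := fun x : ZMod (a none) => if IsUnit x then (1 : ℝ) else 0)
      (fun x => by split_ifs <;> norm_num) (fun x => by split_ifs <;> norm_num) X Y
    rw [zmodMean_isUnit, Fintype.card_unit] at h1
    norm_num only [Nat.cast_one] at h1
    refine le_trans ?_ (h1.trans (le_of_eq (by rw [hΔ, hD])))
    refine (norm_sum_le _ _).trans (Finset.sum_le_sum fun n _ => ?_)
    rw [norm_mul, Complex.norm_real, Real.norm_of_nonneg (hω0 n), norm_mul, norm_star]
    have hv1 : ‖V χ n‖ ≤ 1 := by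
      rw [hV, norm_prod]
      exact Finset.prod_le_one (fun _ _ => norm_nonneg _) fun o _ => norm_charLocal_le_one _ _ _
    have hv : ‖V χ n‖ * ‖V χ n‖ ≤ if IsUnit (n : ZMod (a none)) then (1 : ℝ) else 0 := by
      split_ifs with hu
      · exact mul_le_one₀ hv1 (norm_nonneg _) hv1
      · have : V χ n = 0 := Finset.prod_eq_zero (Finset.mem_univ none) (MulChar.map_nonunit _ hu)
        rw [this]; simp
    have := mul_le_mul_of_nonneg_left hv (hω0 n)
    refine this.trans (le_of_eq ?_)
    simp only [hω, one_div]
    ring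
  have hnorm : ∀ z : ℂ, ((‖z‖ ^ 2 : ℝ) : ℂ) = z * star z := fun z => by
    rw [RCLike.star_def, Complex.mul_conj, Complex.normSq_eq_norm_sq]
  have hexp : ((∑ n ∈ Finset.Ioc X Y, ω n * ‖∑ χ ∈ 𝒢, b χ * V χ n‖ ^ 2 : ℝ) : ℂ)
      = ∑ χ ∈ 𝒢, ∑ χ' ∈ 𝒢, b χ * star (b χ')
        * ∑ n ∈ Finset.Ioc X Y, (ω n : ℂ) * (V χ n * star (V χ' n)) := by
    rw [Complex.ofReal_sum]
    simp_rw [Complex.ofReal_mul, hnorm, star_sum, Finset.sum_mul_sum, Finset.mul_sum]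
    rw [Finset.sum_comm]
    refine Finset.sum_congr rfl fun χ _ => ?_
    rw [Finset.sum_comm]
    refine Finset.sum_congr rfl fun χ' _ => Finset.sum_congr rfl fun n _ => ?_
    rw [star_mul']
    ring
  have hreal : ∑ n ∈ Finset.Ioc X Y, ω n * ‖∑ χ ∈ 𝒢, b χ * V χ n‖ ^ 2
      ≤ ∑ χ ∈ 𝒢, ∑ χ' ∈ 𝒢, ‖b χ‖ * ‖b χ'‖ * (E + if χ = χ' then Δ else 0) := by
    have h0 : 0 ≤ ∑ n ∈ Finset.Ioc X Y, ω n * ‖∑ χ ∈ 𝒢, b χ * V χ n‖ ^ 2 :=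
      Finset.sum_nonneg fun n _ => mul_nonneg (hω0 n) (sq_nonneg _)
    rw [← Real.norm_of_nonneg h0, ← Complex.norm_real, hexp]
    refine (norm_sum_le _ _).trans (Finset.sum_le_sum fun χ hχ => ?_)
    refine (norm_sum_le _ _).trans (Finset.sum_le_sum fun χ' hχ' => ?_)
    rw [norm_mul, norm_mul, norm_star]
    refine mul_le_mul_of_nonneg_left ?_ (by positivity)
    split_ifs with h
    · subst h
      linarith [hdiag χ]
    · linarith [hoff χ hχ χ' hχ' h]
  refine hreal.trans ?_
  have h2 : ∑ χ ∈ 𝒢, ∑ χ' ∈ 𝒢, ‖b χ‖ * ‖b χ'‖ * (E + if χ = χ' then Δ else 0)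
      = E * (∑ χ ∈ 𝒢, ‖b χ‖) ^ 2 + Δ * ∑ χ ∈ 𝒢, ‖b χ‖ ^ 2 := by
    rw [sq, Finset.sum_mul_sum, Finset.mul_sum, Finset.mul_sum, ← Finset.sum_add_distrib]
    refine Finset.sum_congr rfl fun χ hχ => ?_
    simp only [mul_add, Finset.sum_add_distrib, mul_ite, mul_zero, Finset.sum_ite_eq, hχ, if_true]
    rw [Finset.mul_sum]
    congr 1
    · exact Finset.sum_congr rfl fun _ _ => by ring
    · ring
  have h3 : (∑ χ ∈ 𝒢, ‖b χ‖) ^ 2 ≤ 𝒢.card * ∑ χ ∈ 𝒢, ‖b χ‖ ^ 2 := sq_sum_le_card_mul_sum_sq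
  rw [h2]
  have h4 := mul_le_mul_of_nonneg_left h3 hE0
  refine (add_le_add_left h4 _).trans (le_of_eq ?_)
  rw [hE, hΔ]
  ring

/-- A large sieve inequality without logarithmic loss, for sequences supported on integers
free of the primes involved. -/
theorem sum_norm_sum_mul_charProd_sq_le (ha : Pairwise (Function.onFun Nat.Coprime a))
    (hprime : ∀ i, (a (some i)).Prime) {y : (ι → Option Unit) → ℝ} (hy0 : ∀ s, 0 ≤ y s)
    (hy : IsDecr none y) (𝒢 : Finset (CharFamily a)) {Q : ℕ} (hQ : ∀ χ ∈ 𝒢, charCond χ ≤ Q)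
    (X Y : ℕ) {K : ℝ} (hK0 : 0 ≤ K)
    (hK : (∑ n ∈ Finset.Ioc X Y, 1 / (n : ℝ)) * ((a none).totient / a none) *
          ((∏ i, (1 + 4 * (1 / (a (some i) : ℝ)) ^ 2))
            * ∑ s, y s ^ 2 / tupleSize (fun i => a (some i)) s)
        + 4 * a none * (∑ s, y s * tupleSize (fun i => a (some i)) s) ^ 2
          * (1 + 𝒢.card * (Q : ℝ) ^ 2) / (X + 1)
        ≤ K * (∑ s, y s / tupleSize (fun i => a (some i)) s) ^ 2)
    (hM : 0 < ∑ s, y s / tupleSize (fun i => a (some i)) s)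
    (α : ℕ → ℂ) (hα : ∀ n, α n ≠ 0 → ∀ i, n.Coprime (a (some i))) :
    ∑ χ ∈ 𝒢, ‖∑ n ∈ Finset.Ioc X Y, α n * charProd χ n‖ ^ 2
      ≤ K * ∑ n ∈ Finset.Ioc X Y, ‖α n‖ ^ 2 * n := by
  classical
  set M : ℝ := ∑ s, y s / tupleSize (fun i => a (some i)) s with hMdef
  set A : CharFamily a → ℂ := fun χ => ∑ n ∈ Finset.Ioc X Y, α n * charProd χ n with hA
  set S : ℝ := ∑ χ ∈ 𝒢, ‖A χ‖ ^ 2 with hS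
  set T : ℝ := ∑ n ∈ Finset.Ioc X Y, ‖α n‖ ^ 2 * n with hT
  have hT0 : 0 ≤ T := Finset.sum_nonneg fun n _ => by positivity
  have hS0 : 0 ≤ S := Finset.sum_nonneg fun χ _ => by positivity
  set B : ℕ → ℂ := fun n => ∑ χ ∈ 𝒢, star (A χ) * ∏ o, charLocal χ o n with hB
  have hdual := sum_inv_mul_sieveWeight_sq_mul_norm_sq_le ha hprime hy0 hy 𝒢 hQ
    (fun χ => star (A χ)) X Y
  simp only [norm_star] at hdual
  have hdual2 := hdual.trans (mul_le_mul_of_nonneg_right hK hS0)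
  set G : Finset ℕ := (Finset.Ioc X Y).filter fun n => α n ≠ 0 with hG
  have hGsub : G ⊆ Finset.Ioc X Y := Finset.filter_subset _ _
  have hlow : M ^ 2 * ∑ n ∈ G, 1 / (n : ℝ) * ‖B n‖ ^ 2 ≤ K * M ^ 2 * S := by
    refine le_trans ?_ hdual2
    rw [Finset.mul_sum]
    refine le_trans (le_of_eq ?_) (Finset.sum_le_sum_of_subset_of_nonneg
      hGsub fun n _ _ => mul_nonneg (mul_nonneg (by positivity)
        (sq_nonneg _)) (sq_nonneg _))
    refine Finset.sum_congr rfl fun n hn => ?_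
    rw [sieveWeight_zeroResidue_of_coprime y hprime (hα n (Finset.mem_filter.1 hn).2)]
    ring
  have hlow2 : ∑ n ∈ G, 1 / (n : ℝ) * ‖B n‖ ^ 2 ≤ K * S := by
    have hM2 : 0 < M ^ 2 := by positivity
    refine le_of_mul_le_mul_left (hlow.trans (le_of_eq ?_)) hM2
    ring
  have hSeq : (S : ℂ) = ∑ n ∈ G, α n * B n := by
    have h1 : ∑ n ∈ G, α n * B n = ∑ n ∈ Finset.Ioc X Y, α n *
        ∑ χ ∈ 𝒢, star (A χ) * charProd χ n := by
      rw [hG, Finset.sum_filter]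
      refine Finset.sum_congr rfl fun n _ => ?_
      split_ifs with h
      · rw [hB]
        simp only
        congr 1
        refine Finset.sum_congr rfl fun χ _ => ?_
        rw [charProd_eq_prod_charLocal χ (hα n h)]
      · rw [not_not.1 h, zero_mul]
    rw [h1, hS]
    simp_rw [Finset.mul_sum]
    rw [Finset.sum_comm, Complex.ofReal_sum]
    refine Finset.sum_congr rfl fun χ _ => ?_
    have : ((‖A χ‖ ^ 2 : ℝ) : ℂ) = star (A χ) * A χ := by
      rw [mul_comm, RCLike.star_def, Complex.mul_conj, Complex.normSq_eq_norm_sq]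
    rw [this]
    conv_lhs => rw [hA]
    simp only
    rw [Finset.mul_sum]
    exact Finset.sum_congr rfl fun n _ => by simp only [hA]; ring
  have hSle : S ≤ ∑ n ∈ G, ‖α n‖ * ‖B n‖ := by
    rw [← Real.norm_of_nonneg hS0, ← Complex.norm_real, hSeq]
    refine (norm_sum_le _ _).trans (le_of_eq (Finset.sum_congr rfl fun n _ => norm_mul _ _))
  have hcs : (∑ n ∈ G, ‖α n‖ * ‖B n‖) ^ 2 ≤ T * (K * S) := by
    have h1 : ∑ n ∈ G, ‖α n‖ * ‖B n‖
        = ∑ n ∈ G, (‖α n‖ * Real.sqrt n) * (‖B n‖ / Real.sqrt n) := by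
      refine Finset.sum_congr rfl fun n hn => ?_
      have hn0 : 0 < n := (Nat.zero_le _).trans_lt
        (Finset.mem_Ioc.1 (Finset.mem_filter.1 hn).1).1
      have : Real.sqrt n ≠ 0 := (Real.sqrt_pos.2 (by exact_mod_cast hn0)).ne'
      field_simp
    rw [h1]
    refine (Finset.sum_mul_sq_le_sq_mul_sq _ _ _).trans ?_
    refine mul_le_mul ?_ ?_ (Finset.sum_nonneg fun n _ => by positivity) hT0
    · rw [hT]
      refine le_trans (le_of_eq ?_) (Finset.sum_le_sum_of_subset_of_nonneg
        hGsub fun n _ _ => by positivity)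
      exact Finset.sum_congr rfl fun n _ => by
        rw [mul_pow, Real.sq_sqrt (Nat.cast_nonneg _)]
    · refine le_trans (le_of_eq ?_) hlow2
      exact Finset.sum_congr rfl fun n _ => by
        rw [div_pow, Real.sq_sqrt (Nat.cast_nonneg _)]; ring
  have h5 : S ^ 2 ≤ T * (K * S) := (pow_le_pow_left₀ hS0 hSle 2).trans hcs
  rcases hS0.eq_or_lt with h | h
  · rw [← h]; positivity
  · have : S * S ≤ (K * T) * S := by nlinarith
    exact le_of_mul_le_mul_right this h

end LargeSieve

section UnitMean

variable {q : ℕ} [NeZero q]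

/-- The mean of a function over the units of `ZMod q`. -/
noncomputable def unitMean (f : ZMod q → ℝ) : ℝ := (∑ u : (ZMod q)ˣ, f u) / q.totient

/-- The Fourier coefficient of a function on the units of `ZMod q`. -/
noncomputable def unitCoeff (f : ZMod q → ℝ) (χ : DirichletCharacter ℂ q) : ℂ :=
  (∑ u : (ZMod q)ˣ, (f u : ℂ) * χ (u⁻¹ : (ZMod q)ˣ)) / q.totient

theorem unitCoeff_one (f : ZMod q → ℝ) : unitCoeff f 1 = unitMean f := by
  rw [unitCoeff, unitMean]
  push_cast
  simp

theorem norm_unitCoeff_le (f : ZMod q → ℝ) (χ : DirichletCharacter ℂ q) :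
    ‖unitCoeff f χ‖ ≤ unitMean fun x => |f x| := by
  rw [unitCoeff, unitMean, norm_div, Complex.norm_natCast]
  refine div_le_div_of_nonneg_right ((norm_sum_le _ _).trans (Finset.sum_le_sum fun u _ => ?_))
    (Nat.cast_nonneg _)
  rw [norm_mul, Complex.norm_real, Real.norm_eq_abs]
  exact mul_le_of_le_one_right (abs_nonneg _) (χ.norm_le_one _)

theorem sum_unitCoeff_mul (f : ZMod q → ℝ) {x : ZMod q} (hx : IsUnit x) :
    ∑ χ : DirichletCharacter ℂ q, unitCoeff f χ * χ x = f x := by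
  obtain ⟨v, rfl⟩ := hx
  have hq : (q.totient : ℂ) ≠ 0 := by
    exact_mod_cast (Nat.totient_pos.2 (Nat.pos_of_ne_zero (NeZero.ne q))).ne'
  simp only [unitCoeff, div_mul_eq_mul_div, Finset.sum_mul]
  rw [← Finset.sum_div, Finset.sum_comm, div_eq_iff hq]
  have h : ∀ u : (ZMod q)ˣ, ∑ χ : DirichletCharacter ℂ q,
      (f u : ℂ) * χ (u⁻¹ : (ZMod q)ˣ) * χ v = if u = v then (f v : ℂ) * q.totient else 0 := by
    intro u
    simp_rw [mul_assoc]
    rw [← Finset.mul_sum]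
    have := DirichletCharacter.sum_char_inv_mul_char_eq ℂ (n := q) u.isUnit (v : ZMod q)
    rw [ZMod.inv_coe_unit] at this
    rw [this]
    by_cases huv : u = v
    · simp [huv]
    · rw [if_neg (fun h => huv (Units.ext h)), if_neg huv, mul_zero]
  rw [Finset.sum_congr rfl fun u _ => h u]
  simp

theorem unitCoeff_const (c : ℝ) {χ : DirichletCharacter ℂ q} (hχ : χ ≠ 1) {f : ZMod q → ℝ}
    (hf : ∀ u : (ZMod q)ˣ, f u = c) : unitCoeff f χ = 0 := by
  rw [unitCoeff]
  simp_rw [hf]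
  rw [← Finset.mul_sum]
  have h1 : ∑ u : (ZMod q)ˣ, χ (u⁻¹ : (ZMod q)ˣ) = ∑ u : (ZMod q)ˣ, χ u :=
    Equiv.sum_comp (Equiv.inv _) fun u : (ZMod q)ˣ => χ u
  have h2 : ∑ u : (ZMod q)ˣ, χ u = 0 := by
    have h := MulChar.sum_eq_zero_of_ne_one hχ
    rw [← h]
    classical
    symm
    rw [← Finset.sum_subset (Finset.subset_univ
      (Finset.univ.map ⟨((↑) : (ZMod q)ˣ → ZMod q), Units.val_injective⟩))]
    · rw [Finset.sum_map]; rfl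
    · intro x _ hx
      refine MulChar.map_nonunit _ fun hu => hx ?_
      exact Finset.mem_map.2 ⟨hu.unit, Finset.mem_univ _, hu.unit_spec⟩
  rw [h1, h2, mul_zero, zero_div]

theorem unitMean_add (f g : ZMod q → ℝ) :
    unitMean (fun x => f x + g x) = unitMean f + unitMean g := by
  simp [unitMean, Finset.sum_add_distrib, add_div]

theorem unitMean_const_mul (c : ℝ) (f : ZMod q → ℝ) :
    unitMean (fun x => c * f x) = c * unitMean f := by
  simp [unitMean, ← Finset.mul_sum, mul_div_assoc]

theorem unitMean_congr {f g : ZMod q → ℝ} (h : ∀ u : (ZMod q)ˣ, f u = g u) :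
    unitMean f = unitMean g := by simp [unitMean, h]

theorem unitMean_mono {f g : ZMod q → ℝ} (h : ∀ u : (ZMod q)ˣ, f u ≤ g u) :
    unitMean f ≤ unitMean g :=
  div_le_div_of_nonneg_right (Finset.sum_le_sum fun u _ => h u) (Nat.cast_nonneg _)

theorem unitMean_const (c : ℝ) : unitMean (fun _ : ZMod q => c) = c := by
  have hq : (q.totient : ℝ) ≠ 0 := by
    exact_mod_cast (Nat.totient_pos.2 (Nat.pos_of_ne_zero (NeZero.ne q))).ne'
  rw [unitMean, Finset.sum_const, Finset.card_univ, ZMod.card_units_eq_totient, nsmul_eq_mul,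
    mul_div_cancel_left₀ _ hq]

theorem unitMean_ite_eq {c : ZMod q} (hc : IsUnit c) :
    unitMean (fun x => if x = c then (1 : ℝ) else 0) = 1 / q.totient := by
  obtain ⟨v, rfl⟩ := hc
  rw [unitMean]
  simp [Units.val_inj]

end UnitMean

section PairModel

variable {J : Type*} [DecidableEq J]

/-- The approximate means over units of products of two local factors. -/
noncomputable def pairModel (m : J) (p : ℕ) : Option J → Option J → ℝ
  | none, none => 1
  | some j, none => if j = m then 1 / p else 0
  | none, some j => if j = m then 1 / p else 0
  | some j, some j' => if j = j' ∧ j ≠ m then 1 / p else 0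

/-- The pairs of local factors which give a main contribution. -/
def pairEmb (m : J) : Option (Option J) → Option J × Option J
  | none => (none, none)
  | some none => (none, some m)
  | some (some j) => if j = m then (some j, none) else (some j, some j)

theorem pairEmb_injective (m : J) : Function.Injective (pairEmb m) := by
  rintro (_ | _ | j) (_ | _ | j') h
  all_goals simp only [pairEmb] at h
  all_goals (try split_ifs at h) <;> simp_all

theorem pairModel_pairEmb (m : J) (p : ℕ) (l : Option J) :
    pairModel m p (pairEmb m (some l)).1 (pairEmb m (some l)).2 = 1 / p := by
  rcases l with _ | j
  · simp [pairEmb, pairModel]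
  · by_cases h : j = m
    · simp [pairEmb, pairModel, h]
    · simp [pairEmb, pairModel, h]

theorem pairModel_eq_zero (m : J) (p : ℕ) {o : Option J × Option J}
    (ho : o ∉ Set.range (pairEmb m)) : pairModel m p o.1 o.2 = 0 := by
  obtain ⟨_ | j, _ | j'⟩ := o
  · exact absurd ⟨none, rfl⟩ ho
  · have : j' ≠ m := fun h => ho ⟨some none, by simp [pairEmb, h]⟩
    simp [pairModel, this]
  · have : j ≠ m := fun h => ho ⟨some (some m), by simp [pairEmb, h]⟩
    simp [pairModel, this]
  · have : ¬ (j = j' ∧ j ≠ m) := fun h => ho ⟨some (some j), by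
      obtain ⟨rfl, h2⟩ := h
      simp [pairEmb, h2]⟩
    simp only [pairModel, this, if_false]

theorem pairModel_nonneg (m : J) (p : ℕ) (o o' : Option J) : 0 ≤ pairModel m p o o' := by
  rcases o with _ | j <;> rcases o' with _ | j' <;> simp only [pairModel]
  · exact zero_le_one
  all_goals split_ifs <;> positivity

variable {p : ℕ}

theorem sieveFactor_none (c : J → ZMod p) (x : ZMod p) : sieveFactor c none x = 1 := rfl

theorem sieveFactor_some (c : J → ZMod p) (j : J) (x : ZMod p) :
    sieveFactor c (some j) x = 1 / p - if x = c j then 1 else 0 := rfl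

theorem abs_unitMean_sieveFactor_sub_le (hp : p.Prime) (hp3 : 3 ≤ p) [NeZero p] {c : J → ZMod p}
    (hc : Function.Injective c) {m : J} (hm : c m = 0) (o o' : Option J) :
    |unitMean (fun x => sieveFactor c o x * sieveFactor c o' x) - pairModel m p o o'|
      ≤ if o = none ∧ o' = none then 0 else 2 * (1 / (p : ℝ)) ^ 2 := by
  have : Fact p.Prime := ⟨hp⟩
  have hp3' : (3 : ℝ) ≤ p := by exact_mod_cast hp3
  have hφ : (p.totient : ℝ) = p - 1 := by
    rw [Nat.totient_prime hp, Nat.cast_sub hp.one_le, Nat.cast_one]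
  have hp0 : (0 : ℝ) < p := by linarith
  have hp1 : (0 : ℝ) < (p : ℝ) - 1 := by linarith
  have hfm : ∀ u : (ZMod p)ˣ, sieveFactor c (some m) u = 1 / p := by
    intro u; simp [sieveFactor, hm]
  have hcj : ∀ j, j ≠ m → IsUnit (c j) := fun j hj =>
    isUnit_iff_ne_zero.2 fun h => hj (hc (h.trans hm.symm))
  have hj1 : ∀ j, j ≠ m → unitMean (sieveFactor c (some j)) = 1 / p - 1 / (p - 1) := by
    intro j hj
    have : sieveFactor c (some j)
        = fun x => (1 / (p : ℝ)) + (-1) * if x = c j then (1 : ℝ) else 0 := by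
      funext x; rw [sieveFactor_some]; ring
    rw [this, unitMean_add, unitMean_const_mul, unitMean_const, unitMean_ite_eq (hcj j hj), hφ]
    ring
  have e1 : |1 / (p : ℝ) - 1 / (p - 1)| ≤ 2 * (1 / (p : ℝ)) ^ 2 := by
    rw [abs_sub_comm, abs_of_nonneg (sub_nonneg.2 (one_div_le_one_div_of_le hp1 (by linarith)))]
    rw [div_sub_div _ _ hp1.ne' hp0.ne', one_div, inv_pow, ← div_eq_mul_inv,
      div_le_div_iff₀ (by positivity) (by positivity)]
    nlinarith
  have hsq : (1 / (p : ℝ)) ^ 2 ≤ 2 * (1 / (p : ℝ)) ^ 2 := by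
    have : 0 ≤ (1 / (p : ℝ)) ^ 2 := by positivity
    linarith
  have key : ∀ o o' : Option J, ∀ r : ℝ,
      unitMean (fun x => sieveFactor c o x * sieveFactor c o' x) = r →
      unitMean (fun x => sieveFactor c o' x * sieveFactor c o x) = r := fun o o' r h => by
    rw [← h]; exact unitMean_congr fun u => mul_comm _ _
  have hmn : ∀ g : ZMod p → ℝ,
      unitMean (fun x => sieveFactor c (some m) x * g x) = 1 / p * unitMean g := by
    intro g
    rw [← unitMean_const_mul]
    exact unitMean_congr fun u => by rw [hfm]
  have hpos2 : (0 : ℝ) ≤ 2 * (1 / (p : ℝ)) ^ 2 := by positivity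
  have hp1' : 1 / (p : ℝ) ≤ 1 := by rw [div_le_one hp0]; linarith
  have e2 : |1 / (p : ℝ) * (1 / (p : ℝ) - 1 / (p - 1))| ≤ 2 * (1 / (p : ℝ)) ^ 2 := by
    rw [abs_mul, abs_of_nonneg (by positivity : 0 ≤ 1 / (p : ℝ))]
    exact (mul_le_of_le_one_left (abs_nonneg _) hp1').trans e1
  have hone : unitMean (fun x => sieveFactor c none x * sieveFactor c none x) = 1 := by
    rw [← unitMean_const (q := p) 1]
    exact unitMean_congr fun u => by simp [sieveFactor]
  have hjn : ∀ j, unitMean (fun x => sieveFactor c (some j) x * sieveFactor c none x)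
      = unitMean (sieveFactor c (some j)) := fun j => unitMean_congr fun u => by
    rw [sieveFactor_none, mul_one]
  have hmm : unitMean (sieveFactor c (some m)) = 1 / p := by
    rw [← unitMean_const (q := p) (1 / p)]
    exact unitMean_congr hfm
  have hsome : ∀ j, |unitMean (fun x => sieveFactor c (some j) x * sieveFactor c none x)
      - pairModel m p (some j) none| ≤ 2 * (1 / (p : ℝ)) ^ 2 := by
    intro j
    rw [hjn]
    by_cases h : j = m
    · rw [h, hmm]; simp [pairModel]
    · rw [hj1 j h]; simpa [pairModel, h] using e1
  rcases o with _ | j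
  · rcases o' with _ | j'
    · rw [hone]; simp [pairModel]
    · rw [if_neg (by simp), key _ _ _ rfl]
      exact hsome j'
  rcases o' with _ | j'
  · rw [if_neg (by simp)]
    exact hsome j
  rw [if_neg (by simp)]
  by_cases h : j = m
  · subst h
    rw [hmn]
    by_cases h' : j' = j
    · subst h'
      rw [hmm]
      have : |1 / (p : ℝ) * (1 / p)| ≤ 2 * (1 / (p : ℝ)) ^ 2 := by
        rw [← sq, abs_of_nonneg (by positivity)]; exact hsq
      simpa [pairModel] using this
    · rw [hj1 j' h']
      simpa [pairModel] using e2
  by_cases h' : j' = m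
  · subst h'
    rw [key _ _ _ (hmn _), hj1 j h]
    simpa [pairModel, h] using e2
  by_cases hjj : j = j'
  · subst hjj
    have e3 : unitMean (fun x => sieveFactor c (some j) x * sieveFactor c (some j) x)
        = (1 / (p : ℝ)) ^ 2 + (1 - 2 * (1 / (p : ℝ))) * (1 / (p - 1)) := by
      rw [← hφ, ← unitMean_ite_eq (hcj j h), ← unitMean_const_mul,
        ← unitMean_const (q := p) ((1 / (p : ℝ)) ^ 2), ← unitMean_add]
      refine unitMean_congr fun u => ?_
      rw [sieveFactor_some]
      split_ifs <;> ring
    rw [e3]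
    have e4 : (1 / (p : ℝ)) ^ 2 + (1 - 2 * (1 / (p : ℝ))) * (1 / (p - 1)) - 1 / p
        = - ((1 / (p : ℝ)) ^ 2 * (1 / (p - 1))) := by
      field_simp; ring
    have e5 : |(1 / (p : ℝ)) ^ 2 + (1 - 2 * (1 / (p : ℝ))) * (1 / (p - 1)) - 1 / p|
        ≤ 2 * (1 / (p : ℝ)) ^ 2 := by
      rw [e4, abs_neg, abs_of_nonneg (by positivity)]
      refine le_trans (mul_le_of_le_one_right (by positivity) ?_) hsq
      rw [div_le_one hp1]; linarith
    simpa [pairModel, h] using e5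
  · have e3 : unitMean (fun x => sieveFactor c (some j) x * sieveFactor c (some j') x)
        = (1 / (p : ℝ)) ^ 2 + -(1 / (p : ℝ)) * (1 / (p - 1)) + -(1 / (p : ℝ)) * (1 / (p - 1)) := by
      rw [unitMean_congr (g := fun x => ((1 / (p : ℝ)) ^ 2
          + -(1 / (p : ℝ)) * if x = c j then (1 : ℝ) else 0)
          + -(1 / (p : ℝ)) * if x = c j' then (1 : ℝ) else 0),
        unitMean_add, unitMean_add, unitMean_const_mul, unitMean_const_mul, unitMean_const,
        unitMean_ite_eq (hcj j h), unitMean_ite_eq (hcj j' h'), hφ]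
      intro u
      rw [sieveFactor_some, sieveFactor_some]
      have : ¬ ((u : ZMod p) = c j ∧ (u : ZMod p) = c j') := fun hh =>
        hjj (hc (hh.1.symm.trans hh.2))
      split_ifs with h1 h2 <;> first | exact absurd ⟨‹_›, ‹_›⟩ this | ring
    rw [e3]
    have e4 : (1 / (p : ℝ)) ^ 2 + -(1 / (p : ℝ)) * (1 / (p - 1)) + -(1 / (p : ℝ)) * (1 / (p - 1))
        = - ((p + 1) / (p - 1) * (1 / (p : ℝ)) ^ 2) := by
      field_simp; ring
    have e5 : |(1 / (p : ℝ)) ^ 2 + -(1 / (p : ℝ)) * (1 / (p - 1)) + -(1 / (p : ℝ)) * (1 / (p - 1))|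
        ≤ 2 * (1 / (p : ℝ)) ^ 2 := by
      rw [e4, abs_neg, abs_of_nonneg (by positivity)]
      refine mul_le_mul_of_nonneg_right ?_ (by positivity)
      rw [div_le_iff₀ hp1]; linarith
    simpa [pairModel, hjj] using e5

theorem unitMean_abs_sieveFactor_mul_le (hp : p.Prime) [NeZero p] (c : J → ZMod p)
    {o o' : Option J} (h : o ≠ none ∨ o' ≠ none) :
    unitMean (fun x => |sieveFactor c o x * sieveFactor c o' x|) ≤ 4 * (1 / (p : ℝ)) := by
  have hp2 : (2 : ℝ) ≤ p := by exact_mod_cast hp.two_le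
  have : Fact p.Prime := ⟨hp⟩
  have hφ : (p.totient : ℝ) = p - 1 := by
    rw [Nat.totient_prime hp, Nat.cast_sub hp.one_le, Nat.cast_one]
  have key : ∀ j, unitMean (fun x => |sieveFactor c (some j) x|) ≤ 4 * (1 / (p : ℝ)) := by
    intro j
    have h1 : unitMean (fun x => |sieveFactor c (some j) x|)
        ≤ unitMean (fun x => 1 / (p : ℝ) + if x = c j then (1 : ℝ) else 0) := by
      refine unitMean_mono fun u => ?_
      rw [sieveFactor_some]
      refine (abs_sub _ _).trans ?_
      rw [abs_of_nonneg (by positivity : (0 : ℝ) ≤ 1 / p)]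
      gcongr
      split_ifs <;> simp
    refine h1.trans ?_
    rw [unitMean_add, unitMean_const]
    have h2 : unitMean (fun x => if x = c j then (1 : ℝ) else 0) ≤ 1 / (p - 1) := by
      by_cases hu : IsUnit (c j)
      · rw [unitMean_ite_eq hu, hφ]
      · rw [unitMean_congr (g := fun _ => 0), unitMean_const]
        · exact div_nonneg zero_le_one (by linarith)
        · intro u
          rw [if_neg]
          rintro hh
          exact hu (hh ▸ u.isUnit)
    have h3 : 1 / ((p : ℝ) - 1) ≤ 3 * (1 / p) := by
      rw [mul_one_div, div_le_div_iff₀ (by linarith) (by linarith)]; linarith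
    linarith
  rcases o with _ | j
  · rcases o' with _ | j'
    · simp at h
    · refine le_trans (unitMean_mono fun u => ?_) (key j')
      rw [abs_mul]
      exact mul_le_of_le_one_left (abs_nonneg _) (abs_sieveFactor_le_one hp.one_lt _ _ _)
  · refine le_trans (unitMean_mono fun u => ?_) (key j)
    rw [abs_mul]
    exact mul_le_of_le_one_right (abs_nonneg _) (abs_sieveFactor_le_one hp.one_lt _ _ _)

end PairModel

section UnitForm

variable {ι J : Type*} [Fintype ι] [DecidableEq ι] [Fintype J] [DecidableEq J] {P : ι → ℕ}

/-- Upper bounds for sums over pairs of tuples with local weights close to `pairModel`. -/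
theorem sum_prod_mul_prod_mul_le (hP : ∀ i, 0 < P i) (m : J) {G G' : J → ℕ → ℝ}
    (hG0 : ∀ j n, 0 ≤ G j n) (hG0' : ∀ j n, 0 ≤ G' j n) (hG : ∀ j, Antitone (G j))
    (hG' : ∀ j, Antitone (G' j)) (U : Finset ι) {u : ι → Option J × Option J → ℝ}
    (hu0 : ∀ i o, 0 ≤ u i o) (hu1 : ∀ i ∉ U, u i (none, none) ≤ 1)
    (hu2 : ∀ i ∉ U, ∀ o ≠ (none, none),
      u i o ≤ pairModel m (P i) o.1 o.2 + 2 * (1 / (P i : ℝ)) ^ 2)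
    (hu3 : ∀ i ∈ U, u i (none, none) = 0)
    (hu4 : ∀ i ∈ U, ∀ o ≠ (none, none), u i o ≤ 4 * (1 / (P i : ℝ))) :
    ∑ σ : ι → Option J × Option J, ((∏ j, G j (tupleEntry P (fun i => (σ i).1) j))
        * ∏ j, G' j (tupleEntry P (fun i => (σ i).2) j)) * ∏ i, u i (σ i)
      ≤ (∏ i, if i ∈ U then 4 * ((Fintype.card J : ℝ) + 1) ^ 2 * (1 / (P i : ℝ))
          else 1 + 2 * ((Fintype.card J : ℝ) + 1) ^ 2 * (1 / (P i : ℝ)) ^ 2)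
        * (setSum P (G m) * setSum P (G' m)
          * ∏ j ∈ Finset.univ.erase m, setSum P (fun n => G j n * G' j n)) := by
  set c : ι → ℝ := fun i => if i ∈ U then 4 * ((Fintype.card J : ℝ) + 1) ^ 2 * (1 / (P i : ℝ))
          else 1 + 2 * ((Fintype.card J : ℝ) + 1) ^ 2 * (1 / (P i : ℝ)) ^ 2 with hc
  have hc0 : ∀ i, 0 ≤ c i := fun i => by simp only [hc]; split_ifs <;> positivity
  have hpr0 : ∀ s : ι → Option J, 0 ≤ ∏ j, G j (tupleEntry P s j) := fun s =>
    Finset.prod_nonneg fun j _ => hG0 j _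
  have hpr0' : ∀ s : ι → Option J, 0 ≤ ∏ j, G' j (tupleEntry P s j) := fun s =>
    Finset.prod_nonneg fun j _ => hG0' j _
  have hdec : IsDecr (pairEmb m none) fun σ : ι → Option J × Option J =>
      (∏ j, G j (tupleEntry P (fun i => (σ i).1) j))
        * ∏ j, G' j (tupleEntry P (fun i => (σ i).2) j) :=
    IsDecr.fst_mul_snd (y := fun s => ∏ j, G j (tupleEntry P s j))
      (z := fun s => ∏ j, G' j (tupleEntry P s j))
      (IsDecr.prod _ (fun j _ => isDecr_entry hP (hG j) j) fun j _ s => hG0 j _)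
      (IsDecr.prod _ (fun j _ => isDecr_entry hP (hG' j) j) fun j _ s => hG0' j _) hpr0 hpr0'
  have hcard : ((Finset.univ.erase (pairEmb m none)).card : ℝ)
      ≤ ((Fintype.card J : ℝ) + 1) ^ 2 := by
    have : (Finset.univ.erase (pairEmb m none) : Finset (Option J × Option J)).card
        ≤ (Fintype.card J + 1) ^ 2 := by
      refine (Finset.card_erase_le).trans (le_of_eq ?_)
      rw [Finset.card_univ, Fintype.card_prod, Fintype.card_option, sq]
    exact_mod_cast this
  have hmain := hdec.sum_mul_prod_le_sum_comp_div (P := P) (pairEmb_injective m)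
    (fun σ => mul_nonneg (hpr0 _) (hpr0' _)) hu0 hc0
    (v := fun i o => pairModel m (P i) o.1 o.2) (fun i => rfl)
    (fun i l => pairModel_pairEmb m (P i) l) (fun i o ho => pairModel_eq_zero m (P i) ho) (by
      intro i
      have hsum : ∀ r : ℝ, 0 ≤ r → (∀ o ≠ (none, none),
          u i o ≤ c i * pairModel m (P i) o.1 o.2 + r) →
          ∑ o ∈ Finset.univ.erase (pairEmb m none),
            max (u i o - c i * pairModel m (P i) o.1 o.2) 0
          ≤ ((Fintype.card J : ℝ) + 1) ^ 2 * r := by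
        intro r hr h
        refine (Finset.sum_le_card_nsmul _ _ r fun o ho => ?_).trans ?_
        · refine max_le ?_ hr
          have := h o (Finset.mem_erase.1 ho).1
          linarith
        · rw [nsmul_eq_mul]
          exact mul_le_mul_of_nonneg_right hcard hr
      by_cases hi : i ∈ U
      · have := hsum (4 * (1 / (P i : ℝ))) (by positivity) (fun o ho => (hu4 i hi o ho).trans
          (le_add_of_nonneg_left (mul_nonneg (hc0 i) (pairModel_nonneg _ _ _ _))))
        change u i (none, none) + _ ≤ _
        rw [hu3 i hi, zero_add]
        refine this.trans (le_of_eq ?_)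
        simp only [hc, hi, if_true]
        ring
      · have hci : c i = 1 + 2 * ((Fintype.card J : ℝ) + 1) ^ 2 * (1 / (P i : ℝ)) ^ 2 := by
          simp only [hc, hi, if_false]
        have := hsum (2 * (1 / (P i : ℝ)) ^ 2) (by positivity) (fun o ho =>
          (hu2 i hi o ho).trans (add_le_add_left
            (le_mul_of_one_le_left (pairModel_nonneg _ _ _ _) (by
              rw [hci]; exact le_add_of_nonneg_right (by positivity))) _))
        have h1 := hu1 i hi
        change u i (none, none) + _ ≤ _
        rw [hci] at this ⊢
        linarith)
  refine hmain.trans (mul_le_mul_of_nonneg_left ?_ (Finset.prod_nonneg fun i _ => hc0 i))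
  set H : Option J → ℕ → ℝ := fun l => match l with
    | none => G' m
    | some j => if j = m then G m else fun n => G j n * G' j n with hH
  have hH0 : ∀ l n, 0 ≤ H l n := by
    rintro (_ | j) n
    · exact hG0' m n
    · simp only [hH]
      split_ifs
      · exact hG0 m n
      · exact mul_nonneg (hG0 j n) (hG0' j n)
  have hprod : ∏ l, setSum P (H l) = setSum P (G m) * setSum P (G' m)
      * ∏ j ∈ Finset.univ.erase m, setSum P (fun n => G j n * G' j n) := by
    rw [Fintype.prod_option, ← Finset.mul_prod_erase _ _ (Finset.mem_univ m)]
    have : ∀ j ∈ Finset.univ.erase m, setSum P (H (some j))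
        = setSum P (fun n => G j n * G' j n) := by
      intro j hj
      simp only [hH, (Finset.mem_erase.1 hj).1, if_false]
    rw [Finset.prod_congr rfl this]
    simp only [hH, if_true]
    ring
  rw [← hprod]
  refine le_trans (le_of_eq ?_) (sum_prod_tupleEntry_div_le (P := P) hH0)
  refine Finset.sum_congr rfl fun t _ => ?_
  congr 1
  have e1 : ∀ j, entrySet (fun i => ((pairEmb m ∘ t) i).1) j = entrySet t (some j) := by
    intro j
    ext i
    simp only [entrySet, Finset.mem_filter, Finset.mem_univ, true_and, Function.comp]
    rcases t i with _ | _ | l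
    · simp [pairEmb]
    · simp [pairEmb]
    · by_cases hl : l = m <;> simp [pairEmb, hl]
  have e2 : ∀ j, entrySet (fun i => ((pairEmb m ∘ t) i).2) j
      = entrySet t (if j = m then none else some j) := by
    intro j
    ext i
    simp only [entrySet, Finset.mem_filter, Finset.mem_univ, true_and, Function.comp]
    rcases t i with _ | _ | l
    · simp [pairEmb]
    · by_cases hj : j = m
      · simp [pairEmb, hj]
      · simp [pairEmb, hj]; exact fun h => hj h.symm
    · by_cases hl : l = m
      · by_cases hj : j = m
        · simp [pairEmb, hl, hj]
        · simp [pairEmb, hl, hj]; exact fun h => hj h.symm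
      · by_cases hj : j = m
        · simp [pairEmb, hl, hj]
        · simp [pairEmb, hl, hj]
  simp only [tupleEntry, e1, e2]
  rw [Fintype.prod_option, ← Finset.mul_prod_erase _ _ (Finset.mem_univ m),
    ← Finset.mul_prod_erase _ (fun j => G' j _) (Finset.mem_univ m),
    ← Finset.mul_prod_erase _ (fun j => H (some j) _) (Finset.mem_univ m)]
  have e3 : ∀ j ∈ Finset.univ.erase m, H (some j) (setProd P (entrySet t (some j)))
      = G j (setProd P (entrySet t (some j)))
        * G' j (setProd P (entrySet t (if j = m then none else some j))) := by
    intro j hj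
    simp only [hH, (Finset.mem_erase.1 hj).1, if_false]
  rw [Finset.prod_congr rfl e3, Finset.prod_mul_distrib]
  simp only [hH, if_true]
  ring

variable [∀ i, NeZero (P i)] {c : ∀ i, J → ZMod (P i)}

/-- The mean over units of the product of two sieve weights. -/
noncomputable def unitForm (c : ∀ i, J → ZMod (P i)) (y z : (ι → Option J) → ℝ) : ℝ :=
  ∑ s, ∑ t, y s * z t *
    ∏ i, unitMean (fun x => sieveFactor (c i) (s i) x * sieveFactor (c i) (t i) x)

theorem unitForm_eq (y z : (ι → Option J) → ℝ) :
    unitForm c y z = (∏ i, (((P i).totient : ℝ))⁻¹) * ∑ u : ∀ i, (ZMod (P i))ˣ,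
      sieveWeight c y (fun i => u i) * sieveWeight c z (fun i => u i) := by
  have h1 : ∀ s t : ι → Option J,
      ∏ i, unitMean (fun x => sieveFactor (c i) (s i) x * sieveFactor (c i) (t i) x)
      = (∏ i, (((P i).totient : ℝ))⁻¹) * ∑ u : ∀ i, (ZMod (P i))ˣ,
        ∏ i, (sieveFactor (c i) (s i) (u i) * sieveFactor (c i) (t i) (u i)) := by
    intro s t
    simp only [unitMean, div_eq_inv_mul]
    rw [Finset.prod_mul_distrib, Finset.prod_univ_sum, Fintype.piFinset_univ]
  simp only [unitForm, h1]
  simp_rw [sieveWeight, Finset.sum_mul_sum, Finset.prod_mul_distrib, Finset.mul_sum]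
  have : ∀ s : ι → Option J, ∑ t : ι → Option J, ∑ u : ∀ i, (ZMod (P i))ˣ,
      y s * z t * ((∏ i, (((P i).totient : ℝ))⁻¹) *
        ((∏ i, sieveFactor (c i) (s i) (u i)) * ∏ i, sieveFactor (c i) (t i) (u i)))
      = ∑ u : ∀ i, (ZMod (P i))ˣ, ∑ t : ι → Option J,
      y s * z t * ((∏ i, (((P i).totient : ℝ))⁻¹) *
        ((∏ i, sieveFactor (c i) (s i) (u i)) * ∏ i, sieveFactor (c i) (t i) (u i))) :=
    fun s => Finset.sum_comm
  simp_rw [this]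
  rw [Finset.sum_comm]
  refine Finset.sum_congr rfl fun u _ => Finset.sum_congr rfl fun s _ =>
    Finset.sum_congr rfl fun t _ => by ring

theorem unitForm_sq_le (y z : (ι → Option J) → ℝ) :
    unitForm c y z ^ 2 ≤ unitForm c y y * unitForm c z z := by
  rw [unitForm_eq, unitForm_eq, unitForm_eq, mul_pow]
  have h := Finset.sum_mul_sq_le_sq_mul_sq Finset.univ
    (fun u : ∀ i, (ZMod (P i))ˣ => sieveWeight c y (fun i => (u i : ZMod (P i))))
    (fun u => sieveWeight c z (fun i => (u i : ZMod (P i))))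
  simp only [← sq]
  refine (mul_le_mul_of_nonneg_left h (sq_nonneg _)).trans (le_of_eq ?_)
  ring

theorem unitForm_self_nonneg (y : (ι → Option J) → ℝ) : 0 ≤ unitForm c y y := by
  rw [unitForm_eq]
  exact mul_nonneg (Finset.prod_nonneg fun i _ => by positivity)
    (Finset.sum_nonneg fun u _ => mul_self_nonneg _)

theorem unitForm_le (hP : ∀ i, (P i).Prime) (hP3 : ∀ i, 3 ≤ P i)
    (hc : ∀ i, Function.Injective (c i)) {m : J} (hm : ∀ i, c i m = 0) {G : J → ℕ → ℝ}
    (hG0 : ∀ j n, 0 ≤ G j n) (hG : ∀ j, Antitone (G j)) :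
    unitForm c (fun s => ∏ j, G j (tupleEntry P s j)) (fun s => ∏ j, G j (tupleEntry P s j))
      ≤ (∏ i, (1 + 2 * ((Fintype.card J : ℝ) + 1) ^ 2 * (1 / (P i : ℝ)) ^ 2))
        * (setSum P (G m) * setSum P (G m)
          * ∏ j ∈ Finset.univ.erase m, setSum P (fun n => G j n * G j n)) := by
  have h := sum_prod_mul_prod_mul_le (fun i => (hP i).pos) m hG0 hG0 hG hG ∅
    (u := fun i o => |unitMean (fun x => sieveFactor (c i) o.1 x * sieveFactor (c i) o.2 x)|)
    (fun _ _ => abs_nonneg _) (fun i _ => by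
      have := abs_unitMean_sieveFactor_sub_le (hP i) (hP3 i) (hc i) (hm i) none none
      simp only [and_self, if_true, pairModel] at this
      have h1 := abs_nonpos_iff.1 this
      rw [sub_eq_zero.1 h1, abs_one]) (fun i _ o ho => by
      have := abs_unitMean_sieveFactor_sub_le (hP i) (hP3 i) (hc i) (hm i) o.1 o.2
      rw [if_neg (fun h => ho (Prod.ext h.1 h.2))] at this
      have h1 := abs_sub_abs_le_abs_sub (unitMean fun x => sieveFactor (c i) o.1 x
        * sieveFactor (c i) o.2 x) (pairModel m (P i) o.1 o.2)
      rw [abs_of_nonneg (pairModel_nonneg m (P i) o.1 o.2)] at h1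
      linarith) (fun i hi => absurd hi (Finset.notMem_empty _))
      (fun i hi => absurd hi (Finset.notMem_empty _))
  simp only [Finset.notMem_empty, if_false] at h
  refine le_trans ?_ h
  rw [unitForm, sum_mul_sum_eq_sum_pair fun s t : ι → Option J => (∏ j, G j (tupleEntry P s j))
    * (∏ j, G j (tupleEntry P t j)) * ∏ i, unitMean fun x => sieveFactor (c i) (s i) x
      * sieveFactor (c i) (t i) x]
  refine Finset.sum_le_sum fun σ _ => mul_le_mul_of_nonneg_left ?_
    (mul_nonneg (Finset.prod_nonneg fun j _ => hG0 j _) (Finset.prod_nonneg fun j _ => hG0 j _))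
  exact (le_abs_self _).trans (Finset.abs_prod _ _).le

open Classical in
theorem le_unitForm (hP : ∀ i, (P i).Prime) (hP3 : ∀ i, 3 ≤ P i)
    (hc : ∀ i, Function.Injective (c i)) {m : J} (hm : ∀ i, c i m = 0)
    {y z : (ι → Option J) → ℝ} (hy0 : ∀ s, 0 ≤ y s) (hz0 : ∀ s, 0 ≤ z s)
    (hy : IsDecr none y) (hz : IsDecr none z) {δ : ℝ} (hδ : 0 ≤ δ)
    (hδ' : ∏ i, (1 + 2 * ((Fintype.card J : ℝ) + 1) ^ 2 * (1 / (P i : ℝ)) ^ 2) ≤ 2 - δ) :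
    δ * ∑ s, y s * z (fun i => if s i = some m then none else s i) / tupleSize P s
      ≤ unitForm c y z := by
  set u : ι → Option J × Option J → ℝ := fun i o =>
    unitMean (fun x => sieveFactor (c i) o.1 x * sieveFactor (c i) o.2 x) with hu
  set v : ι → Option J × Option J → ℝ := fun i o => pairModel m (P i) o.1 o.2 with hv
  set F : (ι → Option J × Option J) → ℝ :=
    fun σ => y (fun i => (σ i).1) * z (fun i => (σ i).2) with hF
  have hF0 : ∀ σ, 0 ≤ F σ := fun σ => mul_nonneg (hy0 _) (hz0 _)
  have hv0 : ∀ i o, 0 ≤ v i o := fun i o => pairModel_nonneg _ _ _ _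
  have hFd : IsDecr (none, none) F := IsDecr.fst_mul_snd hy hz hy0 hz0
  have hform : unitForm c y z = ∑ σ, F σ * ∏ i, u i (σ i) := by
    rw [unitForm, sum_mul_sum_eq_sum_pair fun s t : ι → Option J => y s * z t *
      ∏ i, unitMean fun x => sieveFactor (c i) (s i) x * sieveFactor (c i) (t i) x]
  have hM0 : 0 ≤ ∑ σ, F σ * ∏ i, v i (σ i) := Finset.sum_nonneg fun σ _ =>
    mul_nonneg (hF0 σ) (Finset.prod_nonneg fun i _ => hv0 i _)
  have hcard : ((Finset.univ.erase ((none, none) : Option J × Option J)).card : ℝ)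
      ≤ ((Fintype.card J : ℝ) + 1) ^ 2 := by
    have : (Finset.univ.erase ((none, none) : Option J × Option J)).card
        ≤ (Fintype.card J + 1) ^ 2 := by
      refine (Finset.card_erase_le).trans (le_of_eq ?_)
      rw [Finset.card_univ, Fintype.card_prod, Fintype.card_option, sq]
    exact_mod_cast this
  have herr := hFd.sum_mul_prod_le hF0 (u := fun i o => v i o + |u i o - v i o|) (v := v)
    (c := fun i => 1 + 2 * ((Fintype.card J : ℝ) + 1) ^ 2 * (1 / (P i : ℝ)) ^ 2)
    (fun i o => add_nonneg (hv0 i o) (abs_nonneg _)) hv0 (fun i => by positivity) (by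
      intro i
      have h0 : |u i (none, none) - v i (none, none)| = 0 := by
        have := abs_unitMean_sieveFactor_sub_le (hP i) (hP3 i) (hc i) (hm i) none none
        rw [if_pos ⟨rfl, rfl⟩] at this
        exact le_antisymm this (abs_nonneg _)
      have h1 : v i (none, none) = 1 := rfl
      rw [h0, h1]
      have : ∑ o ∈ Finset.univ.erase ((none, none) : Option J × Option J),
          max (v i o + |u i o - v i o| -
            (1 + 2 * ((Fintype.card J : ℝ) + 1) ^ 2 * (1 / (P i : ℝ)) ^ 2) * v i o) 0
          ≤ ((Fintype.card J : ℝ) + 1) ^ 2 * (2 * (1 / (P i : ℝ)) ^ 2) := by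
        refine (Finset.sum_le_card_nsmul _ _ (2 * (1 / (P i : ℝ)) ^ 2) fun o ho => ?_).trans ?_
        · refine max_le ?_ (by positivity)
          have h2 := abs_unitMean_sieveFactor_sub_le (hP i) (hP3 i) (hc i) (hm i) o.1 o.2
          rw [if_neg (fun h => (Finset.mem_erase.1 ho).1 (Prod.ext h.1 h.2))] at h2
          change |u i o - v i o| ≤ _ at h2
          have h3 : v i o ≤ (1 + 2 * ((Fintype.card J : ℝ) + 1) ^ 2 * (1 / (P i : ℝ)) ^ 2)
            * v i o := le_mul_of_one_le_left (hv0 i o) (le_add_of_nonneg_right (by positivity))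
          linarith
        · rw [nsmul_eq_mul]
          exact mul_le_mul_of_nonneg_right hcard (by positivity)
      linarith)
  have hlow : δ * ∑ σ, F σ * ∏ i, v i (σ i) ≤ unitForm c y z := by
    rw [hform]
    have h1 : ∑ σ, F σ * (2 * ∏ i, v i (σ i) - ∏ i, (v i (σ i) + |u i (σ i) - v i (σ i)|))
        ≤ ∑ σ, F σ * ∏ i, u i (σ i) := Finset.sum_le_sum fun σ _ =>
      mul_le_mul_of_nonneg_left (Finset.two_mul_prod_sub_prod_le _ fun i _ => hv0 i _) (hF0 σ)
    refine le_trans ?_ h1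
    simp_rw [mul_sub]
    rw [Finset.sum_sub_distrib]
    have h2 : ∑ σ, F σ * (2 * ∏ i, v i (σ i)) = 2 * ∑ σ, F σ * ∏ i, v i (σ i) := by
      rw [Finset.mul_sum]; exact Finset.sum_congr rfl fun _ _ => by ring
    have h3 := herr.trans (mul_le_mul_of_nonneg_right hδ' hM0)
    rw [h2]
    linarith
  refine le_trans (mul_le_mul_of_nonneg_left ?_ hδ) hlow
  have hinj : Function.Injective (fun (s : ι → Option J) (i : ι) =>
      (s i, if s i = some m then none else s i)) := fun s t h => by
    funext i; exact congrArg Prod.fst (congrFun h i)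
  refine le_trans (le_of_eq ?_) (Finset.sum_le_sum_of_subset_of_nonneg
    (Finset.subset_univ (Finset.univ.map ⟨_, hinj⟩))
    fun σ _ _ => mul_nonneg (hF0 σ) (Finset.prod_nonneg fun i _ => hv0 i _))
  rw [Finset.sum_map]
  refine Finset.sum_congr rfl fun s _ => ?_
  rw [div_eq_mul_one_div, one_div_tupleSize]
  refine congrArg₂ (· * ·) rfl (Finset.prod_congr rfl fun i _ => ?_)
  change _ = pairModel m (P i) (s i) (if s i = some m then none else s i)
  rcases s i with _ | j
  · simp [pairModel]
  · by_cases hj : j = m <;> simp [pairModel, hj]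

theorem setSum_le_one_le (hP : ∀ i, 1 < P i) :
    setSum P (fun n => if n ≤ 1 then 1 else 0) ≤ 1 := by
  rw [setSum, Finset.sum_eq_single ∅]
  · simp [setProd]
  · intro S _ hS
    obtain ⟨i, hi⟩ := Finset.nonempty_iff_ne_empty.2 hS
    have h1 : P i ≤ setProd P S := by
      have := setProd_mono (P := P) (fun i => (hP i).le) (Finset.singleton_subset_iff.2 hi)
      simpa [setProd] using this
    rw [if_neg (by have := hP i; omega), zero_div]
  · simp

/-- The lower bound for the main term: the quadratic form over units, for truncated products. -/
theorem le_unitForm_self (hP : ∀ i, (P i).Prime) (hP3 : ∀ i, 3 ≤ P i)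
    (hc : ∀ i, Function.Injective (c i)) {m : J} (hm : ∀ i, c i m = 0) {g : ℕ → ℝ}
    (hg0 : ∀ n, 0 ≤ g n) (hg : Antitone g) (hg1 : 1 ≤ g 1) {R : ℕ} (hR : 1 < R) {lam lam' : ℝ}
    (hlam0 : 0 ≤ lam)
    (hlam : setSum P (fun n => g n * g n * Real.log n) ≤ lam * setSum P (fun n => g n * g n))
    (hlam' : setSum P (fun n => g n * Real.log n) ≤ lam' * setSum P g)
    (hlamR : (lam' + Fintype.card J * lam) / Real.log R
      + (Fintype.card J : ℝ) ^ 2 * ∑ i, (1 / (P i : ℝ)) ^ 2 ≤ 1 / 2)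
    (hδ : ∏ i, (1 + 2 * ((Fintype.card J : ℝ) + 1) ^ 2 * (1 / (P i : ℝ)) ^ 2) ≤ 3 / 2)
    {y : (ι → Option J) → ℝ}
    (hy : ∀ s, y s = if tupleSize P s ≤ R then ∏ j, g (tupleEntry P s j) else 0) :
    setSum P g ^ 2 * setSum P (fun n => g n * g n) ^ (Fintype.card J - 1) / 24
      ≤ unitForm c y y := by
  classical
  have hP0 : ∀ i, 0 < P i := fun i => (hP i).pos
  set A : ℝ := setSum P (fun n => g n * g n) with hA
  set b : ℝ := setSum P g with hb
  have hgg0 : ∀ n, 0 ≤ g n * g n := fun n => mul_nonneg (hg0 n) (hg0 n)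
  have hgg : Antitone fun n => g n * g n := fun n n' h =>
    mul_le_mul (hg h) (hg h) (hg0 _) (hg0 _)
  have hA0 : 0 < A := lt_of_lt_of_le (by nlinarith) (le_setSum (P := P) hgg0)
  have hb0 : 0 < b := lt_of_lt_of_le (by linarith) (le_setSum (P := P) hg0)
  set Gz : J → ℕ → ℝ := fun j n => if j = m then (if n ≤ 1 then 1 else 0) else g n with hGz
  have hGz0 : ∀ j n, 0 ≤ Gz j n := by
    intro j n; simp only [hGz]; split_ifs <;> first | exact hg0 n | norm_num
  have hGza : ∀ j, Antitone (Gz j) := by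
    intro j n n' h
    simp only [hGz]
    split_ifs with h1 h2 h3
    · exact le_rfl
    · exact absurd (h.trans h2) h3
    · exact zero_le_one
    · exact le_rfl
    · exact hg h
  set z : (ι → Option J) → ℝ := fun s => ∏ j, Gz j (tupleEntry P s j) with hz
  have hz0 : ∀ s, 0 ≤ z s := fun s => Finset.prod_nonneg fun j _ => hGz0 j _
  have hy0 : ∀ s, 0 ≤ y s := fun s => by
    rw [hy]; split_ifs
    · exact Finset.prod_nonneg fun j _ => hg0 _
    · exact le_rfl
  have hyd : IsDecr none y := by
    have h1 : y = fun s => (if tupleSize P s ≤ R then (1 : ℝ) else 0)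
        * ∏ j, g (tupleEntry P s j) := by
      funext s; rw [hy]; split_ifs <;> simp
    rw [h1]
    refine IsDecr.mul (isDecr_size hP0 (g := fun n => if n ≤ R then (1 : ℝ) else 0) ?_)
      (IsDecr.prod _ (fun j _ => isDecr_entry hP0 hg j) fun j _ s => hg0 _)
      (fun s => by split_ifs <;> norm_num) fun s => Finset.prod_nonneg fun j _ => hg0 _
    intro n n' h
    simp only
    split_ifs with h1 h2 h3
    · exact le_rfl
    · exact absurd (h.trans h1) h2
    · exact zero_le_one
    · exact le_rfl
  have hzd : IsDecr none z :=
    IsDecr.prod _ (fun j _ => isDecr_entry hP0 (hGza j) j) fun j _ s => hGz0 j _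
  have hcardA : ∀ r : ℝ, ∏ _j ∈ Finset.univ.erase m, r = r ^ (Fintype.card J - 1) := by
    intro r
    rw [Finset.prod_const, Finset.card_erase_of_mem (Finset.mem_univ m), Finset.card_univ]
  -- the upper bound for the test form
  have hzz : unitForm c z z ≤ 3 / 2 * A ^ (Fintype.card J - 1) := by
    have h1 := unitForm_le hP hP3 hc hm hGz0 hGza
    have h2 : ∏ j ∈ Finset.univ.erase m, setSum P (fun n => Gz j n * Gz j n)
        = A ^ (Fintype.card J - 1) := by
      rw [← hcardA]
      refine Finset.prod_congr rfl fun j hj => ?_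
      simp only [hGz, (Finset.mem_erase.1 hj).1, if_false, hA]
    have h3 : setSum P (Gz m) ≤ 1 := by
      have : Gz m = fun n => if n ≤ 1 then 1 else 0 := by simp [hGz]
      rw [this]
      exact setSum_le_one_le fun i => (hP i).one_lt
    have h4 : 0 ≤ setSum P (Gz m) := setSum_nonneg (hGz0 m)
    rw [h2] at h1
    refine h1.trans (mul_le_mul hδ ?_ (by positivity) (by norm_num))
    exact mul_le_of_le_one_left (by positivity) (mul_le_one₀ h3 h4 h3)
  -- the lower bound for the mixed form
  have hyz : 1 / 4 * (b * A ^ (Fintype.card J - 1)) ≤ unitForm c y z := by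
    have h1 := le_unitForm hP hP3 hc hm hy0 hz0 hyd hzd (δ := 1 / 2) (by norm_num) (by linarith)
    refine le_trans ?_ h1
    set G : J → ℕ → ℝ := fun j n => if j = m then g n else g n * g n with hG
    have h2 := le_sum_tupleSize_le hP0 (G := G)
      (fun j n => by simp only [hG]; split_ifs; exacts [hg0 n, hgg0 n])
      (fun j n n' h => by simp only [hG]; split_ifs; exacts [hg h, hgg h])
      (lam := fun j => if j = m then lam' else lam) hR (fun j => by
        by_cases hj : j = m
        · simp only [hG, hj, if_true]; exact hlam'
        · simp only [hG, hj, if_false]; exact hlam)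
    have h3 : ∏ j, setSum P (G j) = b * A ^ (Fintype.card J - 1) := by
      rw [← Finset.mul_prod_erase _ _ (Finset.mem_univ m), ← hcardA]
      congr 1
      · simp [hG, hb]
      · refine Finset.prod_congr rfl fun j hj => ?_
        simp only [hG, (Finset.mem_erase.1 hj).1, if_false, hA]
    have h4 : ∑ j : J, (if j = m then lam' else lam) ≤ lam' + Fintype.card J * lam := by
      rw [← Finset.add_sum_erase _ _ (Finset.mem_univ m), if_pos rfl]
      gcongr
      rw [Finset.sum_congr rfl fun j hj => if_neg (Finset.mem_erase.1 hj).1, Finset.sum_const,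
        nsmul_eq_mul]
      exact mul_le_mul_of_nonneg_right (by exact_mod_cast Finset.card_le_univ _) hlam0
    have h5 : 0 < Real.log R := Real.log_pos (by exact_mod_cast hR)
    have h6 := div_le_div_of_nonneg_right h4 h5.le
    rw [h3] at h2
    have h7 : 1 / 2 * (b * A ^ (Fintype.card J - 1)) ≤ ∑ s : ι → Option J,
        (if tupleSize P s ≤ R then ∏ j, G j (tupleEntry P s j) else 0) / tupleSize P s :=
      le_trans (mul_le_mul_of_nonneg_right (by linarith) (by positivity)) h2
    have h8 : ∀ s : ι → Option J,
        (if tupleSize P s ≤ R then ∏ j, G j (tupleEntry P s j) else 0) / (tupleSize P s : ℝ)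
        = y s * z (fun i => if s i = some m then none else s i) / tupleSize P s := by
      intro s
      congr 1
      rw [hy, ite_mul, zero_mul]
      split_ifs
      · rw [hz, ← Finset.prod_mul_distrib]
        refine Finset.prod_congr rfl fun j _ => ?_
        by_cases hj : j = m
        · subst hj
          have : entrySet (fun i => if s i = some j then none else s i) j = ∅ := by
            ext i
            simp only [entrySet, Finset.mem_filter, Finset.mem_univ, true_and,
              Finset.notMem_empty, iff_false]
            split_ifs with h <;> simp [h]
          simp [hG, hGz, tupleEntry, this, setProd]
        · have : entrySet (fun i => if s i = some m then none else s i) j = entrySet s j := by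
            ext i
            simp only [entrySet, Finset.mem_filter, Finset.mem_univ, true_and]
            split_ifs with h
            · simp [h, Ne.symm hj]
            · rfl
          simp only [hG, hGz, hj, if_false, tupleEntry, this]
      · rfl
    rw [Finset.sum_congr rfl fun s _ => h8 s] at h7
    linarith
  have hcs := unitForm_sq_le (c := c) y z
  have hE := unitForm_self_nonneg (c := c) y
  have hAk : 0 < A ^ (Fintype.card J - 1) := by positivity
  have h1 : (1 / 4 * (b * A ^ (Fintype.card J - 1))) ^ 2
      ≤ unitForm c y y * (3 / 2 * A ^ (Fintype.card J - 1)) :=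
    (pow_le_pow_left₀ (by positivity) hyz 2).trans
      (hcs.trans (mul_le_mul_of_nonneg_left hzz hE))
  have h2 : (b ^ 2 * A ^ (Fintype.card J - 1) / 24) * A ^ (Fintype.card J - 1)
      ≤ unitForm c y y * A ^ (Fintype.card J - 1) := by nlinarith
  exact le_of_mul_le_mul_right h2 hAk

end UnitForm

section FormCoeff

variable {ι J : Type*} [Fintype ι] [DecidableEq ι] [Fintype J] [DecidableEq J]
  {a : Option ι → ℕ} [∀ o, NeZero (a o)]

/-- The Fourier coefficients of the square of a sieve weight, restricted to a residue class. -/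
noncomputable def formCoeff (c : ∀ i, J → ZMod (a (some i))) (β : ZMod (a none))
    (y : (ι → Option J) → ℝ) (χ : CharFamily a) : ℂ :=
  unitCoeff (fun x => if x = β then (1 : ℝ) else 0) (χ none) * ∑ s, ∑ t, ((y s * y t : ℝ) : ℂ) *
    ∏ i, unitCoeff (fun x => sieveFactor (c i) (s i) x * sieveFactor (c i) (t i) x) (χ (some i))

variable {c : ∀ i, J → ZMod (a (some i))} {β : ZMod (a none)} {y : (ι → Option J) → ℝ}

theorem sum_formCoeff_mul_charProd {n : ℕ} (hn : ∀ o, n.Coprime (a o)) :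
    ∑ χ, formCoeff c β y χ * charProd χ n
      = (((if (n : ZMod (a none)) = β then (1 : ℝ) else 0)
        * sieveWeight c y (fun _ => n) ^ 2 : ℝ) : ℂ) := by
  classical
  have hu : ∀ o, IsUnit (n : ZMod (a o)) := fun o => (ZMod.isUnit_iff_coprime _ _).2 (hn o)
  have hprod : ∀ f : ∀ o, ZMod (a o) → ℝ,
      ∑ χ : CharFamily a, (∏ o, unitCoeff (f o) (χ o)) * charProd χ n
        = ∏ o, ((f o n : ℝ) : ℂ) := by
    intro f
    simp only [charProd, ← Finset.prod_mul_distrib]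
    rw [← Fintype.piFinset_univ, ← Finset.prod_univ_sum (t := fun _ => Finset.univ)
      (f := fun o χ => unitCoeff (f o) χ * χ (n : ZMod (a o)))]
    exact Finset.prod_congr rfl fun o _ => sum_unitCoeff_mul _ (hu o)
  have hst : ∀ s t : ι → Option J,
      ∑ χ : CharFamily a, (unitCoeff (fun x => if x = β then (1 : ℝ) else 0) (χ none)
        * (((y s * y t : ℝ) : ℂ) * ∏ i, unitCoeff (fun x => sieveFactor (c i) (s i) x
          * sieveFactor (c i) (t i) x) (χ (some i)))) * charProd χ n
      = (((if (n : ZMod (a none)) = β then (1 : ℝ) else 0) * ((y s * y t)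
        * ∏ i, (sieveFactor (c i) (s i) (n : ZMod (a (some i)))
          * sieveFactor (c i) (t i) (n : ZMod (a (some i))))) : ℝ) : ℂ) := by
    intro s t
    have := hprod fun o => match o with
      | none => fun x => if x = β then (1 : ℝ) else 0
      | some i => fun x => sieveFactor (c i) (s i) x * sieveFactor (c i) (t i) x
    simp only [Fintype.prod_option] at this
    have h2 := congrArg (fun w => ((y s * y t : ℝ) : ℂ) * w) this
    simp only [Finset.mul_sum] at h2
    refine Eq.trans (Finset.sum_congr rfl fun χ _ => ?_) (h2.trans ?_)
    · ring
    · push_cast; ring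
  simp only [formCoeff, Finset.mul_sum, Finset.sum_mul]
  rw [Finset.sum_comm]
  have hs : ∀ s : ι → Option J, ∑ χ : CharFamily a, ∑ t : ι → Option J,
      unitCoeff (fun x => if x = β then (1 : ℝ) else 0) (χ none)
        * (((y s * y t : ℝ) : ℂ) * ∏ i, unitCoeff (fun x => sieveFactor (c i) (s i) x
          * sieveFactor (c i) (t i) x) (χ (some i))) * charProd χ n
      = ∑ t : ι → Option J, (((if (n : ZMod (a none)) = β then (1 : ℝ) else 0) * ((y s * y t)
        * ∏ i, (sieveFactor (c i) (s i) (n : ZMod (a (some i)))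
          * sieveFactor (c i) (t i) (n : ZMod (a (some i))))) : ℝ) : ℂ) := by
    intro s
    rw [Finset.sum_comm]
    exact Finset.sum_congr rfl fun t _ => hst s t
  rw [Finset.sum_congr rfl fun s _ => hs s, sieveWeight, sq, Finset.sum_mul_sum]
  rw [Finset.mul_sum]
  push_cast
  refine Finset.sum_congr rfl fun s _ => ?_
  rw [Finset.mul_sum]
  refine Finset.sum_congr rfl fun t _ => ?_
  rw [Finset.prod_mul_distrib]
  ring

theorem formCoeff_one (hβ : IsUnit β) :
    formCoeff c β y 1 = ((unitForm c y y / (a none).totient : ℝ) : ℂ) := by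
  simp only [formCoeff, Pi.one_apply, unitCoeff_one, unitMean_ite_eq hβ, unitForm]
  push_cast
  ring

theorem norm_formCoeff_le (hP : ∀ i, (a (some i)).Prime) (hP3 : ∀ i, 3 ≤ a (some i))
    (hc : ∀ i, Function.Injective (c i)) {m : J} (hm : ∀ i, c i m = 0) (hβ : IsUnit β)
    {g : ℕ → ℝ} (hg0 : ∀ n, 0 ≤ g n) (hg : Antitone g) (hy0 : ∀ s, 0 ≤ y s)
    (hy : ∀ s, y s ≤ ∏ j, g (tupleEntry (fun i => a (some i)) s j)) (χ : CharFamily a) :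
    ‖formCoeff c β y χ‖ ≤ 1 / (a none).totient *
      ((∏ i, if i ∈ charSupport χ then 4 * ((Fintype.card J : ℝ) + 1) ^ 2 * (1 / (a (some i) : ℝ))
          else 1 + 2 * ((Fintype.card J : ℝ) + 1) ^ 2 * (1 / (a (some i) : ℝ)) ^ 2)
        * (setSum (fun i => a (some i)) g ^ 2
          * setSum (fun i => a (some i)) (fun n => g n * g n) ^ (Fintype.card J - 1))) := by
  classical
  rw [formCoeff, norm_mul]
  have h1 : ‖unitCoeff (fun x => if x = β then (1 : ℝ) else 0) (χ none)‖
      ≤ 1 / (a none).totient := by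
    refine (norm_unitCoeff_le _ _).trans (le_of_eq ?_)
    rw [← unitMean_ite_eq hβ]
    exact unitMean_congr fun u => by split_ifs <;> simp
  refine mul_le_mul h1 ?_ (norm_nonneg _) (by positivity)
  set u : ι → Option J × Option J → ℝ := fun i o =>
    ‖unitCoeff (fun x => sieveFactor (c i) o.1 x * sieveFactor (c i) o.2 x) (χ (some i))‖ with hu
  have hsupp : ∀ i, i ∉ charSupport χ → χ (some i) = 1 := by
    intro i hi
    simpa [charSupport] using hi
  have hcoef : ∀ i, i ∉ charSupport χ → ∀ o,
      u i o = |unitMean fun x => sieveFactor (c i) o.1 x * sieveFactor (c i) o.2 x| := by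
    intro i hi o
    simp only [hu]
    rw [hsupp i hi, unitCoeff_one, Complex.norm_real, Real.norm_eq_abs]
  have hup := sum_prod_mul_prod_mul_le (P := fun i => a (some i)) (fun i => (hP i).pos) m
    (G := fun _ => g) (G' := fun _ => g) (fun _ => hg0) (fun _ => hg0) (fun _ => hg) (fun _ => hg)
    (charSupport χ) (u := u) (fun _ _ => norm_nonneg _) (fun i hi => by
      have := abs_unitMean_sieveFactor_sub_le (hP i) (hP3 i) (hc i) (hm i) none none
      simp only [and_self, if_true, pairModel] at this
      rw [hcoef i hi, sub_eq_zero.1 (abs_nonpos_iff.1 this), abs_one]) (fun i hi o ho => by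
      have := abs_unitMean_sieveFactor_sub_le (hP i) (hP3 i) (hc i) (hm i) o.1 o.2
      rw [if_neg (fun h => ho (Prod.ext h.1 h.2))] at this
      have h1 := abs_sub_abs_le_abs_sub (unitMean fun x => sieveFactor (c i) o.1 x
        * sieveFactor (c i) o.2 x) (pairModel m (a (some i)) o.1 o.2)
      rw [abs_of_nonneg (pairModel_nonneg m (a (some i)) o.1 o.2)] at h1
      rw [hcoef i hi]
      linarith) (fun i hi => by
      have hχ : χ (some i) ≠ 1 := by simpa [charSupport] using hi
      simp only [hu]
      rw [unitCoeff_const 1 hχ (fun u => by simp [sieveFactor]), norm_zero]) (fun i _ o ho => by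
      refine (norm_unitCoeff_le _ _).trans (unitMean_abs_sieveFactor_mul_le (hP i) (c i) ?_)
      by_contra! h
      exact ho (Prod.ext h.1 h.2))
  have hcard : ∀ r : ℝ, ∏ _j ∈ Finset.univ.erase m, r = r ^ (Fintype.card J - 1) := by
    intro r
    rw [Finset.prod_const, Finset.card_erase_of_mem (Finset.mem_univ m), Finset.card_univ]
  rw [hcard, ← sq] at hup
  refine le_trans ?_ hup
  rw [← sum_mul_sum_eq_sum_pair fun s t : ι → Option J =>
    ((∏ j, g (tupleEntry (fun i => a (some i)) s j))
      * ∏ j, g (tupleEntry (fun i => a (some i)) t j)) * ∏ i, u i (s i, t i)]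
  refine (norm_sum_le _ _).trans (Finset.sum_le_sum fun s _ => ?_)
  refine (norm_sum_le _ _).trans (Finset.sum_le_sum fun t _ => ?_)
  rw [norm_mul, norm_prod, Complex.norm_real, Real.norm_of_nonneg (mul_nonneg (hy0 s) (hy0 t))]
  refine mul_le_mul_of_nonneg_right ?_ (Finset.prod_nonneg fun i _ => norm_nonneg _)
  exact mul_le_mul (hy s) (hy t) (hy0 t) ((hy0 s).trans (hy s))

theorem formCoeff_eq_zero (hP : ∀ i, (a (some i)).Prime) {R : ℕ}
    (hy : ∀ s, R < tupleSize (fun i => a (some i)) s → y s = 0) {χ : CharFamily a}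
    (hχ : R ^ 2 < charCond χ) : formCoeff c β y χ = 0 := by
  classical
  rw [formCoeff]
  refine mul_eq_zero_of_right _ (Finset.sum_eq_zero fun s _ => Finset.sum_eq_zero fun t _ => ?_)
  by_cases hs : R < tupleSize (fun i => a (some i)) s
  · rw [hy s hs]; simp
  by_cases ht : R < tupleSize (fun i => a (some i)) t
  · rw [hy t ht]; simp
  push Not at hs ht
  have hne : ¬ charSupport χ ⊆ (Finset.univ.filter fun i => s i ≠ none)
      ∪ (Finset.univ.filter fun i => t i ≠ none) := by
    intro hsub
    have h1 : charCond χ ≤ tupleSize (fun i => a (some i)) s * tupleSize (fun i => a (some i)) t := by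
      refine (setProd_mono (fun i => (hP i).pos) hsub).trans ?_
      rw [tupleSize, tupleSize, setProd, setProd, setProd, ← Finset.prod_union_inter]
      exact Nat.le_mul_of_pos_right _ (Finset.prod_pos fun i _ => (hP i).pos)
    have h2 := Nat.mul_le_mul hs ht
    rw [← sq] at h2
    omega
  obtain ⟨i, hi, hi'⟩ := Finset.not_subset.1 hne
  simp only [Finset.mem_union, Finset.mem_filter, Finset.mem_univ, true_and, not_or,
    not_not] at hi'
  have hχi : χ (some i) ≠ 1 := by simpa [charSupport] using hi
  refine mul_eq_zero_of_right _ (Finset.prod_eq_zero (Finset.mem_univ i) ?_)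
  exact unitCoeff_const 1 hχi fun u => by simp [sieveFactor, hi'.1, hi'.2]

end FormCoeff

section Harmonic

theorem log_le_sum_Ioc_one_div {x : ℕ} (hx : 0 < x) :
    Real.log x ≤ ∑ n ∈ Finset.Ioc 0 x, 1 / (n : ℝ) := by
  have h := log_add_one_le_harmonic x
  rw [harmonic_eq_sum_Icc] at h
  push_cast at h
  have e : Finset.Ioc 0 x = Finset.Icc 1 x := by ext; simp [Nat.lt_iff_add_one_le]
  have h2 : Real.log x ≤ Real.log (x + 1) :=
    Real.log_le_log (by exact_mod_cast hx) (by linarith)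
  simp only [e, one_div]
  linarith

theorem sum_Ioc_one_div_le (x : ℕ) : ∑ n ∈ Finset.Ioc 0 x, 1 / (n : ℝ) ≤ 1 + Real.log x := by
  have h := harmonic_le_one_add_log x
  rw [harmonic_eq_sum_Icc] at h
  push_cast at h
  have e : Finset.Ioc 0 x = Finset.Icc 1 x := by ext; simp [Nat.lt_iff_add_one_le]
  simpa only [e, one_div] using h

theorem sum_Ioc_one_div_sq_le {D : ℕ} (hD : 0 < D) (T : ℕ) :
    ∑ n ∈ Finset.Ioc D T, (1 / (n : ℝ)) ^ 2 ≤ (1 : ℝ) / D := by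
  rcases le_total T D with h | h
  · rw [Finset.Ioc_eq_empty_of_le h]
    simp
  · have := sum_Ioc_inv_sq_le_sub (α := ℝ) hD.ne' h
    simp only [one_div, inv_pow]
    have h2 : (0 : ℝ) ≤ (T : ℝ)⁻¹ := by positivity
    linarith

theorem exists_abs_sum_coprime_one_div_sub_le {W : ℕ} (hW : 0 < W) :
    ∃ C : ℝ, ∀ x : ℕ, 0 < x →
      |∑ n ∈ (Finset.Ioc 0 x).filter (fun n => n.Coprime W), 1 / (n : ℝ)
        - (W.totient / W : ℝ) * Real.log x| ≤ C := by
  classical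
  have : NeZero W := ⟨hW.ne'⟩
  refine ⟨4 * W + 1, fun x hx => ?_⟩
  have h := norm_sum_inv_mul_prod_sub_le (𝕜 := ℝ) (Finset.univ : Finset Unit) (fun _ => W)
    (fun _ _ _ _ h => absurd rfl h) (fun _ (x : ZMod W) => if IsUnit x then (1 : ℝ) else 0)
    (fun _ x => by split_ifs <;> simp) 0 x
  simp only [Finset.univ_unique, Finset.prod_singleton, zmodMean_isUnit, smul_eq_mul,
    ZMod.isUnit_iff_coprime, mul_ite, mul_one, mul_zero, ← Finset.sum_filter] at h
  rw [Real.norm_eq_abs] at h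
  have h1 := log_le_sum_Ioc_one_div hx
  have h2 := sum_Ioc_one_div_le x
  have hκ0 : (0 : ℝ) ≤ W.totient / W := by positivity
  have hκ1 : (W.totient / W : ℝ) ≤ 1 := by
    rw [div_le_one (by exact_mod_cast hW)]
    exact_mod_cast W.totient_le
  have h3 : |(∑ n ∈ Finset.Ioc 0 x, 1 / (n : ℝ)) * (W.totient / W : ℝ)
      - (W.totient / W : ℝ) * Real.log x| ≤ 1 := by
    rw [abs_le]
    constructor <;> nlinarith
  have h4 := (abs_sub_le _ _ _).trans (add_le_add h h3)
  refine h4.trans (le_of_eq ?_)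
  push_cast
  ring

end Harmonic

section PrimeSums

/-- The primes in `(A, B]`. -/
abbrev primesIoc (A B : ℕ) : Finset ℕ := (Finset.Ioc A B).filter Nat.Prime

theorem exists_abs_sum_primesIoc_log_div_sub_le :
    ∃ C : ℝ, 0 < C ∧ ∀ A B : ℕ, 0 < A → A ≤ B →
      |∑ p ∈ primesIoc A B, Real.log p / p - (Real.log B - Real.log A)| ≤ C := by
  obtain ⟨C, hC⟩ := exists_abs_sum_prime_log_div_sub_log_le
  refine ⟨2 * C + 1, ?_, fun A B hA hAB => ?_⟩
  · have := (abs_nonneg _).trans (hC 1 one_pos)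
    linarith
  have h1 := hC A hA
  have h2 := hC B (hA.trans_le hAB)
  have e : (Finset.Ioc 0 B).filter Nat.Prime
      = (Finset.Ioc 0 A).filter Nat.Prime ∪ primesIoc A B := by
    rw [← Finset.filter_union, Finset.Ioc_union_Ioc_eq_Ioc (Nat.zero_le _) hAB]
  have hd : Disjoint ((Finset.Ioc 0 A).filter Nat.Prime) (primesIoc A B) :=
    Finset.disjoint_filter_filter (Finset.Ioc_disjoint_Ioc_of_le le_rfl)
  rw [e, Finset.sum_union hd] at h2
  rw [abs_le] at *
  constructor <;> linarith

theorem exists_sum_primesIoc_one_div_le :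
    ∃ C : ℝ, 0 < C ∧ ∀ A B : ℕ, 1 < A → A ≤ B →
      ∑ p ∈ primesIoc A B, 1 / (p : ℝ) ≤ (Real.log B - Real.log A + C) / Real.log A ∧
      (Real.log B - Real.log A - C) / Real.log B ≤ ∑ p ∈ primesIoc A B, 1 / (p : ℝ) := by
  obtain ⟨C, hC0, hC⟩ := exists_abs_sum_primesIoc_log_div_sub_le
  refine ⟨C, hC0, fun A B hA hAB => ?_⟩
  have h := abs_le.1 (hC A B (by lia) hAB)
  have hA1 : (1 : ℝ) < A := by exact_mod_cast hA
  have hB1 : (1 : ℝ) < B := by exact_mod_cast hA.trans_le hAB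
  have hlA := Real.log_pos hA1
  have hlB := Real.log_pos hB1
  have hmem : ∀ p ∈ primesIoc A B, (A : ℝ) < p ∧ (p : ℝ) ≤ B := by
    intro p hp
    obtain ⟨h1, h2⟩ := Finset.mem_Ioc.1 (Finset.mem_filter.1 hp).1
    exact ⟨by exact_mod_cast h1, by exact_mod_cast h2⟩
  constructor
  · rw [le_div_iff₀ hlA]
    refine le_trans ?_ (show ∑ p ∈ primesIoc A B, Real.log p / p ≤ _ by linarith)
    rw [Finset.sum_mul]
    refine Finset.sum_le_sum fun p hp => ?_
    have := (hmem p hp).1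
    rw [one_div, inv_mul_eq_div]
    gcongr
  · rw [div_le_iff₀ hlB]
    refine (show _ ≤ ∑ p ∈ primesIoc A B, Real.log p / p by linarith).trans ?_
    rw [Finset.sum_mul]
    refine Finset.sum_le_sum fun p hp => ?_
    obtain ⟨h1, h2⟩ := hmem p hp
    rw [one_div, inv_mul_eq_div]
    have : (0 : ℝ) < p := by linarith
    gcongr

end PrimeSums

section Setup

/-- The moduli of the sieve: the primorial of `D`, and the primes in `(D, T]`. -/
def sieveModulus (D T : ℕ) : Option (primesIoc D T) → ℕ
  | none => primorial D
  | some p => p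

variable {D T : ℕ}

theorem sieveModulus_prime (i : primesIoc D T) : (sieveModulus D T (some i)).Prime :=
  (Finset.mem_filter.1 i.2).2

theorem lt_sieveModulus (i : primesIoc D T) : D < sieveModulus D T (some i) :=
  (Finset.mem_Ioc.1 (Finset.mem_filter.1 i.2).1).1

theorem sieveModulus_le (i : primesIoc D T) : sieveModulus D T (some i) ≤ T :=
  (Finset.mem_Ioc.1 (Finset.mem_filter.1 i.2).1).2

theorem sieveModulus_injective :
    Function.Injective fun i : primesIoc D T => sieveModulus D T (some i) :=
  Subtype.val_injective

instance (o : Option (primesIoc D T)) : NeZero (sieveModulus D T o) := by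
  rcases o with _ | i
  · exact ⟨(primorial_pos D).ne'⟩
  · exact ⟨(sieveModulus_prime i).ne_zero⟩

theorem coprime_primorial_iff {n : ℕ} :
    n.Coprime (primorial D) ↔ ∀ p, p.Prime → p ≤ D → ¬ p ∣ n := by
  rw [primorial, Nat.coprime_prod_right_iff]
  constructor
  · intro h p hp hpD hpn
    have := h p (Finset.mem_filter.2 ⟨Finset.mem_range.2 (by lia), hp⟩)
    exact ((Nat.Prime.coprime_iff_not_dvd hp).1 this.symm) hpn
  · intro h p hp
    obtain ⟨h1, h2⟩ := Finset.mem_filter.1 hp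
    exact ((Nat.Prime.coprime_iff_not_dvd h2).2 (h p h2 (by
      have := Finset.mem_range.1 h1
      lia))).symm

theorem pairwise_coprime_sieveModulus :
    Pairwise (Function.onFun Nat.Coprime (sieveModulus D T)) := by
  have key : ∀ i : primesIoc D T,
      (sieveModulus D T (some i)).Coprime (sieveModulus D T none) := fun i => by
    refine coprime_primorial_iff.2 fun p hp hpD hdvd => ?_
    have := (Nat.prime_dvd_prime_iff_eq hp (sieveModulus_prime i)).1 hdvd
    have := lt_sieveModulus i
    lia
  intro o o' h
  rcases o with _ | i <;> rcases o' with _ | i'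
  · exact absurd rfl h
  · exact (key i').symm
  · exact key i
  · exact (Nat.coprime_primes (sieveModulus_prime i) (sieveModulus_prime i')).2 fun e =>
      h (by rw [sieveModulus_injective e])

/-- An integer all of whose prime factors exceed `T` is coprime to all moduli. -/
theorem coprime_sieveModulus {n : ℕ} (hDT : D ≤ T) (hn : ∀ p, p.Prime → p ∣ n → T < p)
    (o : Option (primesIoc D T)) : n.Coprime (sieveModulus D T o) := by
  rcases o with _ | i
  · exact coprime_primorial_iff.2 fun p hp hpD hdvd => by
      have := hn p hp hdvd
      lia
  · refine ((Nat.Prime.coprime_iff_not_dvd (sieveModulus_prime i)).2 fun h => ?_).symm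
    have := hn _ (sieveModulus_prime i) h
    have := sieveModulus_le i
    lia

theorem sum_sieveModulus {M : Type*} [AddCommMonoid M] (f : ℕ → M) :
    ∑ i : primesIoc D T, f (sieveModulus D T (some i)) = ∑ p ∈ primesIoc D T, f p :=
  Finset.sum_coe_sort (primesIoc D T) f

theorem sum_one_div_sieveModulus_sq_le (hD : 0 < D) :
    ∑ i : primesIoc D T, (1 / (sieveModulus D T (some i) : ℝ)) ^ 2 ≤ (1 : ℝ) / D := by
  rw [sum_sieveModulus fun p => (1 / (p : ℝ)) ^ 2]
  exact (Finset.sum_le_sum_of_subset_of_nonneg (Finset.filter_subset _ _)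
    fun _ _ _ => by positivity).trans (sum_Ioc_one_div_sq_le hD T)

theorem prod_one_add_sieveModulus_sq_le (hD : 0 < D) {c : ℝ} (hc : 0 ≤ c) :
    ∏ i : primesIoc D T, (1 + c * (1 / (sieveModulus D T (some i) : ℝ)) ^ 2)
      ≤ Real.exp (c / D) := by
  calc _ ≤ ∏ i : primesIoc D T, Real.exp (c * (1 / (sieveModulus D T (some i) : ℝ)) ^ 2) := by
        refine Finset.prod_le_prod (fun i _ => by positivity) fun i _ => ?_
        rw [add_comm]
        exact Real.add_one_le_exp _
    _ ≤ _ := by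
        rw [← Real.exp_sum, ← Finset.mul_sum]
        refine Real.exp_le_exp.2 ?_
        rw [div_eq_mul_one_div]
        exact mul_le_mul_of_nonneg_left (sum_one_div_sieveModulus_sq_le hD) hc

theorem setProd_injective {ι : Type*} [Fintype ι] [DecidableEq ι] {P : ι → ℕ}
    (hP : ∀ i, (P i).Prime) (hinj : Function.Injective P) : Function.Injective (setProd P) := by
  have hmem : ∀ S i, P i ∣ setProd P S ↔ i ∈ S := by
    intro S i
    constructor
    · intro h
      obtain ⟨j, hj, hd⟩ := (Prime.dvd_finsetProd_iff (hP i).prime _).1 h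
      rwa [hinj ((Nat.prime_dvd_prime_iff_eq (hP i) (hP j)).1 hd)]
    · exact fun h => Finset.dvd_prod_of_mem _ h
  intro S S' h
  ext i
  rw [← hmem, ← hmem, h]

/-- The sum of `1 / r` over products `r ≤ z` of distinct primes in `(D, T]`. -/
noncomputable def smoothSum (D T z : ℕ) : ℝ :=
  setSum (fun i : primesIoc D T => sieveModulus D T (some i)) fun n => if n ≤ z then 1 else 0

theorem smoothSum_eq (z : ℕ) :
    smoothSum D T z = ∑ S ∈ Finset.univ.filter (fun S : Finset (primesIoc D T) =>
      setProd (fun i => sieveModulus D T (some i)) S ≤ z),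
        1 / (setProd (fun i => sieveModulus D T (some i)) S : ℝ) := by
  rw [smoothSum, setSum, Finset.sum_filter]
  refine Finset.sum_congr rfl fun S _ => ?_
  split_ifs <;> simp

theorem smoothSum_le (D T z : ℕ) :
    smoothSum D T z
      ≤ ∑ n ∈ (Finset.Ioc 0 z).filter (fun n => n.Coprime (primorial D)), 1 / (n : ℝ) := by
  rw [smoothSum_eq, ← Finset.sum_image (f := fun n : ℕ => 1 / (n : ℝ))
    (setProd_injective sieveModulus_prime sieveModulus_injective).injOn]
  refine Finset.sum_le_sum_of_subset_of_nonneg (fun n hn => ?_) fun _ _ _ => by positivity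
  obtain ⟨S, hS, rfl⟩ := Finset.mem_image.1 hn
  refine Finset.mem_filter.2 ⟨Finset.mem_Ioc.2 ⟨setProd_pos
    (fun i => (sieveModulus_prime i).pos) S, (Finset.mem_filter.1 hS).2⟩, ?_⟩
  exact Nat.Coprime.prod_left fun i _ =>
    pairwise_coprime_sieveModulus (i := some i) (j := none) (by simp)

theorem le_two_mul_smoothSum {z : ℕ} (hz : z ≤ T) :
    ∑ n ∈ (Finset.Ioc 0 z).filter (fun n => n.Coprime (primorial D)), 1 / (n : ℝ)
      ≤ 2 * smoothSum D T z := by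
  set 𝒮 := Finset.univ.filter (fun S : Finset (primesIoc D T) =>
      setProd (fun i => sieveModulus D T (some i)) S ≤ z) with h𝒮
  set f : Finset (primesIoc D T) × ℕ → ℕ := fun x =>
    setProd (fun i => sieveModulus D T (some i)) x.1 * x.2 ^ 2 with hf
  have hsub : (Finset.Ioc 0 z).filter (fun n => n.Coprime (primorial D))
      ⊆ (𝒮 ×ˢ Finset.Ioc 0 z).image f := by
    intro n hn
    obtain ⟨hn1, hn2⟩ := Finset.mem_filter.1 hn
    obtain ⟨hn0, hnz⟩ := Finset.mem_Ioc.1 hn1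
    obtain ⟨r, b, hrb, hr⟩ := Nat.sq_mul_squarefree n
    have hr0 : r ≠ 0 := hr.ne_zero
    have hb0 : b ≠ 0 := by
      rintro rfl
      simp at hrb
      lia
    have hrn : r ∣ n := Dvd.intro_left _ hrb
    have hrz : r ≤ z := (Nat.le_of_dvd hn0 hrn).trans hnz
    have hbz : b ≤ z := by
      have : b ∣ n := (Dvd.intro_left b (by ring : b * b = b ^ 2)).trans (Dvd.intro _ hrb)
      exact (Nat.le_of_dvd hn0 this).trans hnz
    have hprime : ∀ p ∈ r.primeFactors, p ∈ primesIoc D T := by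
      intro p hp
      have hp1 := Nat.prime_of_mem_primeFactors hp
      have hp2 := Nat.dvd_of_mem_primeFactors hp
      refine Finset.mem_filter.2 ⟨Finset.mem_Ioc.2 ⟨?_, ?_⟩, hp1⟩
      · by_contra h
        exact coprime_primorial_iff.1 hn2 p hp1 (by lia) (hp2.trans hrn)
      · exact (Nat.le_of_dvd (Nat.pos_of_ne_zero hr0) hp2).trans (hrz.trans hz)
    have hS : setProd (fun i : primesIoc D T => sieveModulus D T (some i))
        (Finset.univ.filter fun i : primesIoc D T => (i : ℕ) ∈ r.primeFactors) = r := by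
      rw [setProd, Finset.prod_filter]
      change ∏ i : primesIoc D T, (if (i : ℕ) ∈ r.primeFactors then (i : ℕ) else 1) = r
      rw [Finset.prod_coe_sort (primesIoc D T) (fun p => if p ∈ r.primeFactors then p else 1),
        ← Finset.prod_filter, Finset.filter_mem_eq_inter, Finset.inter_eq_right.2 hprime,
        Nat.prod_primeFactors_of_squarefree hr]
    refine Finset.mem_image.2 ⟨(Finset.univ.filter fun i : primesIoc D T =>
      (i : ℕ) ∈ r.primeFactors, b), Finset.mem_product.2 ⟨?_, ?_⟩, ?_⟩
    · exact Finset.mem_filter.2 ⟨Finset.mem_univ _, by rw [hS]; exact hrz⟩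
    · exact Finset.mem_Ioc.2 ⟨Nat.pos_of_ne_zero hb0, hbz⟩
    · simp only [hf]
      rw [hS, mul_comm, hrb]
  have hsq : ∑ n ∈ Finset.Ioc 0 z, (1 / (n : ℝ)) ^ 2 ≤ 2 := by
    rcases Nat.eq_zero_or_pos z with rfl | hz0
    · simp
    · rw [← Finset.Ioc_union_Ioc_eq_Ioc zero_le_one (by lia : 1 ≤ z),
        Finset.sum_union (Finset.Ioc_disjoint_Ioc_of_le le_rfl)]
      have := sum_Ioc_one_div_sq_le one_pos z
      have e : Finset.Ioc 0 1 = {1} := rfl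
      rw [e, Finset.sum_singleton]
      norm_num at this ⊢
      linarith
  calc _ ≤ ∑ n ∈ (𝒮 ×ˢ Finset.Ioc 0 z).image f, 1 / (n : ℝ) :=
        Finset.sum_le_sum_of_subset_of_nonneg hsub fun _ _ _ => by positivity
    _ ≤ ∑ x ∈ 𝒮 ×ˢ Finset.Ioc 0 z, 1 / (f x : ℝ) :=
        Finset.sum_image_le_of_nonneg (g := f) (f := fun n : ℕ => 1 / (n : ℝ))
          fun _ _ => by positivity
    _ = smoothSum D T z * ∑ n ∈ Finset.Ioc 0 z, (1 / (n : ℝ)) ^ 2 := by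
        rw [smoothSum_eq, Finset.sum_mul_sum, Finset.sum_product]
        refine Finset.sum_congr rfl fun S _ => Finset.sum_congr rfl fun n _ => ?_
        simp only [hf]
        push_cast
        rw [one_div_pow, one_div_mul_one_div]
    _ ≤ _ := by
        rw [mul_comm]
        refine mul_le_mul_of_nonneg_right hsq (setSum_nonneg fun n => ?_)
        split_ifs <;> norm_num

/-- The density of the integers coprime to the primorial of `D`. -/
noncomputable def coprimeDensity (D : ℕ) : ℝ := (primorial D).totient / primorial D

theorem coprimeDensity_pos (D : ℕ) : 0 < coprimeDensity D := by
  have h1 := primorial_pos D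
  have h2 := Nat.totient_pos.2 h1
  unfold coprimeDensity
  positivity

theorem coprimeDensity_le_one (D : ℕ) : coprimeDensity D ≤ 1 := by
  rw [coprimeDensity, div_le_one (by exact_mod_cast primorial_pos D)]
  exact_mod_cast Nat.totient_le _

theorem one_le_smoothSum {z : ℕ} (hz : 1 ≤ z) : 1 ≤ smoothSum D T z := by
  refine le_trans (le_of_eq ?_) (le_setSum (fun n => ?_))
  · rw [if_pos hz]
  · split_ifs <;> norm_num

theorem exists_smoothSum_bounds (D : ℕ) : ∃ z₀ : ℕ, 1 < z₀ ∧ ∀ z T : ℕ, z₀ ≤ z →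
    smoothSum D T z ≤ 2 * (coprimeDensity D * Real.log z) ∧
    (z ≤ T → coprimeDensity D * Real.log z ≤ 4 * smoothSum D T z) := by
  obtain ⟨C, hC⟩ := exists_abs_sum_coprime_one_div_sub_le (primorial_pos D)
  have hlim : Tendsto (fun z : ℕ => coprimeDensity D * Real.log z) atTop atTop :=
    Tendsto.const_mul_atTop (coprimeDensity_pos D)
      (Real.tendsto_log_atTop.comp tendsto_natCast_atTop_atTop)
  obtain ⟨z₀, hz₀⟩ := eventually_atTop.1 (hlim.eventually_ge_atTop (2 * C))
  refine ⟨max z₀ 2, by simp, fun z T hz => ?_⟩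
  have h1 := hz₀ z ((le_max_left _ _).trans hz)
  have h2 := abs_le.1 (hC z (by have := (le_max_right z₀ 2).trans hz; lia))
  change -C ≤ _ - coprimeDensity D * Real.log z ∧ _ - coprimeDensity D * Real.log z ≤ C at h2
  have hC0 : 0 ≤ C := by linarith [h2.1, h2.2]
  constructor
  · linarith [smoothSum_le D T z]
  · intro hzT
    linarith [le_two_mul_smoothSum (D := D) hzT]

end Setup

section TupleSums

variable {J : Type*} [Fintype J] [DecidableEq J] {D T : ℕ}

theorem sum_tupleSize_le (hD : 0 < D) (hJ : Fintype.card J ≤ D) (R : ℕ) :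
    ∑ s : primesIoc D T → Option J,
      (if tupleSize (fun i => sieveModulus D T (some i)) s ≤ R then
        (tupleSize (fun i => sieveModulus D T (some i)) s : ℝ) else 0) ≤ 3 * (R : ℝ) ^ 3 := by
  set P := fun i : primesIoc D T => sieveModulus D T (some i) with hP
  have h1 : ∀ s : primesIoc D T → Option J,
      (if tupleSize P s ≤ R then (tupleSize P s : ℝ) else 0)
        ≤ (R : ℝ) ^ 3 * ∏ i, (if s i = none then (1 : ℝ) else (1 / (P i : ℝ)) ^ 2) := by
    intro s
    have e : ∏ i, (if s i = none then (1 : ℝ) else (1 / (P i : ℝ)) ^ 2)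
        = ((1 : ℝ) / tupleSize P s) ^ 2 := by
      rw [one_div_tupleSize, ← Finset.prod_pow]
      refine Finset.prod_congr rfl fun i _ => ?_
      split_ifs <;> simp
    have hpos : (0 : ℝ) < tupleSize P s := by
      exact_mod_cast tupleSize_pos (fun i => (sieveModulus_prime i).pos) s
    rw [e]
    split_ifs with h
    · have h' : (tupleSize P s : ℝ) ≤ R := by exact_mod_cast h
      rw [one_div, inv_pow, ← div_eq_mul_inv, le_div_iff₀ (by positivity)]
      calc (tupleSize P s : ℝ) * (tupleSize P s) ^ 2 = (tupleSize P s : ℝ) ^ 3 := by ring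
        _ ≤ _ := by gcongr
    · positivity
  refine (Finset.sum_le_sum fun s _ => h1 s).trans ?_
  rw [← Finset.mul_sum, mul_comm (3 : ℝ),
    Fintype.sum_prod_pi fun (i : primesIoc D T) (o : Option J) =>
      if o = none then (1 : ℝ) else (1 / (P i : ℝ)) ^ 2]
  refine mul_le_mul_of_nonneg_left ?_ (by positivity)
  have h2 := prod_one_add_sieveModulus_sq_le (T := T) hD (Nat.cast_nonneg (α := ℝ) (Fintype.card J))
  simp only [Fintype.sum_option, if_true, reduceCtorEq, if_false, Finset.sum_const,
    Finset.card_univ, nsmul_eq_mul]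
  refine h2.trans ?_
  have h3 : (Fintype.card J : ℝ) / D ≤ 1 := by
    rw [div_le_one (by exact_mod_cast hD)]
    exact_mod_cast hJ
  exact (Real.exp_le_exp.2 h3).trans (by linarith [Real.exp_one_lt_d9])

theorem sum_option_unit_div_tupleSize {ι : Type*} [Fintype ι] [DecidableEq ι] (P : ι → ℕ)
    (G : ℕ → ℝ) :
    ∑ s : ι → Option Unit, G (tupleSize P s) / tupleSize P s = setSum P G := by
  classical
  have hs : ∀ s : ι → Option Unit,
      (Finset.univ.filter fun i => s i ≠ none) = entrySet s () := by
    intro s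
    ext i
    rcases h : s i with _ | u
    · simp [entrySet, h]
    · simp [entrySet, h]
  refine Fintype.sum_bijective (fun s : ι → Option Unit => entrySet s ()) ⟨fun s t h => ?_,
    fun S => ?_⟩ _ _ fun s => ?_
  · exact entrySet_injective (funext fun _ => h)
  · obtain ⟨s, hs⟩ := exists_entrySet_eq (S := fun _ : Unit => S) fun j j' h =>
      absurd (Subsingleton.elim j j') h
    exact ⟨s, congrFun hs ()⟩
  · simp only [tupleSize, hs]

end TupleSums

section CharFamilies

variable {D T : ℕ}

theorem sum_prod_charSupport_le {u : primesIoc D T → ℝ} (hu : ∀ i, 0 ≤ u i) :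
    ∑ χ : CharFamily (sieveModulus D T), ∏ i, (if i ∈ charSupport χ then u i else 1)
      ≤ primorial D * ∏ i, (1 + sieveModulus D T (some i) * u i) := by
  classical
  let f : ∀ o, DirichletCharacter ℂ (sieveModulus D T o) → ℝ := fun o => match o with
    | none => fun _ => 1
    | some i => fun χ => if χ ≠ 1 then u i else 1
  have e : ∑ χ : CharFamily (sieveModulus D T), ∏ i, (if i ∈ charSupport χ then u i else 1)
      = ∏ o, ∑ χ, f o χ := by
    rw [Finset.prod_univ_sum (t := fun _ => Finset.univ), Fintype.piFinset_univ]
    refine Finset.sum_congr rfl fun χ _ => ?_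
    rw [Fintype.prod_option]
    simp [f, charSupport]
  have hcard : ∀ o, (Fintype.card (DirichletCharacter ℂ (sieveModulus D T o)) : ℝ)
      ≤ sieveModulus D T o := fun o => by
    rw [← Nat.card_eq_fintype_card, DirichletCharacter.card_eq_totient_of_hasEnoughRootsOfUnity]
    exact_mod_cast Nat.totient_le _
  rw [e, Fintype.prod_option]
  refine mul_le_mul ?_ (Finset.prod_le_prod (fun i _ => ?_) fun i _ => ?_) ?_ (by positivity)
  · refine (le_of_eq ?_).trans (hcard none)
    simp [f]
  · exact Finset.sum_nonneg fun χ _ => by simp only [f]; split_ifs <;> simp [hu]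
  · have : ∑ χ, f (some i) χ ≤ ∑ χ : DirichletCharacter ℂ (sieveModulus D T (some i)),
        ((if χ = 1 then 1 else 0) + u i) := by
      refine Finset.sum_le_sum fun χ _ => ?_
      by_cases h : χ = 1 <;> simp [f, h, hu]
    refine this.trans ?_
    rw [Finset.sum_add_distrib, Finset.sum_ite_eq' Finset.univ, if_pos (Finset.mem_univ _),
      Finset.sum_const, nsmul_eq_mul, Finset.card_univ]
    exact add_le_add le_rfl (mul_le_mul_of_nonneg_right (hcard (some i)) (hu i))
  · exact Finset.prod_nonneg fun i _ => Finset.sum_nonneg fun χ _ => by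
      simp only [f]; split_ifs <;> simp [hu]

theorem one_div_charCond {ι : Type*} [Fintype ι] [DecidableEq ι] {a : Option ι → ℕ}
    (χ : CharFamily a) :
    (1 : ℝ) / charCond χ = ∏ i, if i ∈ charSupport χ then 1 / (a (some i) : ℝ) else 1 := by
  rw [charCond, setProd, Nat.cast_prod, one_div, ← Finset.prod_inv_distrib,
    Finset.prod_ite_mem, Finset.univ_inter]
  simp

theorem charCond_pos (χ : CharFamily (sieveModulus D T)) : 0 < charCond χ :=
  setProd_pos (fun i => (sieveModulus_prime i).pos) _

theorem card_charCond_le (hD : 0 < D) (𝒢 : Finset (CharFamily (sieveModulus D T))) {Q : ℕ}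
    (hQ : ∀ χ ∈ 𝒢, charCond χ ≤ Q) : (𝒢.card : ℝ) ≤ 3 * primorial D * (Q : ℝ) ^ 3 := by
  have h1 : ∀ χ ∈ 𝒢, (1 : ℝ) ≤ (Q : ℝ) ^ 3 * ∏ i : primesIoc D T,
      (if i ∈ charSupport χ then (1 / (sieveModulus D T (some i) : ℝ)) ^ 3 else 1) := by
    intro χ hχ
    have e : ∏ i : primesIoc D T,
        (if i ∈ charSupport χ then (1 / (sieveModulus D T (some i) : ℝ)) ^ 3 else 1)
        = (1 / (charCond χ : ℝ)) ^ 3 := by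
      rw [one_div_charCond, ← Finset.prod_pow]
      refine Finset.prod_congr rfl fun i _ => ?_
      split_ifs <;> simp
    have h2 : (charCond χ : ℝ) ≤ Q := by exact_mod_cast hQ χ hχ
    have h3 : (0 : ℝ) < charCond χ := by exact_mod_cast charCond_pos χ
    rw [e, ← mul_pow, mul_one_div]
    exact one_le_pow₀ ((one_le_div h3).2 h2)
  have h2 : (𝒢.card : ℝ) ≤ ∑ χ ∈ 𝒢, (Q : ℝ) ^ 3 * ∏ i : primesIoc D T,
      (if i ∈ charSupport χ then (1 / (sieveModulus D T (some i) : ℝ)) ^ 3 else 1) := by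
    have := Finset.sum_le_sum h1
    simpa using this
  have hnn : ∀ χ : CharFamily (sieveModulus D T), 0 ≤ ∏ i : primesIoc D T,
      (if i ∈ charSupport χ then (1 / (sieveModulus D T (some i) : ℝ)) ^ 3 else 1) := fun χ =>
    Finset.prod_nonneg fun i _ => by split_ifs <;> positivity
  refine h2.trans ?_
  rw [← Finset.mul_sum]
  refine (mul_le_mul_of_nonneg_left ((Finset.sum_le_univ_sum_of_nonneg hnn).trans
    (sum_prod_charSupport_le fun i => by positivity)) (by positivity)).trans ?_
  have h3 : ∏ i : primesIoc D T, (1 + sieveModulus D T (some i)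
      * (1 / (sieveModulus D T (some i) : ℝ)) ^ 3) ≤ 3 := by
    have := prod_one_add_sieveModulus_sq_le (T := T) hD (zero_le_one (α := ℝ))
    refine le_trans (le_of_eq (Finset.prod_congr rfl fun i _ => ?_)) (this.trans ?_)
    · have : (sieveModulus D T (some i) : ℝ) ≠ 0 := by
        exact_mod_cast (sieveModulus_prime i).ne_zero
      field_simp
    · have h1 : (1 : ℝ) / D ≤ 1 := by
        rw [div_le_one (by exact_mod_cast hD)]
        exact_mod_cast hD
      exact (Real.exp_le_exp.2 h1).trans (by linarith [Real.exp_one_lt_d9])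
  calc _ ≤ (Q : ℝ) ^ 3 * (primorial D * 3) := by gcongr
    _ = _ := by ring

theorem large_sieve_error_le {W Q z S G X : ℝ} (hW : 1 ≤ W) (hQ : 1 ≤ Q) (hS0 : 0 ≤ S)
    (hS : S ≤ 3 * z ^ 3) (hG : G ≤ 3 * W * Q ^ 3) (hX0 : 0 ≤ X)
    (hX : 144 * W ^ 2 * z ^ 6 * Q ^ 5 ≤ X) :
    4 * W * S ^ 2 * (1 + G * Q ^ 2) / (X + 1) ≤ 1 := by
  rw [div_le_one (by positivity)]
  have h1 : 1 + G * Q ^ 2 ≤ 4 * W * Q ^ 5 := by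
    have h2 : 1 ≤ W * Q ^ 5 := by
      have := one_le_pow₀ hQ (n := 5)
      nlinarith
    have h3 : G * Q ^ 2 ≤ 3 * W * Q ^ 3 * Q ^ 2 := mul_le_mul_of_nonneg_right hG (by positivity)
    nlinarith
  calc 4 * W * S ^ 2 * (1 + G * Q ^ 2) ≤ 4 * W * S ^ 2 * (4 * W * Q ^ 5) :=
        mul_le_mul_of_nonneg_left h1 (by positivity)
    _ ≤ 4 * W * (3 * z ^ 3) ^ 2 * (4 * W * Q ^ 5) := by gcongr
    _ = 144 * W ^ 2 * z ^ 6 * Q ^ 5 := by ring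
    _ ≤ _ := by linarith

/-- The large sieve inequality for families of characters. -/
theorem exists_sum_norm_sum_mul_charProd_sq_le (hD : 4 ≤ D) (r : ℕ) :
    ∃ z₀ : ℕ, ∀ z T Q X Y : ℕ, z₀ ≤ z → z ≤ T → 0 < Q → 0 < Y → Y ≤ z ^ r →
      144 * primorial D ^ 2 * z ^ 6 * Q ^ 5 ≤ X →
      ∀ 𝒢 : Finset (CharFamily (sieveModulus D T)), (∀ χ ∈ 𝒢, charCond χ ≤ Q) →
      ∀ α : ℕ → ℂ, (∀ n, α n ≠ 0 → ∀ i : primesIoc D T,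
        n.Coprime (sieveModulus D T (some i))) →
      ∑ χ ∈ 𝒢, ‖∑ n ∈ Finset.Ioc X Y, α n * charProd χ n‖ ^ 2
        ≤ (12 * r + 16) * ∑ n ∈ Finset.Ioc X Y, ‖α n‖ ^ 2 * n := by
  obtain ⟨z₁, hz₁, hb⟩ := exists_smoothSum_bounds D
  have hlim : Tendsto (fun z : ℕ => coprimeDensity D * Real.log z) atTop atTop :=
    Tendsto.const_mul_atTop (coprimeDensity_pos D)
      (Real.tendsto_log_atTop.comp tendsto_natCast_atTop_atTop)
  obtain ⟨z₂, hz₂⟩ := eventually_atTop.1 (hlim.eventually_ge_atTop 1)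
  refine ⟨max z₁ z₂, fun z T Q X Y hz hzT hQ0 hY0 hY hX 𝒢 hQ α hα => ?_⟩
  have hz1 : 1 ≤ z := by have := (le_max_left z₁ z₂).trans hz; lia
  have hM := (hb z T ((le_max_left _ _).trans hz)).2 hzT
  have hL := hz₂ z ((le_max_right _ _).trans hz)
  have hM1 := one_le_smoothSum (D := D) (T := T) hz1
  set M := smoothSum D T z with hMdef
  set P := fun i : primesIoc D T => sieveModulus D T (some i) with hP
  set y : (primesIoc D T → Option Unit) → ℝ := fun s => if tupleSize P s ≤ z then 1 else 0 with hy
  have hanti : Antitone fun n : ℕ => if n ≤ z then (1 : ℝ) else 0 := by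
    intro m n hmn
    dsimp only
    split_ifs with h1 h2 <;> first | lia | norm_num
  have hy0 : ∀ s, 0 ≤ y s := fun s => by simp only [hy]; split_ifs <;> norm_num
  have hyd : IsDecr none y := isDecr_size (fun i => (sieveModulus_prime i).pos) hanti
  have hyM : ∑ s, y s / tupleSize P s = M :=
    sum_option_unit_div_tupleSize P fun n => if n ≤ z then (1 : ℝ) else 0
  have hyM2 : ∑ s, y s ^ 2 / tupleSize P s = M := by
    rw [← hyM]
    refine Finset.sum_congr rfl fun s _ => ?_
    simp only [hy]
    split_ifs <;> simp
  have hyS : ∑ s, y s * tupleSize P s ≤ 3 * (z : ℝ) ^ 3 := by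
    refine le_trans (le_of_eq (Finset.sum_congr rfl fun s _ => ?_))
      (sum_tupleSize_le (J := Unit) (T := T) (by lia : 0 < D) (by simp; lia) z)
    simp only [hy, ite_mul, one_mul, zero_mul, hP]
  have hlogY : Real.log Y ≤ r * Real.log z := by
    rw [← Real.log_pow]
    exact Real.log_le_log (by exact_mod_cast hY0) (by exact_mod_cast hY)
  have hlz : 0 ≤ Real.log z := Real.log_natCast_nonneg z
  have hκ1 := coprimeDensity_le_one D
  have hκ0 := coprimeDensity_pos D
  have hW : (1 : ℝ) ≤ primorial D := by exact_mod_cast primorial_pos D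
  have hsumle : ∑ n ∈ Finset.Ioc X Y, 1 / (n : ℝ) ≤ 1 + r * Real.log z := by
    refine (Finset.sum_le_sum_of_subset_of_nonneg (Finset.Ioc_subset_Ioc_left (Nat.zero_le _))
      fun _ _ _ => by positivity).trans ((sum_Ioc_one_div_le Y).trans ?_)
    linarith
  have hexp : ∏ i, (1 + 4 * (1 / (P i : ℝ)) ^ 2) ≤ 3 := by
    refine (prod_one_add_sieveModulus_sq_le (T := T) (by lia : 0 < D)
      (by norm_num : (0 : ℝ) ≤ 4)).trans ?_
    have h1 : (4 : ℝ) / D ≤ 1 := by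
      rw [div_le_one (by exact_mod_cast (by lia : 0 < D))]
      exact_mod_cast hD
    exact (Real.exp_le_exp.2 h1).trans (by linarith [Real.exp_one_lt_d9])
  have hcard := card_charCond_le (by lia : 0 < D) 𝒢 hQ
  refine sum_norm_sum_mul_charProd_sq_le pairwise_coprime_sieveModulus sieveModulus_prime hy0 hyd
    𝒢 hQ X Y (by positivity) ?_ ?_ α hα
  swap
  · rw [hyM]; linarith
  rw [hyM, hyM2]
  change (∑ n ∈ Finset.Ioc X Y, 1 / (n : ℝ)) * coprimeDensity D * _ + _ ≤ _
  have hQ1 : (1 : ℝ) ≤ Q := by exact_mod_cast hQ0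
  have hX' : 144 * (primorial D : ℝ) ^ 2 * (z : ℝ) ^ 6 * (Q : ℝ) ^ 5 ≤ X := by exact_mod_cast hX
  have hsecond : 4 * (primorial D : ℝ) * (∑ s, y s * tupleSize P s) ^ 2
      * (1 + 𝒢.card * (Q : ℝ) ^ 2) / (X + 1) ≤ 1 := by
    exact large_sieve_error_le hW hQ1 (Finset.sum_nonneg fun s _ =>
      mul_nonneg (hy0 s) (Nat.cast_nonneg _)) hyS hcard (Nat.cast_nonneg _) hX'
  have hM0 : 0 ≤ M := by linarith
  have key : ∀ S E U : ℝ, S ≤ 1 + r * Real.log z → 0 ≤ E → E ≤ 3 → U ≤ 1 →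
      S * coprimeDensity D * (E * M) + U ≤ (12 * r + 16) * M ^ 2 := by
    intro S E U hS hE0 hE hU
    calc S * coprimeDensity D * (E * M) + U
        ≤ (1 + r * Real.log z) * coprimeDensity D * (3 * M) + 1 := by
          refine add_le_add (mul_le_mul (mul_le_mul_of_nonneg_right hS hκ0.le)
            (mul_le_mul_of_nonneg_right hE hM0) (by positivity) (by positivity)) hU
      _ ≤ ((3 * r + 4) * (coprimeDensity D * Real.log z)) * M := by
          have h1 : coprimeDensity D * M ≤ M := mul_le_of_le_one_left hM0 hκ1
          have h2 : M ≤ (coprimeDensity D * Real.log z) * M := le_mul_of_one_le_left hM0 hL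
          nlinarith
      _ ≤ ((3 * r + 4) * (4 * M)) * M :=
          mul_le_mul_of_nonneg_right (mul_le_mul_of_nonneg_left hM (by positivity)) hM0
      _ = _ := by ring
  exact key _ _ _ hsumle (Finset.prod_nonneg fun i _ => by positivity) hexp hsecond

end CharFamilies

section PrimePowers

/-- The number of ways of writing `n` as an ordered product of `j` primes from `(A, B]`. -/
def primeTuples (A B j n : ℕ) : Finset (Fin j → ℕ) :=
  (Fintype.piFinset fun _ => primesIoc A B).filter fun t => ∏ l, t l = n

theorem card_primeTuples_le (A B j n : ℕ) : (primeTuples A B j n).card ≤ j ^ j := by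
  rcases (primeTuples A B j n).eq_empty_or_nonempty with h | ⟨t₀, h₀⟩
  · simp [h]
  · have hsub : primeTuples A B j n ⊆ Fintype.piFinset fun _ => Finset.univ.image t₀ := by
      intro t ht
      obtain ⟨h1, h2⟩ := Finset.mem_filter.1 ht
      obtain ⟨h3, h4⟩ := Finset.mem_filter.1 h₀
      refine Fintype.mem_piFinset.2 fun l => ?_
      have hp := (Finset.mem_filter.1 (Fintype.mem_piFinset.1 h1 l)).2
      have hd : t l ∣ ∏ l, t₀ l := by
        rw [h4, ← h2]
        exact Finset.dvd_prod_of_mem _ (Finset.mem_univ l)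
      obtain ⟨m, -, hm⟩ := (Prime.dvd_finsetProd_iff hp.prime _).1 hd
      have hq := (Finset.mem_filter.1 (Fintype.mem_piFinset.1 h3 m)).2
      exact Finset.mem_image.2 ⟨m, Finset.mem_univ _, ((Nat.prime_dvd_prime_iff_eq hp hq).1 hm).symm⟩
    refine (Finset.card_le_card hsub).trans ?_
    rw [Fintype.card_piFinset, Finset.prod_const, Finset.card_univ, Fintype.card_fin]
    refine Nat.pow_le_pow_left (Finset.card_image_le.trans ?_) _
    simp

theorem sum_primesIoc_one_div_mul_pow {𝕜 : Type*} [RCLike 𝕜] (F : ℕ →* 𝕜) (A B : ℕ) {j : ℕ}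
    (hj : 0 < j) :
    (∑ p ∈ primesIoc A B, (1 / (p : 𝕜)) * F p) ^ j
      = ∑ n ∈ Finset.Ioc (A ^ j) (B ^ j), ((primeTuples A B j n).card / (n : 𝕜)) * F n := by
  have h1 : (∑ p ∈ primesIoc A B, (1 / (p : 𝕜)) * F p) ^ j
      = ∑ t ∈ Fintype.piFinset fun _ : Fin j => primesIoc A B,
        (1 / ((∏ l, t l : ℕ) : 𝕜)) * F (∏ l, t l) := by
    have := Finset.prod_univ_sum (fun _ : Fin j => primesIoc A B)
      fun _ p => (1 / (p : 𝕜)) * F p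
    rw [Finset.prod_const, Finset.card_univ, Fintype.card_fin] at this
    rw [this]
    refine Finset.sum_congr rfl fun t _ => ?_
    rw [Finset.prod_mul_distrib, map_prod, Nat.cast_prod, one_div, ← Finset.prod_inv_distrib]
    simp only [one_div]
  have hmaps : ∀ t ∈ Fintype.piFinset fun _ : Fin j => primesIoc A B,
      ∏ l, t l ∈ Finset.Ioc (A ^ j) (B ^ j) := by
    intro t ht
    have h := fun l => Finset.mem_Ioc.1 (Finset.mem_filter.1 (Fintype.mem_piFinset.1 ht l)).1
    have hne : (Finset.univ : Finset (Fin j)).Nonempty := ⟨⟨0, hj⟩, Finset.mem_univ _⟩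
    refine Finset.mem_Ioc.2 ⟨?_, ?_⟩
    · rcases Nat.eq_zero_or_pos A with rfl | hA
      · rw [zero_pow hj.ne']
        exact Finset.prod_pos fun l _ => (h l).1
      · have := Finset.prod_lt_prod_of_nonempty (f := fun _ => A) (g := t) (fun l _ => hA)
          (fun l _ => (h l).1) hne
        simpa using this
    · have := Finset.prod_le_pow_card Finset.univ t B fun l _ => (h l).2
      simpa using this
  rw [h1, ← Finset.sum_fiberwise_of_maps_to hmaps]
  refine Finset.sum_congr rfl fun n _ => ?_
  rw [Finset.sum_congr rfl (g := fun _ => (1 / (n : 𝕜)) * F n) fun t ht => by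
    rw [(Finset.mem_filter.1 ht).2], Finset.sum_const, nsmul_eq_mul, primeTuples]
  ring

theorem lt_of_dvd_of_primeTuples_card_ne_zero {A B j n : ℕ} (h : (primeTuples A B j n).card ≠ 0)
    {p : ℕ} (hp : p.Prime) (hpn : p ∣ n) : A < p := by
  obtain ⟨t, ht⟩ := Finset.card_ne_zero.1 h
  obtain ⟨h1, h2⟩ := Finset.mem_filter.1 ht
  rw [← h2] at hpn
  obtain ⟨m, -, hm⟩ := (Prime.dvd_finsetProd_iff hp.prime _).1 hpn
  have hq := Finset.mem_filter.1 (Fintype.mem_piFinset.1 h1 m)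
  rw [(Nat.prime_dvd_prime_iff_eq hp hq.2).1 hm]
  exact (Finset.mem_Ioc.1 hq.1).1

theorem sum_primeTuples_sq_le (A B : ℕ) {j : ℕ} (hj : 0 < j) :
    ∑ n ∈ Finset.Ioc (A ^ j) (B ^ j), ((primeTuples A B j n).card / (n : ℝ)) ^ 2 * n
      ≤ (j : ℝ) ^ j * (∑ p ∈ primesIoc A B, 1 / (p : ℝ)) ^ j := by
  have h := sum_primesIoc_one_div_mul_pow (1 : ℕ →* ℝ) A B hj
  simp only [MonoidHom.one_apply, mul_one] at h
  rw [h, Finset.mul_sum]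
  refine Finset.sum_le_sum fun n hn => ?_
  have hn0 : (0 : ℝ) < n := by exact_mod_cast (Nat.zero_le _).trans_lt (Finset.mem_Ioc.1 hn).1
  have hc : ((primeTuples A B j n).card : ℝ) ≤ (j : ℝ) ^ j := by
    exact_mod_cast card_primeTuples_le A B j n
  calc ((primeTuples A B j n).card / (n : ℝ)) ^ 2 * n
      = (primeTuples A B j n).card * ((primeTuples A B j n).card / (n : ℝ)) := by
        field_simp
    _ ≤ _ := mul_le_mul_of_nonneg_right hc (by positivity)

end PrimePowers

section CharSums

variable {D T : ℕ}

/-- `charProd` as a monoid homomorphism. -/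
noncomputable def charProdHom {ι : Type*} [Fintype ι] {a : Option ι → ℕ} (χ : CharFamily a) :
    ℕ →* ℂ where
  toFun := charProd χ
  map_one' := by simp [charProd]
  map_mul' m n := by simp only [charProd, ← Finset.prod_mul_distrib, Nat.cast_mul, map_mul]

/-- The sum of `χ(p) / p` over the primes in `(A, B]`. -/
noncomputable def primeCharSum (A B : ℕ) (χ : CharFamily (sieveModulus D T)) : ℂ :=
  ∑ p ∈ primesIoc A B, (1 / (p : ℂ)) * charProd χ p

/-- The sum of `χ(p) log p / p` over the primes in `(A, B]`. -/
noncomputable def primeLogCharSum (A B : ℕ) (χ : CharFamily (sieveModulus D T)) : ℂ :=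
  ∑ p ∈ primesIoc A B, ((Real.log p / p : ℝ) : ℂ) * charProd χ p

theorem norm_primeCharSum_le (A B : ℕ) (χ : CharFamily (sieveModulus D T)) :
    ‖primeCharSum A B χ‖ ≤ ∑ p ∈ primesIoc A B, 1 / (p : ℝ) := by
  refine norm_sum_le_of_le _ fun p _ => ?_
  rw [norm_mul, norm_div, norm_one, Complex.norm_natCast]
  exact mul_le_of_le_one_right (by positivity) (norm_charProd_le_one χ p)

theorem exists_sum_norm_primeCharSum_pow_le (hD : 4 ≤ D) {j : ℕ} (hj : 0 < j) (r : ℕ) :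
    ∃ z₀ : ℕ, ∀ z T Q A B : ℕ, z₀ ≤ z → z ≤ T → 0 < Q → 0 < B → B ^ j ≤ z ^ r → T ≤ A →
      144 * primorial D ^ 2 * z ^ 6 * Q ^ 5 ≤ A ^ j →
      ∀ 𝒢 : Finset (CharFamily (sieveModulus D T)), (∀ χ ∈ 𝒢, charCond χ ≤ Q) →
      ∑ χ ∈ 𝒢, ‖primeCharSum A B χ‖ ^ (2 * j)
        ≤ (12 * r + 16) * ((j : ℝ) ^ j * (∑ p ∈ primesIoc A B, 1 / (p : ℝ)) ^ j) := by
  obtain ⟨z₀, hz₀⟩ := exists_sum_norm_sum_mul_charProd_sq_le hD r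
  refine ⟨max z₀ D, fun z T Q A B hz hzT hQ0 hB0 hB hTA hA 𝒢 hQ => ?_⟩
  have h := hz₀ z T Q (A ^ j) (B ^ j) ((le_max_left _ _).trans hz) hzT hQ0 (pow_pos hB0 j) hB hA 𝒢
    hQ (fun n => (primeTuples A B j n).card / (n : ℂ)) fun n hn i => by
      have hn' : (primeTuples A B j n).card ≠ 0 := fun h => hn (by simp [h])
      exact coprime_sieveModulus (((le_max_right _ _).trans hz).trans hzT)
        (fun p hp hpn => hTA.trans_lt (lt_of_dvd_of_primeTuples_card_ne_zero hn' hp hpn)) (some i)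
  have e : ∀ χ : CharFamily (sieveModulus D T),
      ‖∑ n ∈ Finset.Ioc (A ^ j) (B ^ j), (primeTuples A B j n).card / (n : ℂ) * charProd χ n‖ ^ 2
        = ‖primeCharSum A B χ‖ ^ (2 * j) := by
    intro χ
    have h2 := sum_primesIoc_one_div_mul_pow (charProdHom χ) A B hj
    change primeCharSum A B χ ^ j = ∑ n ∈ Finset.Ioc (A ^ j) (B ^ j),
      (primeTuples A B j n).card / (n : ℂ) * charProd χ n at h2
    rw [← h2, norm_pow, ← pow_mul, mul_comm]
  simp only [e] at h
  refine h.trans (mul_le_mul_of_nonneg_left (le_trans (le_of_eq ?_)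
    (sum_primeTuples_sq_le A B hj)) (by positivity))
  refine Finset.sum_congr rfl fun n _ => ?_
  rw [norm_div, Complex.norm_natCast, Complex.norm_natCast]

theorem exists_sum_norm_primeLogCharSum_sq_le (hD : 4 ≤ D) (r : ℕ) :
    ∃ z₀ : ℕ, ∀ z T Q A B : ℕ, z₀ ≤ z → z ≤ T → 0 < Q → 0 < B → B ≤ z ^ r → T ≤ A →
      144 * primorial D ^ 2 * z ^ 6 * Q ^ 5 ≤ A →
      ∀ 𝒢 : Finset (CharFamily (sieveModulus D T)), (∀ χ ∈ 𝒢, charCond χ ≤ Q) →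
      ∑ χ ∈ 𝒢, ‖primeLogCharSum A B χ‖ ^ 2
        ≤ (12 * r + 16) * (Real.log B * ∑ p ∈ primesIoc A B, Real.log p / p) := by
  obtain ⟨z₀, hz₀⟩ := exists_sum_norm_sum_mul_charProd_sq_le hD r
  refine ⟨max z₀ D, fun z T Q A B hz hzT hQ0 hB0 hB hTA hA 𝒢 hQ => ?_⟩
  have h := hz₀ z T Q A B ((le_max_left _ _).trans hz) hzT hQ0 hB0 hB hA 𝒢
    hQ (fun n => if n.Prime ∧ A < n then ((Real.log n / n : ℝ) : ℂ) else 0) fun n hn i => by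
      have hn' : n.Prime ∧ A < n := by
        by_contra h
        exact hn (if_neg h)
      refine coprime_sieveModulus (((le_max_right _ _).trans hz).trans hzT)
        (fun p hp hpn => ?_) (some i)
      rw [(Nat.prime_dvd_prime_iff_eq hp hn'.1).1 hpn]
      exact hTA.trans_lt hn'.2
  have e : ∀ F : ℕ → ℂ, ∑ n ∈ Finset.Ioc A B,
      (if n.Prime ∧ A < n then ((Real.log n / n : ℝ) : ℂ) else 0) * F n
      = ∑ p ∈ primesIoc A B, ((Real.log p / p : ℝ) : ℂ) * F p := by
    intro F
    rw [Finset.sum_filter]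
    refine Finset.sum_congr rfl fun n hn => ?_
    have := (Finset.mem_Ioc.1 hn).1
    by_cases h : n.Prime <;> simp [h, this]
  simp only [e] at h
  refine h.trans (mul_le_mul_of_nonneg_left ?_ (by positivity))
  rw [Finset.mul_sum, Finset.sum_filter]
  refine Finset.sum_le_sum fun n hn => ?_
  obtain ⟨h1, h2⟩ := Finset.mem_Ioc.1 hn
  have hn0 : (0 : ℝ) < n := by exact_mod_cast (Nat.zero_le _).trans_lt h1
  by_cases h : n.Prime
  · rw [if_pos ⟨h, h1⟩, if_pos h, Complex.norm_real, Real.norm_eq_abs, sq_abs]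
    have hl : Real.log n ≤ Real.log B := Real.log_le_log hn0 (by exact_mod_cast h2)
    have hl0 : 0 ≤ Real.log n / n := div_nonneg (Real.log_natCast_nonneg n) hn0.le
    calc (Real.log n / n) ^ 2 * n = Real.log n * (Real.log n / n) := by field_simp
      _ ≤ _ := mul_le_mul_of_nonneg_right hl hl0
  · simp [h]

/-- The sums over primes twisted by a nontrivial character modulo the primorial are bounded. -/
theorem exists_norm_primeLogCharSum_le (D : ℕ) : ∃ C : ℝ, 0 ≤ C ∧ ∀ T A B : ℕ, D ≤ T → T ≤ A →
    A ≤ B → ∀ χ : CharFamily (sieveModulus D T), χ ≠ 1 → charSupport χ = ∅ →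
    ‖primeLogCharSum A B χ‖ ≤ C := by
  classical
  have : NeZero (primorial D) := ⟨(primorial_pos D).ne'⟩
  have h : ∀ χ : DirichletCharacter ℂ (primorial D), ∃ C : ℝ, χ ≠ 1 → ∀ x : ℕ,
      ‖∑ p ∈ (Finset.Ioc 0 x).filter Nat.Prime, χ p * (Real.log p : ℂ) / p‖ ≤ C := by
    intro χ
    by_cases hχ : χ = 1
    · exact ⟨0, fun h => absurd hχ h⟩
    · obtain ⟨C, hC⟩ := DirichletCharacter.exists_norm_sum_prime_log_div_le hχ
      exact ⟨C, fun _ => hC⟩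
  choose C hC using h
  refine ⟨2 * ∑ χ, |C χ|, by positivity, fun T A B hDT hTA hAB χ hχ hs => ?_⟩
  have hsome : ∀ i, χ (some i) = 1 := fun i => by
    by_contra hi
    have : i ∈ charSupport χ := by simp [charSupport, hi]
    simp [hs] at this
  set χ₀ : DirichletCharacter ℂ (primorial D) := χ none with hχ₀
  have hnone : χ₀ ≠ 1 := fun h => hχ (funext fun o => by
    rcases o with _ | i
    · exact h
    · exact hsome i)
  have e : primeLogCharSum A B χ = ∑ p ∈ (Finset.Ioc 0 B).filter Nat.Prime,
        χ₀ p * (Real.log p : ℂ) / p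
      - ∑ p ∈ (Finset.Ioc 0 A).filter Nat.Prime, χ₀ p * (Real.log p : ℂ) / p := by
    have e' : (Finset.Ioc 0 B).filter Nat.Prime
        = (Finset.Ioc 0 A).filter Nat.Prime ∪ primesIoc A B := by
      rw [← Finset.filter_union, Finset.Ioc_union_Ioc_eq_Ioc (Nat.zero_le _) hAB]
    have hd : Disjoint ((Finset.Ioc 0 A).filter Nat.Prime) (primesIoc A B) :=
      Finset.disjoint_filter_filter (Finset.Ioc_disjoint_Ioc_of_le le_rfl)
    rw [e', Finset.sum_union hd, add_sub_cancel_left, primeLogCharSum]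
    refine Finset.sum_congr rfl fun p hp => ?_
    obtain ⟨h1, h2⟩ := Finset.mem_filter.1 hp
    have hcop := fun i : primesIoc D T => coprime_sieveModulus (T := T) hDT (n := p)
      (fun q hq hqp => by
        rw [(Nat.prime_dvd_prime_iff_eq hq h2).1 hqp]
        exact hTA.trans_lt (Finset.mem_Ioc.1 h1).1) (some i)
    have : charProd χ p = χ₀ p := by
      rw [charProd, Fintype.prod_option]
      rw [Finset.prod_eq_one fun i _ => ?_, mul_one]
      · rfl
      · rw [hsome i, MulChar.one_apply ((ZMod.isUnit_iff_coprime _ _).2 (hcop i))]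
    rw [this]
    push_cast
    ring
  rw [e]
  refine (norm_sub_le _ _).trans ((add_le_add (hC χ₀ hnone B) (hC χ₀ hnone A)).trans ?_)
  have h1 := Finset.single_le_sum (f := fun χ => |C χ|) (fun χ _ => abs_nonneg _)
    (Finset.mem_univ χ₀)
  have h2 := le_abs_self (C χ₀)
  linarith

end CharSums

section CharWeight

variable {D T : ℕ}

/-- The product of `c / p` over the primes where a family of characters is nontrivial. -/
noncomputable def charWeight (c : ℝ) (χ : CharFamily (sieveModulus D T)) : ℝ :=
  ∏ i, if i ∈ charSupport χ then c * (1 / (sieveModulus D T (some i) : ℝ)) else 1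

theorem charWeight_nonneg {c : ℝ} (hc : 0 ≤ c) (χ : CharFamily (sieveModulus D T)) :
    0 ≤ charWeight c χ :=
  Finset.prod_nonneg fun i _ => by split_ifs <;> positivity

theorem mul_one_div_sieveModulus_le {c : ℝ} (hc : 0 ≤ c) (hD : 0 < D) (i : primesIoc D T) :
    c * (1 / (sieveModulus D T (some i) : ℝ)) ≤ c / D := by
  have hD' : (0 : ℝ) < D := by exact_mod_cast hD
  rw [div_eq_mul_one_div c (D : ℝ)]
  refine mul_le_mul_of_nonneg_left (one_div_le_one_div_of_le hD' ?_) hc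
  exact_mod_cast (lt_sieveModulus i).le

theorem charWeight_le_div {c : ℝ} (hc : 0 ≤ c) (hD : 0 < D) (hcD : c ≤ D)
    {χ : CharFamily (sieveModulus D T)} (hχ : charSupport χ ≠ ∅) : charWeight c χ ≤ c / D := by
  obtain ⟨i₀, hi₀⟩ := Finset.nonempty_iff_ne_empty.2 hχ
  have hD' : (0 : ℝ) < D := by exact_mod_cast hD
  rw [charWeight, ← Finset.mul_prod_erase _ _ (Finset.mem_univ i₀), if_pos hi₀]
  refine (mul_le_of_le_one_right (by positivity) (Finset.prod_le_one (fun i _ => ?_)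
    fun i _ => ?_)).trans (mul_one_div_sieveModulus_le hc hD i₀)
  · split_ifs <;> positivity
  · split_ifs
    · exact (mul_one_div_sieveModulus_le hc hD i).trans ((div_le_one hD').2 hcD)
    · exact le_rfl

theorem charWeight_sq_le {c : ℝ} (hD : 0 < D) (hcD : c ^ 2 ≤ D)
    (χ : CharFamily (sieveModulus D T)) : charWeight c χ ^ 2 ≤ 1 / charCond χ := by
  rw [one_div_charCond, charWeight, ← Finset.prod_pow]
  refine Finset.prod_le_prod (fun i _ => sq_nonneg _) fun i _ => ?_
  split_ifs
  · have hp : (0 : ℝ) < sieveModulus D T (some i) := by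
      exact_mod_cast (sieveModulus_prime i).pos
    have h1 := mul_one_div_sieveModulus_le (T := T) (sq_nonneg c) hD i
    have h2 : c ^ 2 * (1 / (sieveModulus D T (some i) : ℝ)) ≤ 1 :=
      h1.trans ((div_le_one (by exact_mod_cast hD)).2 hcD)
    calc (c * (1 / (sieveModulus D T (some i) : ℝ))) ^ 2
        = c ^ 2 * (1 / (sieveModulus D T (some i) : ℝ)) * (1 / (sieveModulus D T (some i) : ℝ)) := by
          ring
      _ ≤ 1 * (1 / (sieveModulus D T (some i) : ℝ)) := by gcongr
      _ = _ := one_mul _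
  · simp

theorem sum_charWeight_sq_le (c : ℝ) :
    ∑ χ : CharFamily (sieveModulus D T), charWeight c χ ^ 2
      ≤ primorial D * Real.exp (c ^ 2 * ∑ p ∈ primesIoc D T, 1 / (p : ℝ)) := by
  have h := sum_prod_charSupport_le (D := D) (T := T)
    (u := fun i => (c * (1 / (sieveModulus D T (some i) : ℝ))) ^ 2) fun i => sq_nonneg _
  have e : ∀ χ : CharFamily (sieveModulus D T), charWeight c χ ^ 2
      = ∏ i, if i ∈ charSupport χ then (c * (1 / (sieveModulus D T (some i) : ℝ))) ^ 2 else 1 := by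
    intro χ
    rw [charWeight, ← Finset.prod_pow]
    refine Finset.prod_congr rfl fun i _ => ?_
    split_ifs <;> simp
  simp only [e]
  refine h.trans (mul_le_mul_of_nonneg_left ?_ (Nat.cast_nonneg _))
  rw [← sum_sieveModulus fun p => 1 / (p : ℝ), Finset.mul_sum, Real.exp_sum]
  refine Finset.prod_le_prod (fun i _ => by positivity) fun i _ => ?_
  have hp : (sieveModulus D T (some i) : ℝ) ≠ 0 := by
    exact_mod_cast (sieveModulus_prime i).ne_zero
  have e2 : (sieveModulus D T (some i) : ℝ) * (c * (1 / (sieveModulus D T (some i) : ℝ))) ^ 2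
      = c ^ 2 * (1 / (sieveModulus D T (some i) : ℝ)) := by field_simp
  rw [e2, add_comm]
  exact Real.add_one_le_exp _

end CharWeight

section Combination

variable {κ : Type*}

theorem sum_mul_mul_le_of_le (S : Finset κ) {w a b : κ → ℝ} {η A B : ℝ} (hη : 0 ≤ η)
    (hw : ∀ x ∈ S, w x ≤ η) (ha : ∀ x ∈ S, 0 ≤ a x) (hb : ∀ x ∈ S, 0 ≤ b x)
    (hA : ∑ x ∈ S, a x ^ 2 ≤ A) (hB : ∑ x ∈ S, b x ^ 2 ≤ B) :
    ∑ x ∈ S, w x * a x * b x ≤ η * (√A * √B) := by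
  calc ∑ x ∈ S, w x * a x * b x ≤ ∑ x ∈ S, η * (a x * b x) := by
        refine Finset.sum_le_sum fun x hx => ?_
        rw [mul_assoc]
        exact mul_le_mul_of_nonneg_right (hw x hx) (mul_nonneg (ha x hx) (hb x hx))
    _ = η * ∑ x ∈ S, a x * b x := by rw [Finset.mul_sum]
    _ ≤ η * (√(∑ x ∈ S, a x ^ 2) * √(∑ x ∈ S, b x ^ 2)) :=
        mul_le_mul_of_nonneg_left (Real.sum_mul_le_sqrt_mul_sqrt _ _ _) hη
    _ ≤ _ := by gcongr

theorem sum_sq_mul_sq_le (S : Finset κ) {w a : κ → ℝ} {η t : ℝ} (ht : 0 < t) (j : ℕ)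
    (hw : ∀ x ∈ S, w x ^ 2 ≤ η) :
    ∑ x ∈ S, (w x * a x) ^ 2
      ≤ t * ∑ x ∈ S, w x ^ 2 + η / t ^ j * ∑ x ∈ S, a x ^ (2 * (j + 1)) := by
  rw [Finset.mul_sum, Finset.mul_sum, ← Finset.sum_add_distrib]
  refine Finset.sum_le_sum fun x hx => ?_
  have h1 := hw x hx
  have hη : 0 ≤ η := (sq_nonneg _).trans h1
  have h2 : a x ^ 2 ≤ t + a x ^ (2 * (j + 1)) / t ^ j := by
    rcases le_total (a x ^ 2) t with h | h
    · have : 0 ≤ a x ^ (2 * (j + 1)) / t ^ j := by rw [pow_mul]; positivity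
      linarith
    · have : a x ^ 2 ≤ a x ^ (2 * (j + 1)) / t ^ j := by
        rw [le_div_iff₀ (by positivity), pow_mul, pow_succ, mul_comm]
        exact mul_le_mul_of_nonneg_right (pow_le_pow_left₀ ht.le h j) (sq_nonneg _)
      linarith
  calc (w x * a x) ^ 2 = w x ^ 2 * a x ^ 2 := mul_pow _ _ _
    _ ≤ w x ^ 2 * (t + a x ^ (2 * (j + 1)) / t ^ j) := by gcongr
    _ = t * w x ^ 2 + w x ^ 2 * (a x ^ (2 * (j + 1)) / t ^ j) := by ring
    _ ≤ t * w x ^ 2 + η * (a x ^ (2 * (j + 1)) / t ^ j) := by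
        have : 0 ≤ a x ^ (2 * (j + 1)) / t ^ j := by rw [pow_mul]; positivity
        gcongr
    _ = _ := by ring

end Combination

section Bilinear

theorem mul_pow_le_pow_of_le {W y e m : ℕ} (hy : 0 < y) (hW : 144 * W ^ 2 ≤ y)
    (hm : 10 * e + 7 ≤ m) : 144 * W ^ 2 * y ^ 6 * (y ^ (2 * e)) ^ 5 ≤ y ^ m := by
  calc 144 * W ^ 2 * y ^ 6 * (y ^ (2 * e)) ^ 5 ≤ y * y ^ 6 * (y ^ (2 * e)) ^ 5 := by gcongr
    _ = y ^ (10 * e + 7) := by ring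
    _ ≤ y ^ m := Nat.pow_le_pow_right hy hm

theorem exists_sum_primesIoc_pow_le : ∃ C : ℝ, 0 < C ∧ ∀ y u e : ℕ, 1 < y → C ≤ Real.log y →
    0 < u → u ≤ 100 * e → 0 < e → ∑ p ∈ primesIoc (y ^ u) (y ^ (100 * e)), 1 / (p : ℝ) ≤ 101 * e ∧
      ∑ p ∈ primesIoc (y ^ (100 * e)) (y ^ (200 * e)), Real.log p / p
        ≤ 2 * Real.log (y ^ (100 * e) : ℕ) := by
  obtain ⟨C₁, hC₁, h₁⟩ := exists_sum_primesIoc_one_div_le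
  obtain ⟨C₂, hC₂, h₂⟩ := exists_abs_sum_primesIoc_log_div_sub_le
  refine ⟨max C₁ C₂, lt_max_of_lt_left hC₁, fun y u e hy hC hu hue he => ?_⟩
  have hC1 := (le_max_left C₁ C₂).trans hC
  have hC2 := (le_max_right C₁ C₂).trans hC
  have hL : 0 < Real.log y := hC₁.trans_le hC1
  have hu' : (1 : ℝ) ≤ u := by exact_mod_cast hu
  have he' : (1 : ℝ) ≤ e := by exact_mod_cast he
  constructor
  · refine (h₁ _ _ (Nat.one_lt_pow hu.ne' hy) (Nat.pow_le_pow_right hy.le hue)).1.trans ?_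
    push_cast
    rw [Real.log_pow, Real.log_pow, div_le_iff₀ (by positivity)]
    push_cast
    nlinarith [mul_pos (by linarith : (0 : ℝ) < e) hL, mul_le_mul_of_nonneg_right hu'
      (by positivity : 0 ≤ 101 * (e * Real.log y)), mul_le_mul_of_nonneg_right he' hL.le]
  · have := (abs_le.1 (h₂ (y ^ (100 * e)) (y ^ (200 * e)) (by positivity)
      (Nat.pow_le_pow_right hy.le (by lia)))).2
    push_cast at this ⊢
    rw [Real.log_pow, Real.log_pow] at this
    rw [Real.log_pow]
    push_cast at this ⊢
    nlinarith [mul_le_mul_of_nonneg_right he' hL.le]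

variable {D : ℕ}

/-- Characters of large conductor. -/
theorem exists_sum_charWeight_mul_le_of_lt (hD : 4 ≤ D) {c : ℝ} (hcD : c ^ 2 ≤ D)
    {u e : ℕ} (hu : 16 ≤ u) (hue : u ≤ e) (hlog : 4 * e * u * c ^ 2 ≤ Real.log D) :
    ∃ K : ℝ, ∃ x₀ : ℕ, ∀ x y : ℕ, x₀ ≤ x → y = x ^ (4 * e) →
      ∀ 𝒢 : Finset (CharFamily (sieveModulus D (y ^ u))),
      (∀ χ ∈ 𝒢, y < charCond χ ∧ charCond χ ≤ y ^ (2 * e)) →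
      ∑ χ ∈ 𝒢, (charWeight c χ * ‖primeCharSum (y ^ u) (y ^ (100 * e)) χ‖) ^ 2 ≤ K / x := by
  obtain ⟨C₁, hC₁, h₁⟩ := exists_sum_primesIoc_pow_le
  obtain ⟨C₂, hC₂, h₂⟩ := exists_sum_primesIoc_one_div_le
  obtain ⟨z₀, hz₀⟩ := exists_sum_norm_primeCharSum_pow_le hD (by lia : 0 < e) (100 * e * e)
  set W := primorial D with hW
  have he : 0 < e := by lia
  refine ⟨W * Real.exp (c ^ 2 * C₂) + (12 * (100 * e * e : ℕ) + 16) *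
    ((e : ℝ) ^ e * (101 * e) ^ e),
    max (max z₀ (144 * W ^ 2)) (max D (⌈Real.exp C₁⌉₊ + 2)), fun x y hx hxy 𝒢 h𝒢 => ?_⟩
  simp only [max_le_iff] at hx
  obtain ⟨⟨hx1, hx2⟩, hx3, hx4⟩ := hx
  have hx0 : 1 < x := by lia
  have hxy' : x ≤ y := by rw [hxy]; exact Nat.le_self_pow (by lia) x
  have hy : 1 < y := by lia
  have hyT : y ≤ y ^ u := Nat.le_self_pow (by lia) y
  have hlogC : C₁ ≤ Real.log y := by
    rw [Real.le_log_iff_exp_le (by exact_mod_cast (by lia : 0 < y))]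
    exact (Nat.le_ceil _).trans (by exact_mod_cast (by lia))
  have hB := (h₁ y u e hy hlogC (by lia) (by lia) he).1
  have hm := hz₀ y (y ^ u) (y ^ (2 * e)) (y ^ u) (y ^ (100 * e)) (by lia) hyT (by positivity)
    (by positivity) (le_of_eq (by ring)) le_rfl
    ((mul_pow_le_pow_of_le (by lia) (by lia) (by nlinarith)).trans_eq (pow_mul y u e)) 𝒢
    fun χ hχ => (h𝒢 χ hχ).2
  have hx' : (1 : ℝ) < x := by exact_mod_cast hx0
  have hV := sum_sq_mul_sq_le 𝒢 (w := charWeight c)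
    (a := fun χ => ‖primeCharSum (y ^ u) (y ^ (100 * e)) χ‖) (η := 1 / (y : ℝ))
    (t := 1 / (x : ℝ) ^ 2) (by positivity) (e - 1) fun χ hχ =>
      (charWeight_sq_le (by lia) hcD χ).trans (one_div_le_one_div_of_le
        (by exact_mod_cast (by lia : 0 < y)) (by exact_mod_cast (h𝒢 χ hχ).1.le))
  rw [Nat.sub_add_cancel he] at hV
  have hlogD : 1 ≤ Real.log D := by
    rw [Real.le_log_iff_exp_le (by exact_mod_cast (by lia : 0 < D))]
    have := Real.exp_one_lt_three.le
    exact this.trans (by exact_mod_cast (by lia))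
  have hw : ∑ χ ∈ 𝒢, charWeight c χ ^ 2 ≤ W * Real.exp (c ^ 2 * C₂) * x := by
    refine (Finset.sum_le_sum_of_subset_of_nonneg (Finset.subset_univ 𝒢)
      fun _ _ _ => sq_nonneg _).trans ((sum_charWeight_sq_le c).trans ?_)
    rw [mul_assoc, ← Real.exp_log (by linarith : (0 : ℝ) < x), ← Real.exp_add]
    refine mul_le_mul_of_nonneg_left (Real.exp_le_exp.2 ?_) (Nat.cast_nonneg _)
    have h3 := (h₂ D (y ^ u) (by lia) (by lia)).1
    have h4 : Real.log ((y ^ u : ℕ) : ℝ) = 4 * e * u * Real.log x := by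
      rw [hxy]
      push_cast
      rw [Real.log_pow, Real.log_pow]
      push_cast
      ring
    rw [h4] at h3
    have hlx : 0 < Real.log x := Real.log_pos hx'
    have h5 : c ^ 2 * (4 * e * u * Real.log x) / Real.log D ≤ Real.log x := by
      rw [div_le_iff₀ (by linarith)]
      nlinarith
    have h6 : c ^ 2 * C₂ / Real.log D ≤ c ^ 2 * C₂ := div_le_self (by positivity) hlogD
    calc c ^ 2 * ∑ p ∈ primesIoc D (y ^ u), 1 / (p : ℝ)
        ≤ c ^ 2 * ((4 * e * u * Real.log x - Real.log D + C₂) / Real.log D) := by gcongr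
      _ ≤ c ^ 2 * ((4 * e * u * Real.log x + C₂) / Real.log D) := by gcongr; linarith
      _ = c ^ 2 * C₂ / Real.log D + c ^ 2 * (4 * e * u * Real.log x) / Real.log D := by ring
      _ ≤ _ := add_le_add h6 h5
  have hm' := hm.trans (mul_le_mul_of_nonneg_left (mul_le_mul_of_nonneg_left
    (pow_le_pow_left₀ (Finset.sum_nonneg fun _ _ => by positivity) hB e)
    (by positivity : (0 : ℝ) ≤ (e : ℝ) ^ e)) (by positivity : (0 : ℝ) ≤
      12 * (100 * e * e : ℕ) + 16))
  refine hV.trans ?_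
  have e1 : (1 : ℝ) / y / (1 / (x : ℝ) ^ 2) ^ (e - 1) ≤ 1 / x := by
    have : (y : ℝ) * (1 / (x : ℝ) ^ 2) ^ (e - 1) = (x : ℝ) ^ (2 * e + 2) := by
      rw [hxy]
      push_cast
      rw [one_div, inv_pow, ← pow_mul, ← div_eq_mul_inv, div_eq_iff (by positivity), ← pow_add]
      congr 1
      lia
    rw [div_div, this]
    exact one_div_le_one_div_of_le (by positivity) (le_self_pow₀ hx'.le (by lia))
  rw [add_div]
  refine add_le_add ?_ ?_
  · calc 1 / (x : ℝ) ^ 2 * ∑ χ ∈ 𝒢, charWeight c χ ^ 2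
        ≤ 1 / (x : ℝ) ^ 2 * (W * Real.exp (c ^ 2 * C₂) * x) := by gcongr
      _ = _ := by field_simp
  · refine (mul_le_mul e1 hm' (Finset.sum_nonneg fun _ _ => by positivity)
      (by positivity)).trans (le_of_eq (by ring))

/-- Characters of small positive conductor. -/
theorem exists_sum_norm_primeCharSum_sq_le (hD : 4 ≤ D) {u e : ℕ} (hu : 16 ≤ u) (hue : u ≤ e) :
    ∃ y₀ : ℕ, ∀ y : ℕ, y₀ ≤ y → ∀ 𝒢 : Finset (CharFamily (sieveModulus D (y ^ u))),
      (∀ χ ∈ 𝒢, charCond χ ≤ y) →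
      ∑ χ ∈ 𝒢, ‖primeCharSum (y ^ u) (y ^ (100 * e)) χ‖ ^ 2
        ≤ (1200 * e + 16) * (101 * e) := by
  obtain ⟨C₁, hC₁, h₁⟩ := exists_sum_primesIoc_pow_le
  obtain ⟨z₀, hz₀⟩ := exists_sum_norm_primeCharSum_pow_le hD one_pos (100 * e)
  refine ⟨max (max z₀ (144 * primorial D ^ 2)) (⌈Real.exp C₁⌉₊ + 2), fun y hy 𝒢 h𝒢 => ?_⟩
  simp only [max_le_iff] at hy
  obtain ⟨⟨hy1, hy2⟩, hy3⟩ := hy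
  have hlogC : C₁ ≤ Real.log y := by
    rw [Real.le_log_iff_exp_le (by exact_mod_cast (by lia : 0 < y))]
    exact (Nat.le_ceil _).trans (by exact_mod_cast (by lia))
  have hB := (h₁ y u e (by lia) hlogC (by lia) (by lia) (by lia)).1
  have hm := hz₀ y (y ^ u) y (y ^ u) (y ^ (100 * e)) (by lia) (Nat.le_self_pow (by lia) y)
    (by lia) (pow_pos (by lia) _) (by rw [pow_one]) le_rfl (by
      rw [pow_one]
      calc 144 * primorial D ^ 2 * y ^ 6 * y ^ 5 ≤ y * y ^ 6 * y ^ 5 := by gcongr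
        _ = y ^ 12 := by ring
        _ ≤ y ^ u := Nat.pow_le_pow_right (by lia) (by lia)) 𝒢 h𝒢
  simp only [mul_one, pow_one, Nat.cast_one, one_mul] at hm
  refine hm.trans ?_
  push_cast
  refine mul_le_mul (by linarith) hB (Finset.sum_nonneg fun _ _ => by positivity) (by positivity)

theorem exists_sum_norm_primeLogCharSum_pow_sq_le (hD : 4 ≤ D) {u e : ℕ} (hu : 16 ≤ u)
    (hue : u ≤ e) :
    ∃ y₀ : ℕ, ∀ y : ℕ, y₀ ≤ y → ∀ 𝒢 : Finset (CharFamily (sieveModulus D (y ^ u))),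
      (∀ χ ∈ 𝒢, charCond χ ≤ y ^ (2 * e)) →
      ∑ χ ∈ 𝒢, ‖primeLogCharSum (y ^ (100 * e)) (y ^ (200 * e)) χ‖ ^ 2
        ≤ (2400 * e + 16) * 4 * Real.log (y ^ (100 * e) : ℕ) ^ 2 := by
  obtain ⟨C₁, hC₁, h₁⟩ := exists_sum_primesIoc_pow_le
  obtain ⟨z₀, hz₀⟩ := exists_sum_norm_primeLogCharSum_sq_le hD (200 * e)
  refine ⟨max (max z₀ (144 * primorial D ^ 2)) (⌈Real.exp C₁⌉₊ + 2), fun y hy 𝒢 h𝒢 => ?_⟩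
  simp only [max_le_iff] at hy
  obtain ⟨⟨hy1, hy2⟩, hy3⟩ := hy
  have hlogC : C₁ ≤ Real.log y := by
    rw [Real.le_log_iff_exp_le (by exact_mod_cast (by lia : 0 < y))]
    exact (Nat.le_ceil _).trans (by exact_mod_cast (by lia))
  have hB := (h₁ y u e (by lia) hlogC (by lia) (by lia) (by lia)).2
  refine (hz₀ y (y ^ u) (y ^ (2 * e)) (y ^ (100 * e)) (y ^ (200 * e)) (by lia)
    (Nat.le_self_pow (by lia) y) (pow_pos (by lia) _) (pow_pos (by lia) _) le_rfl
    (Nat.pow_le_pow_right (by lia) (by lia)) (mul_pow_le_pow_of_le (by lia) (by lia) (by lia)) 𝒢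
    h𝒢).trans ?_
  have e1 : Real.log (y ^ (200 * e) : ℕ) = 2 * Real.log (y ^ (100 * e) : ℕ) := by
    push_cast
    rw [Real.log_pow, Real.log_pow]
    push_cast
    ring
  have hL : 0 ≤ Real.log (y ^ (100 * e) : ℕ) := Real.log_natCast_nonneg _
  rw [e1, mul_assoc _ (4 : ℝ)]
  push_cast at hB hL ⊢
  refine mul_le_mul (by linarith) ?_ ?_ (by positivity)
  · nlinarith
  · exact mul_nonneg (by positivity) (Finset.sum_nonneg fun p _ =>
      div_nonneg (Real.log_natCast_nonneg p) p.cast_nonneg)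

set_option maxHeartbeats 1000000 in
theorem exists_sum_charWeight_mul_mul_le {c : ℝ} (hc : 1 ≤ c) {u e : ℕ} (hu : 16 ≤ u)
    (hue : u ≤ e) {δ : ℝ} (hδ : 0 < δ) : ∃ D₁ : ℕ, ∀ D : ℕ, D₁ ≤ D → ∃ x₀ : ℕ, ∀ x y : ℕ,
      x₀ ≤ x → y = x ^ (4 * e) → ∀ 𝒢 : Finset (CharFamily (sieveModulus D (y ^ u))),
      (∀ χ ∈ 𝒢, χ ≠ 1 ∧ charCond χ ≤ y ^ (2 * e)) →
      ∑ χ ∈ 𝒢, charWeight c χ * ‖primeCharSum (y ^ u) (y ^ (100 * e)) χ‖ *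
          ‖primeLogCharSum (y ^ (100 * e)) (y ^ (200 * e)) χ‖
        ≤ δ * Real.log (y ^ (100 * e) : ℕ) := by
  set k₁ : ℝ := (1200 * e + 16) * (101 * e) with hk₁
  set k₂ : ℝ := (2400 * e + 16) * 4 with hk₂
  have hk₁0 : 0 ≤ k₁ := by positivity
  have hk₂0 : 0 ≤ k₂ := by positivity
  refine ⟨max (max 4 ⌈c ^ 2⌉₊) (max ⌈Real.exp (4 * e * u * c ^ 2)⌉₊ ⌈3 * c * (√k₁ * √k₂) / δ⌉₊),
    fun D hD => ?_⟩
  simp only [max_le_iff, Nat.ceil_le] at hD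
  obtain ⟨⟨hD4, hcD⟩, hlog, hDδ⟩ := hD
  have hD0 : (0 : ℝ) < D := by exact_mod_cast (by lia : 0 < D)
  rw [← Real.le_log_iff_exp_le hD0] at hlog
  obtain ⟨K, x₁, h₁⟩ := exists_sum_charWeight_mul_le_of_lt hD4 hcD hu hue hlog
  obtain ⟨x₂, h₂⟩ := exists_sum_norm_primeCharSum_sq_le hD4 hu hue
  obtain ⟨x₃, h₃⟩ := exists_sum_norm_primeLogCharSum_pow_sq_le hD4 hu hue
  obtain ⟨C₄, hC₄, h₄⟩ := exists_norm_primeLogCharSum_le D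
  obtain ⟨C₅, hC₅, h₅⟩ := exists_sum_primesIoc_pow_le
  set W := primorial D with hW
  set K₁ : ℝ := 3 * W * (101 * e * C₄) with hK₁
  refine ⟨max (max x₁ x₂) (max (max x₃ (D + 2)) (max ⌈max (Real.exp C₅) (Real.exp (3 * K₁ / δ))⌉₊
    ⌈9 * K * k₂ / δ ^ 2⌉₊)), fun x y hx hxy 𝒢 h𝒢 => ?_⟩
  simp only [max_le_iff, Nat.ceil_le] at hx
  obtain ⟨⟨hx1, hx2⟩, ⟨hx3, hxD⟩, ⟨hx5, hx6⟩, hx7⟩ := hx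
  have hxy' : x ≤ y := by rw [hxy]; exact Nat.le_self_pow (by lia) x
  have hxy'' : (x : ℝ) ≤ y := by exact_mod_cast hxy'
  have hx0 : (0 : ℝ) < x := by exact_mod_cast (by lia : 0 < x)
  have hy0 : (0 : ℝ) < y := hx0.trans_le hxy''
  have hyT : y ≤ y ^ u := Nat.le_self_pow (by lia) y
  set N := y ^ (100 * e) with hN
  have hTN : y ^ u ≤ N := Nat.pow_le_pow_right (by lia) (by lia)
  have hyN : (y : ℝ) ≤ N := by exact_mod_cast hyT.trans hTN
  set L := Real.log (N : ℕ) with hL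
  have hlogy : Real.log y ≤ L := Real.log_le_log hy0 hyN
  have hL0 : 0 ≤ L := Real.log_natCast_nonneg _
  have hB := (h₅ y u e (by lia) ((Real.le_log_iff_exp_le hy0).2 (hx5.trans hxy'')) (by lia) (by lia)
    (by lia)).1
  have hLK : K₁ ≤ δ / 3 * L := by
    have := ((Real.le_log_iff_exp_le hy0).2 (hx6.trans hxy'')).trans hlogy
    rw [div_le_iff₀ hδ] at this
    linarith
  have hA2 : ∀ 𝓗 ⊆ 𝒢, ∑ χ ∈ 𝓗, ‖primeLogCharSum N (y ^ (200 * e)) χ‖ ^ 2 ≤ k₂ * L ^ 2 :=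
    fun 𝓗 h => h₃ y (by lia) 𝓗 fun χ hχ => (h𝒢 χ (h hχ)).2
  classical
  rw [← Finset.sum_filter_add_sum_filter_not 𝒢 fun χ => charSupport χ = ∅,
    ← Finset.sum_filter_add_sum_filter_not (𝒢.filter fun χ => ¬charSupport χ = ∅)
      fun χ => charCond χ ≤ y]
  have hS1 : ∑ χ ∈ 𝒢.filter (fun χ => charSupport χ = ∅), charWeight c χ *
      ‖primeCharSum (y ^ u) N χ‖ * ‖primeLogCharSum N (y ^ (200 * e)) χ‖ ≤ K₁ := by
    have hcard := card_charCond_le (D := D) (T := y ^ u) (by lia)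
      (𝒢.filter fun χ => charSupport χ = ∅) (Q := 1) fun χ hχ => by
        rw [charCond, (Finset.mem_filter.1 hχ).2]
        simp [setProd]
    rw [Nat.cast_one, one_pow, mul_one] at hcard
    refine (Finset.sum_le_card_nsmul _ _ (101 * e * C₄) fun χ hχ => ?_).trans ?_
    · obtain ⟨hχ1, hχ2⟩ := Finset.mem_filter.1 hχ
      have hw : charWeight c χ = 1 := by simp [charWeight, hχ2]
      rw [hw, one_mul]
      exact mul_le_mul ((norm_primeCharSum_le _ _ χ).trans hB) (h₄ (y ^ u) N (y ^ (200 * e))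
        (by lia) hTN (Nat.pow_le_pow_right (by lia) (by lia)) χ (h𝒢 χ hχ1).1 hχ2)
        (norm_nonneg _) (by positivity)
    · rw [nsmul_eq_mul, hK₁]
      gcongr
  have hS2 := sum_mul_mul_le_of_le ((𝒢.filter fun χ => ¬charSupport χ = ∅).filter
      fun χ => charCond χ ≤ y) (w := charWeight c) (a := fun χ => ‖primeCharSum (y ^ u) N χ‖)
      (b := fun χ => ‖primeLogCharSum N (y ^ (200 * e)) χ‖) (η := c / D) (by positivity)
      (fun χ hχ => charWeight_le_div (by linarith) (by lia) (by nlinarith)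
        (Finset.mem_filter.1 (Finset.mem_filter.1 hχ).1).2)
      (fun _ _ => norm_nonneg _) (fun _ _ => norm_nonneg _)
      (h₂ y (by lia) _ fun χ hχ => (Finset.mem_filter.1 hχ).2)
      (hA2 _ ((Finset.filter_subset _ _).trans (Finset.filter_subset _ _)))
  have hS3 := sum_mul_mul_le_of_le ((𝒢.filter fun χ => ¬charSupport χ = ∅).filter
      fun χ => ¬charCond χ ≤ y) (w := fun _ => 1)
      (a := fun χ => charWeight c χ * ‖primeCharSum (y ^ u) N χ‖)
      (b := fun χ => ‖primeLogCharSum N (y ^ (200 * e)) χ‖) (η := 1) zero_le_one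
      (fun χ hχ => le_rfl)
      (fun _ _ => mul_nonneg (charWeight_nonneg (by linarith) _) (norm_nonneg _))
      (fun _ _ => norm_nonneg _)
      (h₁ x y hx1 hxy _ fun χ hχ => ⟨not_le.1 (Finset.mem_filter.1 hχ).2,
        (h𝒢 χ (Finset.mem_filter.1 (Finset.mem_filter.1 hχ).1).1).2⟩)
      (hA2 _ ((Finset.filter_subset _ _).trans (Finset.filter_subset _ _)))
  simp only [one_mul] at hS3
  have hsq : √(k₂ * L ^ 2) = √k₂ * L := by
    rw [Real.sqrt_mul hk₂0, Real.sqrt_sq hL0]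
  rw [hsq] at hS2 hS3
  have e2 : c / D * (√k₁ * (√k₂ * L)) ≤ δ / 3 * L := by
    rw [div_le_iff₀ hδ] at hDδ
    have : c / D * (√k₁ * √k₂) ≤ δ / 3 := by
      rw [div_mul_eq_mul_div, div_le_iff₀ hD0]
      linarith
    calc c / D * (√k₁ * (√k₂ * L)) = c / D * (√k₁ * √k₂) * L := by ring
      _ ≤ _ := mul_le_mul_of_nonneg_right this hL0
  have e3 : √(K / x) * (√k₂ * L) ≤ δ / 3 * L := by
    have : √(K / x) * √k₂ ≤ δ / 3 := by
      rw [← Real.sqrt_mul' _ hk₂0]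
      refine Real.sqrt_le_iff.2 ⟨by positivity, ?_⟩
      rw [div_le_iff₀ (by positivity)] at hx7
      rw [div_mul_eq_mul_div, div_le_iff₀ hx0]
      linarith
    calc √(K / x) * (√k₂ * L) = √(K / x) * √k₂ * L := by ring
      _ ≤ _ := mul_le_mul_of_nonneg_right this hL0
  refine (add_le_add hS1 (add_le_add hS2 hS3)).trans ?_
  linarith

end Bilinear

section DyadicWeight

/-- A decreasing step function, comparable to `log y / log n` for `y ≤ n ≤ y ^ 2 ^ i`. -/
noncomputable def dyadicWeight (y i n : ℕ) : ℝ :=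
  ∑ l ∈ Finset.range (i + 1), (1 / 2 : ℝ) ^ l * if n ≤ y ^ 2 ^ l then 1 else 0

variable {y i : ℕ}

theorem dyadicWeight_nonneg (n : ℕ) : 0 ≤ dyadicWeight y i n :=
  Finset.sum_nonneg fun l _ => mul_nonneg (by positivity) (by split_ifs <;> norm_num)

theorem antitone_dyadicWeight : Antitone (dyadicWeight y i) := fun n n' h =>
  Finset.sum_le_sum fun l _ => mul_le_mul_of_nonneg_left
    (by
      by_cases hn' : n' ≤ y ^ 2 ^ l
      · rw [if_pos hn', if_pos (h.trans hn')]
      · rw [if_neg hn']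
        split_ifs <;> norm_num) (by positivity)

theorem one_le_dyadicWeight_one (hy : 0 < y) : 1 ≤ dyadicWeight y i 1 := by
  rw [dyadicWeight, Finset.sum_range_succ']
  have h : (1 : ℕ) ≤ y ^ 2 ^ 0 := by rw [pow_zero, pow_one]; exact hy
  rw [if_pos h]
  have : (0 : ℝ) ≤ ∑ l ∈ Finset.range i, (1 / 2 : ℝ) ^ (l + 1) *
      if 1 ≤ y ^ 2 ^ (l + 1) then 1 else 0 :=
    Finset.sum_nonneg fun l _ => mul_nonneg (by positivity) (by split_ifs <;> norm_num)
  linarith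

theorem sum_Ico_half_pow_le (m n : ℕ) :
    ∑ l ∈ Finset.Ico m n, (1 / 2 : ℝ) ^ l ≤ 2 * (1 / 2) ^ m := by
  refine (geom_sum_Ico_le_of_lt_one (by norm_num) (by norm_num)).trans (le_of_eq ?_)
  norm_num
  ring

theorem exists_dyadicWeight_le {n : ℕ} (h : dyadicWeight y i n ≠ 0) :
    ∃ m ≤ i, n ≤ y ^ 2 ^ m ∧ dyadicWeight y i n ≤ 2 * (1 / 2) ^ m := by
  have hex : ∃ m, n ≤ y ^ 2 ^ m := by
    by_contra! hne
    exact h (Finset.sum_eq_zero fun l _ => by rw [if_neg (not_le.2 (hne l)), mul_zero])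
  classical
  refine ⟨Nat.find hex, ?_, Nat.find_spec hex, ?_⟩
  · by_contra! hlt
    refine h (Finset.sum_eq_zero fun l hl => ?_)
    rw [if_neg (Nat.find_min hex (by rw [Finset.mem_range] at hl; lia)), mul_zero]
  · refine le_trans ?_ (sum_Ico_half_pow_le (Nat.find hex) (i + 1))
    rw [dyadicWeight, ← Finset.sum_filter_add_sum_filter_not (Finset.range (i + 1))
      fun l => Nat.find hex ≤ l]
    have h0 : ∑ l ∈ (Finset.range (i + 1)).filter (fun l => ¬Nat.find hex ≤ l),
        (1 / 2 : ℝ) ^ l * (if n ≤ y ^ 2 ^ l then (1 : ℝ) else 0) = 0 :=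
      Finset.sum_eq_zero fun l hl => by
        rw [if_neg (Nat.find_min hex (not_le.1 (Finset.mem_filter.1 hl).2)), mul_zero]
    rw [h0, add_zero]
    refine (Finset.sum_le_sum fun l _ => mul_le_of_le_one_right (by positivity)
      (by split_ifs <;> norm_num)).trans (Finset.sum_le_sum_of_subset_of_nonneg (fun l hl => ?_)
        fun _ _ _ => by positivity)
    rw [Finset.mem_filter, Finset.mem_range] at hl
    exact Finset.mem_Ico.2 ⟨hl.2, hl.1⟩

theorem dyadicWeight_le_two (n : ℕ) : dyadicWeight y i n ≤ 2 := by
  by_cases h : dyadicWeight y i n = 0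
  · rw [h]; norm_num
  · obtain ⟨m, -, -, hm⟩ := exists_dyadicWeight_le h
    refine hm.trans (mul_le_of_le_one_right (by norm_num) (pow_le_one₀ (by norm_num) (by norm_num)))

theorem dyadicWeight_sq_le (n : ℕ) : dyadicWeight y i n * dyadicWeight y i n
    ≤ 4 * ∑ l ∈ Finset.range (i + 1), (1 / 4 : ℝ) ^ l * if n ≤ y ^ 2 ^ l then 1 else 0 := by
  have hnn : ∀ l ∈ Finset.range (i + 1),
      (0 : ℝ) ≤ (1 / 4 : ℝ) ^ l * if n ≤ y ^ 2 ^ l then 1 else 0 :=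
    fun l _ => mul_nonneg (by positivity) (by split_ifs <;> norm_num)
  by_cases h : dyadicWeight y i n = 0
  · rw [h, zero_mul]
    exact mul_nonneg (by norm_num) (Finset.sum_nonneg hnn)
  · obtain ⟨m, hmi, hm, hle⟩ := exists_dyadicWeight_le h
    have h1 := Finset.single_le_sum hnn (Finset.mem_range.2 (by lia : m < i + 1))
    rw [if_pos hm, mul_one] at h1
    calc dyadicWeight y i n * dyadicWeight y i n ≤ (2 * (1 / 2) ^ m) * (2 * (1 / 2) ^ m) :=
          mul_le_mul hle hle (dyadicWeight_nonneg n) (by positivity)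
      _ = 4 * (1 / 4 : ℝ) ^ m := by
          rw [show (1 / 4 : ℝ) = (1 / 2) * (1 / 2) by norm_num, mul_pow]
          ring
      _ ≤ _ := mul_le_mul_of_nonneg_left h1 (by norm_num)

theorem dyadicWeight_mul_log_le {n : ℕ} (hn : 0 < n) :
    dyadicWeight y i n * Real.log n ≤ 2 * Real.log y := by
  have hL : 0 ≤ Real.log y := Real.log_natCast_nonneg y
  by_cases h : dyadicWeight y i n = 0
  · rw [h, zero_mul]
    positivity
  · obtain ⟨m, -, hm, hle⟩ := exists_dyadicWeight_le h
    have h1 : Real.log n ≤ 2 ^ m * Real.log y := by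
      have := Real.log_le_log (by exact_mod_cast hn) (by exact_mod_cast hm :
        (n : ℝ) ≤ (y : ℝ) ^ 2 ^ m)
      rw [Real.log_pow] at this
      exact_mod_cast this
    calc dyadicWeight y i n * Real.log n ≤ 2 * (1 / 2) ^ m * (2 ^ m * Real.log y) :=
          mul_le_mul hle h1 (Real.log_natCast_nonneg n) (by positivity)
      _ = 2 * Real.log y * ((1 / 2) * 2) ^ m := by rw [mul_pow]; ring
      _ = _ := by norm_num

theorem dyadicWeight_eq_zero (hy : 0 < y) {n : ℕ} (hn : y ^ 2 ^ i < n) :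
    dyadicWeight y i n = 0 :=
  Finset.sum_eq_zero fun l hl => by
    have : y ^ 2 ^ l ≤ y ^ 2 ^ i := Nat.pow_le_pow_right hy
      (Nat.pow_le_pow_right two_pos (by rw [Finset.mem_range] at hl; lia))
    rw [if_neg (by lia), mul_zero]

theorem setSum_mono {ι : Type*} [Fintype ι] [DecidableEq ι] {P : ι → ℕ} (hP : ∀ i, 0 < P i) {G G' : ℕ → ℝ}
    (h : ∀ n, 0 < n → G n ≤ G' n) : setSum P G ≤ setSum P G' :=
  Finset.sum_le_sum fun S _ => div_le_div_of_nonneg_right (h _ (setProd_pos hP S))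
    (Nat.cast_nonneg _)

theorem setSum_const_mul {ι : Type*} [Fintype ι] [DecidableEq ι] {P : ι → ℕ} (a : ℝ) (G : ℕ → ℝ) :
    setSum P (fun n => a * G n) = a * setSum P G := by
  rw [setSum, setSum, Finset.mul_sum]
  exact Finset.sum_congr rfl fun S _ => mul_div_assoc _ _ _

variable {D T : ℕ}

theorem setSum_sum_indicator {κ : Type*} (s : Finset κ) (a : κ → ℝ) (z : κ → ℕ) :
    setSum (fun j : primesIoc D T => sieveModulus D T (some j))
      (fun n => ∑ l ∈ s, a l * if n ≤ z l then 1 else 0) = ∑ l ∈ s, a l * smoothSum D T (z l) := by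
  simp only [smoothSum, setSum, Finset.sum_div, Finset.mul_sum]
  rw [Finset.sum_comm]
  exact Finset.sum_congr rfl fun l _ => Finset.sum_congr rfl fun S _ => mul_div_assoc _ _ _

theorem exists_setSum_dyadicWeight_bounds (D : ℕ) : ∃ y₀ : ℕ, ∀ y i : ℕ, y₀ ≤ y →
    ((i + 1) * (coprimeDensity D * Real.log y) ≤ 4 * setSum
      (fun j : primesIoc D (y ^ 2 ^ i) => sieveModulus D (y ^ 2 ^ i) (some j)) (dyadicWeight y i)) ∧
    (setSum (fun j : primesIoc D (y ^ 2 ^ i) => sieveModulus D (y ^ 2 ^ i) (some j))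
      (fun n => dyadicWeight y i n * dyadicWeight y i n)
        ≤ 16 * (coprimeDensity D * Real.log y)) ∧
    (setSum (fun j : primesIoc D (y ^ 2 ^ i) => sieveModulus D (y ^ 2 ^ i) (some j))
      (fun n => dyadicWeight y i n * dyadicWeight y i n * Real.log n)
        ≤ 16 * (i + 1) * Real.log y * setSum
          (fun j : primesIoc D (y ^ 2 ^ i) => sieveModulus D (y ^ 2 ^ i) (some j))
            (fun n => dyadicWeight y i n * dyadicWeight y i n)) ∧
    setSum (fun j : primesIoc D (y ^ 2 ^ i) => sieveModulus D (y ^ 2 ^ i) (some j))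
      (fun n => dyadicWeight y i n * Real.log n)
        ≤ 2 ^ i * Real.log y * setSum
          (fun j : primesIoc D (y ^ 2 ^ i) => sieveModulus D (y ^ 2 ^ i) (some j))
            (dyadicWeight y i) := by
  obtain ⟨z₀, hz₀, h⟩ := exists_smoothSum_bounds D
  refine ⟨z₀, fun y i hy => ?_⟩
  have hy0 : 0 < y := by lia
  set P := fun j : primesIoc D (y ^ 2 ^ i) => sieveModulus D (y ^ 2 ^ i) (some j) with hP
  have hP0 : ∀ j, 0 < P j := fun j => (sieveModulus_prime j).pos
  have hL : 0 ≤ Real.log y := Real.log_natCast_nonneg y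
  have hκ := coprimeDensity_pos D
  have hz : ∀ l, z₀ ≤ y ^ 2 ^ l := fun l => hy.trans (Nat.le_self_pow (by positivity) y)
  have hlog : ∀ l, Real.log (y ^ 2 ^ l : ℕ) = 2 ^ l * Real.log y := fun l => by
    push_cast
    rw [Real.log_pow]
    push_cast
    rfl
  have hpow : ∀ l : ℕ, (1 / 2 : ℝ) ^ l * 2 ^ l = 1 := fun l => by
    rw [← mul_pow]; norm_num
  have hb : setSum P (dyadicWeight y i)
      = ∑ l ∈ Finset.range (i + 1), (1 / 2 : ℝ) ^ l * smoothSum D (y ^ 2 ^ i) (y ^ 2 ^ l) :=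
    setSum_sum_indicator (Finset.range (i + 1)) (fun l => (1 / 2 : ℝ) ^ l) (fun l => y ^ 2 ^ l)
  have hble : setSum P (dyadicWeight y i) ≤ 2 * (i + 1) * (coprimeDensity D * Real.log y) := by
    rw [hb]
    calc _ ≤ ∑ l ∈ Finset.range (i + 1), 2 * (coprimeDensity D * Real.log y) := by
          refine Finset.sum_le_sum fun l _ => ?_
          have := (h (y ^ 2 ^ l) (y ^ 2 ^ i) (hz l)).1
          rw [hlog] at this
          calc _ ≤ (1 / 2 : ℝ) ^ l * (2 * (coprimeDensity D * (2 ^ l * Real.log y))) := by gcongr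
            _ = (1 / 2 : ℝ) ^ l * 2 ^ l * (2 * (coprimeDensity D * Real.log y)) := by ring
            _ = _ := by rw [hpow, one_mul]
      _ = _ := by
          rw [Finset.sum_const, Finset.card_range, nsmul_eq_mul]
          push_cast
          ring
  have hAge : coprimeDensity D * Real.log y
      ≤ 4 * setSum P (fun n => dyadicWeight y i n * dyadicWeight y i n) := by
    refine ((h y (y ^ 2 ^ i) hy).2 (Nat.le_self_pow (by positivity) y)).trans
      (mul_le_mul_of_nonneg_left (setSum_mono hP0 fun n hn => ?_) (by norm_num))
    split_ifs with hny
    · have h1 : 1 ≤ dyadicWeight y i n := by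
        rw [dyadicWeight, Finset.sum_range_succ', pow_zero, pow_zero, pow_one, if_pos hny]
        have : (0 : ℝ) ≤ ∑ l ∈ Finset.range i, (1 / 2 : ℝ) ^ (l + 1) *
            if n ≤ y ^ 2 ^ (l + 1) then 1 else 0 :=
          Finset.sum_nonneg fun l _ => mul_nonneg (by positivity) (by split_ifs <;> norm_num)
        linarith
      nlinarith
    · exact mul_nonneg (dyadicWeight_nonneg n) (dyadicWeight_nonneg n)
  refine ⟨?_, ?_, ?_, ?_⟩
  · rw [hb, Finset.mul_sum]
    calc (i + 1) * (coprimeDensity D * Real.log y)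
        = ∑ l ∈ Finset.range (i + 1), coprimeDensity D * Real.log y := by
          rw [Finset.sum_const, Finset.card_range, nsmul_eq_mul]
          push_cast
          ring
      _ ≤ _ := by
          refine Finset.sum_le_sum fun l hl => ?_
          have := (h (y ^ 2 ^ l) (y ^ 2 ^ i) (hz l)).2 (Nat.pow_le_pow_right hy0
            (Nat.pow_le_pow_right two_pos (by rw [Finset.mem_range] at hl; lia)))
          rw [hlog] at this
          calc coprimeDensity D * Real.log y
              = (1 / 2 : ℝ) ^ l * 2 ^ l * (coprimeDensity D * Real.log y) := by
                rw [hpow, one_mul]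
            _ = (1 / 2 : ℝ) ^ l * (coprimeDensity D * (2 ^ l * Real.log y)) := by ring
            _ ≤ (1 / 2 : ℝ) ^ l * (4 * smoothSum D (y ^ 2 ^ i) (y ^ 2 ^ l)) := by gcongr
            _ = _ := by ring
  · calc setSum P (fun n => dyadicWeight y i n * dyadicWeight y i n)
        ≤ setSum P (fun n => 4 * ∑ l ∈ Finset.range (i + 1), (1 / 4 : ℝ) ^ l *
            if n ≤ y ^ 2 ^ l then 1 else 0) :=
          setSum_mono hP0 fun n _ => dyadicWeight_sq_le n
      _ = 4 * ∑ l ∈ Finset.range (i + 1), (1 / 4 : ℝ) ^ l *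
            smoothSum D (y ^ 2 ^ i) (y ^ 2 ^ l) := by
          rw [setSum_const_mul]
          exact congrArg _ (setSum_sum_indicator (Finset.range (i + 1))
            (fun l => (1 / 4 : ℝ) ^ l) (fun l => y ^ 2 ^ l))
      _ ≤ 4 * ∑ l ∈ Finset.range (i + 1), (1 / 2 : ℝ) ^ l *
            (2 * (coprimeDensity D * Real.log y)) := by
          refine mul_le_mul_of_nonneg_left (Finset.sum_le_sum fun l _ => ?_) (by norm_num)
          have := (h (y ^ 2 ^ l) (y ^ 2 ^ i) (hz l)).1
          rw [hlog] at this
          calc _ ≤ (1 / 4 : ℝ) ^ l * (2 * (coprimeDensity D * (2 ^ l * Real.log y))) := by gcongr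
            _ = ((1 / 4 : ℝ) * 2) ^ l * (2 * (coprimeDensity D * Real.log y)) := by
                rw [mul_pow]; ring
            _ = _ := by norm_num
      _ ≤ 4 * (2 * (2 * (coprimeDensity D * Real.log y))) := by
          rw [← Finset.sum_mul]
          have := sum_Ico_half_pow_le 0 (i + 1)
          rw [← Finset.range_eq_Ico, pow_zero, mul_one] at this
          gcongr
      _ = _ := by ring
  · calc _ ≤ setSum P (fun n => 2 * Real.log y * dyadicWeight y i n) := by
          refine setSum_mono hP0 fun n hn => ?_
          have := dyadicWeight_mul_log_le (y := y) (i := i) hn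
          nlinarith [dyadicWeight_nonneg (y := y) (i := i) n]
      _ = 2 * Real.log y * setSum P (dyadicWeight y i) := setSum_const_mul _ _
      _ ≤ 2 * Real.log y * (2 * (i + 1) * (coprimeDensity D * Real.log y)) := by gcongr
      _ ≤ 2 * Real.log y * (2 * (i + 1) *
            (4 * setSum P (fun n => dyadicWeight y i n * dyadicWeight y i n))) := by gcongr
      _ = _ := by ring
  · rw [← setSum_const_mul]
    refine setSum_mono hP0 fun n hn => ?_
    by_cases hnT : n ≤ y ^ 2 ^ i
    · have h1 : Real.log n ≤ 2 ^ i * Real.log y := by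
        rw [← hlog]
        exact Real.log_le_log (by exact_mod_cast hn) (by exact_mod_cast hnT)
      rw [mul_comm]
      exact mul_le_mul_of_nonneg_right h1 (dyadicWeight_nonneg n)
    · rw [dyadicWeight_eq_zero hy0 (not_le.1 hnT)]
      simp

end DyadicWeight

section MainTerms

theorem exists_le_sum_primesIoc_one_div : ∃ M : ℕ, 1 < M ∧ ∀ T N i : ℕ, M ≤ T → T ^ 2 ^ i ≤ N →
    (i : ℝ) / 4 ≤ ∑ p ∈ primesIoc T N, 1 / (p : ℝ) := by
  obtain ⟨C, hC, h⟩ := exists_sum_primesIoc_one_div_le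
  refine ⟨⌈Real.exp (2 * C)⌉₊ + 2, by lia, fun T N i hT => ?_⟩
  have hT1 : 1 < T := by lia
  have hmono : ∀ {A B B' : ℕ}, B ≤ B' →
      ∑ p ∈ primesIoc A B, 1 / (p : ℝ) ≤ ∑ p ∈ primesIoc A B', 1 / (p : ℝ) := fun hB =>
    Finset.sum_le_sum_of_subset_of_nonneg (Finset.filter_subset_filter _
      (Finset.Ioc_subset_Ioc_right hB)) fun _ _ _ => by positivity
  induction i generalizing N with
  | zero =>
    intro _
    rw [Nat.cast_zero, zero_div]
    exact Finset.sum_nonneg fun _ _ => by positivity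
  | succ i ih =>
    intro hN
    set M := T ^ 2 ^ i with hM
    have hTM : T ≤ M := Nat.le_self_pow (by positivity) T
    have hMM : T ^ 2 ^ (i + 1) = M ^ 2 := by rw [hM, ← pow_mul, pow_succ]
    rw [hMM] at hN
    have hle : M ≤ M ^ 2 := Nat.le_self_pow two_ne_zero M
    refine le_trans ?_ (hmono hN)
    have hsplit : ∑ p ∈ primesIoc T (M ^ 2), 1 / (p : ℝ)
        = ∑ p ∈ primesIoc T M, 1 / (p : ℝ) + ∑ p ∈ primesIoc M (M ^ 2), 1 / (p : ℝ) := by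
      rw [primesIoc, ← Finset.Ioc_union_Ioc_eq_Ioc hTM hle, Finset.filter_union, Finset.sum_union]
      exact Finset.disjoint_filter_filter (Finset.Ioc_disjoint_Ioc_of_le le_rfl)
    rw [hsplit]
    have h1 := ih M le_rfl
    have h2 := (h M (M ^ 2) (by lia) hle).2
    have hlog : 2 * C ≤ Real.log M := by
      rw [Real.le_log_iff_exp_le (by exact_mod_cast (by lia : 0 < M))]
      exact (Nat.le_ceil _).trans (by exact_mod_cast (by lia))
    have h3 : (1 : ℝ) / 4 ≤ (Real.log (M ^ 2 : ℕ) - Real.log M - C) / Real.log (M ^ 2 : ℕ) := by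
      push_cast
      rw [Real.log_pow, le_div_iff₀ (by push_cast; linarith)]
      push_cast
      linarith
    push_cast
    linarith

theorem exists_le_sum_primesIoc_log_div : ∃ M : ℕ, 1 < M ∧ ∀ N : ℕ, M ≤ N →
    Real.log N / 2 ≤ ∑ p ∈ primesIoc N (N ^ 2), Real.log p / p := by
  obtain ⟨C, hC, h⟩ := exists_abs_sum_primesIoc_log_div_sub_le
  refine ⟨⌈Real.exp (2 * C)⌉₊ + 2, by lia, fun N hN => ?_⟩
  have hlog : 2 * C ≤ Real.log N := by
    rw [Real.le_log_iff_exp_le (by exact_mod_cast (by lia : 0 < N))]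
    exact (Nat.le_ceil _).trans (by exact_mod_cast (by lia))
  have := (abs_le.1 (h N (N ^ 2) (by lia) (Nat.le_self_pow two_ne_zero N))).1
  push_cast at this
  rw [Real.log_pow] at this
  push_cast at this
  linarith

variable {D T : ℕ}

theorem charProd_one {ι : Type*} [Fintype ι] {a : Option ι → ℕ} {n : ℕ}
    (hn : ∀ o, n.Coprime (a o)) : charProd (1 : CharFamily a) n = 1 :=
  Finset.prod_eq_one fun o _ =>
    MulChar.one_apply ((ZMod.isUnit_iff_coprime _ _).2 (hn o))

theorem primeCharSum_one (hDT : D ≤ T) {A : ℕ} (hTA : T ≤ A) (B : ℕ) :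
    primeCharSum A B (1 : CharFamily (sieveModulus D T))
      = ((∑ p ∈ primesIoc A B, 1 / (p : ℝ) : ℝ) : ℂ) := by
  rw [primeCharSum, Complex.ofReal_sum]
  refine Finset.sum_congr rfl fun p hp => ?_
  obtain ⟨hp1, hp2⟩ := Finset.mem_filter.1 hp
  rw [charProd_one fun o => coprime_sieveModulus hDT (fun q hq hqp => by
    rw [(Nat.prime_dvd_prime_iff_eq hq hp2).1 hqp]; exact hTA.trans_lt (Finset.mem_Ioc.1 hp1).1) o]
  simp

theorem primeLogCharSum_one (hDT : D ≤ T) {A : ℕ} (hTA : T ≤ A) (B : ℕ) :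
    primeLogCharSum A B (1 : CharFamily (sieveModulus D T))
      = ((∑ p ∈ primesIoc A B, Real.log p / p : ℝ) : ℂ) := by
  rw [primeLogCharSum, Complex.ofReal_sum]
  refine Finset.sum_congr rfl fun p hp => ?_
  obtain ⟨hp1, hp2⟩ := Finset.mem_filter.1 hp
  rw [charProd_one fun o => coprime_sieveModulus hDT (fun q hq hqp => by
    rw [(Nat.prime_dvd_prime_iff_eq hq hp2).1 hqp]; exact hTA.trans_lt (Finset.mem_Ioc.1 hp1).1) o,
    mul_one]

end MainTerms

section TupleWeight

variable {J : Type*} [Fintype J] [DecidableEq J]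

/-- The coefficients of the sieve weight, as a function of the tuple of entries. -/
noncomputable def tupleWeight (D y i e : ℕ) (s : primesIoc D (y ^ 2 ^ i) → Option J) : ℝ :=
  if tupleSize (fun j => sieveModulus D (y ^ 2 ^ i) (some j)) s ≤ y ^ e then
    ∏ j, dyadicWeight y i (tupleEntry (fun j => sieveModulus D (y ^ 2 ^ i) (some j)) s j) else 0

variable {D y i e : ℕ}

theorem prod_dyadicWeight_nonneg (s : primesIoc D (y ^ 2 ^ i) → Option J) :
    0 ≤ ∏ j, dyadicWeight y i (tupleEntry (fun j => sieveModulus D (y ^ 2 ^ i) (some j)) s j) :=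
  Finset.prod_nonneg fun _ _ => dyadicWeight_nonneg _

theorem tupleWeight_nonneg (s : primesIoc D (y ^ 2 ^ i) → Option J) :
    0 ≤ tupleWeight D y i e s := by
  rw [tupleWeight]
  split_ifs
  · exact prod_dyadicWeight_nonneg s
  · exact le_rfl

theorem tupleWeight_le (s : primesIoc D (y ^ 2 ^ i) → Option J) : tupleWeight D y i e s
    ≤ ∏ j, dyadicWeight y i (tupleEntry (fun j => sieveModulus D (y ^ 2 ^ i) (some j)) s j) := by
  rw [tupleWeight]
  split_ifs
  · exact le_rfl
  · exact prod_dyadicWeight_nonneg s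

theorem isDecr_tupleWeight : IsDecr none
    (tupleWeight D y i e : (primesIoc D (y ^ 2 ^ i) → Option J) → ℝ) := by
  have hP0 : ∀ j, 0 < sieveModulus D (y ^ 2 ^ i) (some j) := fun j => (sieveModulus_prime j).pos
  have h := IsDecr.mul (isDecr_size (J := J) hP0 (g := fun n => if n ≤ y ^ e then (1 : ℝ) else 0)
      fun n n' hn => by
        by_cases hn' : n' ≤ y ^ e
        · simp [hn', hn.trans hn']
        · simp only [if_neg hn']
          split_ifs <;> norm_num)
    (IsDecr.prod Finset.univ (fun j _ => isDecr_entry (J := J) hP0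
      (antitone_dyadicWeight (y := y) (i := i)) j) fun j _ s => dyadicWeight_nonneg _)
    (fun s => by split_ifs <;> norm_num)
    (fun s => Finset.prod_nonneg fun _ _ => dyadicWeight_nonneg _)
  intro s l o
  have := h s l o
  simp only [ite_mul, one_mul, zero_mul] at this
  exact this

theorem sum_tupleWeight_mul_tupleSize_le (hD : 0 < D) (hJ : Fintype.card J ≤ D) :
    ∑ s : primesIoc D (y ^ 2 ^ i) → Option J,
      tupleWeight D y i e s * tupleSize (fun j => sieveModulus D (y ^ 2 ^ i) (some j)) s
      ≤ 2 ^ Fintype.card J * (3 * (y : ℝ) ^ (3 * e)) := by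
  have h := sum_tupleSize_le (T := y ^ 2 ^ i) hD hJ (y ^ e)
  rw [Nat.cast_pow, ← pow_mul, mul_comm e] at h
  refine le_trans ?_ (mul_le_mul_of_nonneg_left h (by positivity))
  rw [Finset.mul_sum]
  refine Finset.sum_le_sum fun s _ => ?_
  by_cases hs : tupleSize (fun j => sieveModulus D (y ^ 2 ^ i) (some j)) s ≤ y ^ e
  · rw [if_pos hs]
    refine mul_le_mul_of_nonneg_right ((tupleWeight_le s).trans ?_) (Nat.cast_nonneg _)
    refine (Finset.prod_le_prod (fun _ _ => dyadicWeight_nonneg _)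
      fun _ _ => dyadicWeight_le_two _).trans (le_of_eq ?_)
    rw [Finset.prod_const, Finset.card_univ]
  · rw [if_neg hs, tupleWeight, if_neg hs, zero_mul, mul_zero]

theorem sum_tupleWeight_sq_div_le :
    ∑ s : primesIoc D (y ^ 2 ^ i) → Option J, tupleWeight D y i e s ^ 2
        / tupleSize (fun j => sieveModulus D (y ^ 2 ^ i) (some j)) s
      ≤ setSum (fun j : primesIoc D (y ^ 2 ^ i) => sieveModulus D (y ^ 2 ^ i) (some j))
        (fun n => dyadicWeight y i n * dyadicWeight y i n) ^ Fintype.card J := by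
  have h := sum_prod_tupleEntry_div_le (J := J)
    (P := fun j : primesIoc D (y ^ 2 ^ i) => sieveModulus D (y ^ 2 ^ i) (some j))
    (G := fun _ n => dyadicWeight y i n * dyadicWeight y i n)
    fun _ n => mul_nonneg (dyadicWeight_nonneg n) (dyadicWeight_nonneg n)
  rw [Finset.prod_const, Finset.card_univ] at h
  refine le_trans (Finset.sum_le_sum fun s _ => div_le_div_of_nonneg_right ?_
    (Nat.cast_nonneg _)) h
  rw [Finset.prod_mul_distrib, sq]
  exact mul_le_mul (tupleWeight_le s) (tupleWeight_le s) (tupleWeight_nonneg s)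
    (prod_dyadicWeight_nonneg s)

theorem one_le_setSum_dyadicWeight_sq (hy : 0 < y) :
    1 ≤ setSum (fun j : primesIoc D (y ^ 2 ^ i) => sieveModulus D (y ^ 2 ^ i) (some j))
      (fun n => dyadicWeight y i n * dyadicWeight y i n) := by
  refine le_trans ?_ (le_setSum fun n => mul_nonneg (dyadicWeight_nonneg n)
    (dyadicWeight_nonneg n))
  nlinarith [one_le_dyadicWeight_one (i := i) hy]

theorem zmodMean_indicator {q : ℕ} [NeZero q] (v : ZMod q) :
    zmodMean (fun x => if x = v then (1 : ℝ) else 0) = 1 / q := by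
  simp [zmodMean]

/-- The sum of the squared sieve weights over a residue class. -/
theorem exists_sum_sieveWeight_sq_le (he : 0 < e)
    (hJ : 2 * (Fintype.card J + 1) ^ 2 ≤ D) :
    ∃ y₀ : ℕ, ∀ y : ℕ, y₀ ≤ y →
      ∀ c : ∀ j : primesIoc D (y ^ 2 ^ i), J → ZMod (sieveModulus D (y ^ 2 ^ i) (some j)),
      (∀ j, Function.Injective (c j)) → ∀ v : ZMod (sieveModulus D (y ^ 2 ^ i) none),
      ∑ n ∈ Finset.Ioc (y ^ (100 * e)) ((y ^ (100 * e)) ^ 3), 1 / (n : ℝ) *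
          ((if (n : ZMod (sieveModulus D (y ^ 2 ^ i) none)) = v then (1 : ℝ) else 0) *
            sieveWeight c (tupleWeight D y i e) (fun _ => n) ^ 2)
        ≤ 9 * Real.log (y ^ (100 * e) : ℕ) / primorial D *
          setSum (fun j : primesIoc D (y ^ 2 ^ i) => sieveModulus D (y ^ 2 ^ i) (some j))
            (fun n => dyadicWeight y i n * dyadicWeight y i n) ^ Fintype.card J := by
  set k := Fintype.card J with hk
  refine ⟨max (36 * primorial D ^ 2 * 4 ^ k) 8, fun y hy c hc v => ?_⟩
  simp only [max_le_iff] at hy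
  obtain ⟨hy1, hy2⟩ := hy
  have hW0 : 0 < primorial D := primorial_pos D
  have hD0 : 0 < D := by nlinarith
  set N := y ^ (100 * e) with hN
  set A := setSum (fun j : primesIoc D (y ^ 2 ^ i) => sieveModulus D (y ^ 2 ^ i) (some j))
            (fun n => dyadicWeight y i n * dyadicWeight y i n) with hA
  have hA1 : 1 ≤ A := one_le_setSum_dyadicWeight_sq (by lia)
  have hAk : 1 ≤ A ^ k := one_le_pow₀ hA1
  have hyN : y ≤ N := Nat.le_self_pow (by lia) y
  have hN8 : 8 ≤ N := by lia
  set L := Real.log (N : ℕ) with hL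
  have hL1 : 2 ≤ L := by
    rw [hL, Real.le_log_iff_exp_le (by exact_mod_cast (by lia : 0 < N))]
    have h8 : Real.exp 2 ≤ 8 := by
      have := Real.exp_one_lt_d9
      rw [show (2 : ℝ) = 1 + 1 by norm_num, Real.exp_add]
      nlinarith [Real.exp_pos 1]
    exact h8.trans (by exact_mod_cast hN8)
  have h := sum_inv_mul_sieveWeight_sq_le (pairwise_coprime_sieveModulus (D := D) (T := y ^ 2 ^ i))
    (fun j => (sieveModulus_prime j).one_lt) hc (tupleWeight_nonneg (e := e)) isDecr_tupleWeight
    (f := fun x => if x = v then (1 : ℝ) else 0) (fun x => by split_ifs <;> norm_num)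
    (fun x => by split_ifs <;> norm_num) N (N ^ 3)
  refine h.trans ?_
  rw [zmodMean_indicator]
  change _ * (1 / ((primorial D : ℕ) : ℝ)) * _ + 4 * ((primorial D : ℕ) : ℝ) * _ / _ ≤ _
  have hsum : ∑ n ∈ Finset.Ioc N (N ^ 3), 1 / (n : ℝ) ≤ 4 * L := by
    refine (Finset.sum_le_sum_of_subset_of_nonneg (Finset.Ioc_subset_Ioc_left (Nat.zero_le _))
      fun _ _ _ => by positivity).trans ((sum_Ioc_one_div_le _).trans ?_)
    rw [Nat.cast_pow, Real.log_pow]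
    push_cast
    linarith
  have hprod : ∏ j : primesIoc D (y ^ 2 ^ i), (1 + ((k : ℝ) + 1) ^ 2 *
      (1 / (sieveModulus D (y ^ 2 ^ i) (some j) : ℝ)) ^ 2) ≤ 2 := by
    refine (prod_one_add_sieveModulus_sq_le hD0 (by positivity)).trans ?_
    have h1 : ((k : ℝ) + 1) ^ 2 / D ≤ 1 / 2 := by
      rw [div_le_iff₀ (by exact_mod_cast hD0)]
      have : (2 : ℝ) * ((k : ℝ) + 1) ^ 2 ≤ D := by exact_mod_cast hJ
      linarith
    refine (Real.exp_le_exp.2 h1).trans ?_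
    have h2 := Real.add_one_le_exp (-(1 / 2) : ℝ)
    rw [Real.exp_neg] at h2
    have h3 := Real.exp_pos (1 / 2)
    have h4 : (1 : ℝ) / 2 * Real.exp (1 / 2) ≤ 1 := by
      calc (1 : ℝ) / 2 * Real.exp (1 / 2) ≤ (Real.exp (1 / 2))⁻¹ * Real.exp (1 / 2) :=
            mul_le_mul_of_nonneg_right (by linarith) h3.le
        _ = 1 := inv_mul_cancel₀ h3.ne'
    linarith
  have hsq := sum_tupleWeight_sq_div_le (J := J) (D := D) (y := y) (i := i) (e := e)
  have hsize := sum_tupleWeight_mul_tupleSize_le (J := J) (y := y) (i := i) (e := e) hD0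
    (by nlinarith : Fintype.card J ≤ D)
  have hsize0 : 0 ≤ ∑ s : primesIoc D (y ^ 2 ^ i) → Option J, tupleWeight D y i e s *
      tupleSize (fun j => sieveModulus D (y ^ 2 ^ i) (some j)) s :=
    Finset.sum_nonneg fun s _ => mul_nonneg (tupleWeight_nonneg s) (Nat.cast_nonneg _)
  have hW' : (0 : ℝ) < (primorial D : ℕ) := by exact_mod_cast hW0
  have hy' : (1 : ℝ) ≤ y := by exact_mod_cast (by lia : 1 ≤ y)
  have herr : 4 * ((primorial D : ℕ) : ℝ) * (∑ s : primesIoc D (y ^ 2 ^ i) → Option J,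
      tupleWeight D y i e s * tupleSize (fun j => sieveModulus D (y ^ 2 ^ i) (some j)) s) ^ 2 /
        ((N : ℝ) + 1) ≤ 1 / (primorial D : ℕ) := by
    rw [div_le_div_iff₀ (by positivity) hW']
    have e1 : (36 : ℝ) * (primorial D : ℕ) ^ 2 * 4 ^ k ≤ y := by exact_mod_cast hy1
    have e2 : (y : ℝ) * (y : ℝ) ^ (6 * e) ≤ N := by
      rw [hN, Nat.cast_pow, ← pow_succ']
      exact pow_le_pow_right₀ hy' (by lia)
    calc 4 * ((primorial D : ℕ) : ℝ) * (∑ s : primesIoc D (y ^ 2 ^ i) → Option J,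
          tupleWeight D y i e s * tupleSize (fun j => sieveModulus D (y ^ 2 ^ i) (some j)) s) ^ 2 *
            (primorial D : ℕ)
        ≤ 4 * ((primorial D : ℕ) : ℝ) * (2 ^ k * (3 * (y : ℝ) ^ (3 * e))) ^ 2 *
          (primorial D : ℕ) := by
          refine mul_le_mul_of_nonneg_right (mul_le_mul_of_nonneg_left
            (pow_le_pow_left₀ hsize0 hsize 2) (by positivity)) hW'.le
      _ = 36 * (primorial D : ℕ) ^ 2 * 4 ^ k * (y : ℝ) ^ (6 * e) := by
          rw [show (4 : ℝ) = 2 * 2 by norm_num, mul_pow 2 2 k]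
          ring
      _ ≤ (y : ℝ) * (y : ℝ) ^ (6 * e) := mul_le_mul_of_nonneg_right e1 (by positivity)
      _ ≤ 1 * ((N : ℝ) + 1) := by linarith
  have hsq0 : 0 ≤ ∑ s : primesIoc D (y ^ 2 ^ i) → Option J, tupleWeight D y i e s ^ 2
        / tupleSize (fun j => sieveModulus D (y ^ 2 ^ i) (some j)) s :=
    Finset.sum_nonneg fun s _ => by positivity
  have hmain := mul_le_mul (mul_le_mul_of_nonneg_right hsum
    (by positivity : (0 : ℝ) ≤ 1 / (primorial D : ℕ))) (mul_le_mul hprod hsq hsq0 (by norm_num))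
    (mul_nonneg (Finset.prod_nonneg fun _ _ => by positivity) hsq0) (by positivity)
  refine (add_le_add hmain herr).trans ?_
  have e3 : (1 : ℝ) / (primorial D : ℕ) ≤ L / (primorial D : ℕ) * A ^ k := by
    calc (1 : ℝ) / (primorial D : ℕ) ≤ L / (primorial D : ℕ) :=
          div_le_div_of_nonneg_right (by linarith) hW'.le
      _ ≤ _ := le_mul_of_one_le_right (by positivity) hAk
  calc 4 * L * (1 / ((primorial D : ℕ) : ℝ)) * (2 * A ^ k) + 1 / ((primorial D : ℕ) : ℝ)
      ≤ 4 * L * (1 / ((primorial D : ℕ) : ℝ)) * (2 * A ^ k)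
        + L / (primorial D : ℕ) * A ^ k := add_le_add le_rfl e3
    _ = _ := by ring

end TupleWeight

section PrimePairs

variable {J : Type*} [Fintype J] [DecidableEq J] {D T : ℕ}

/-- The Fourier expansion of the sum of squared sieve weights over products of two primes. -/
theorem sum_primePairs_eq (hDT : D ≤ T) {N : ℕ} (hTN : T ≤ N) (M : ℕ)
    (c : ∀ j : primesIoc D T, J → ZMod (sieveModulus D T (some j)))
    (β : ZMod (sieveModulus D T none)) (w : (primesIoc D T → Option J) → ℝ) :
    ((∑ p ∈ primesIoc T N, ∑ q ∈ primesIoc N M, 1 / (p : ℝ) * (Real.log q / q) *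
        ((if ((p * q : ℕ) : ZMod (sieveModulus D T none)) = β then (1 : ℝ) else 0) *
          sieveWeight c w (fun _ => (p * q : ℕ)) ^ 2) : ℝ) : ℂ)
      = ∑ χ, formCoeff c β w χ * (primeCharSum T N χ * primeLogCharSum N M χ) := by
  have hp : ∀ p ∈ primesIoc T N, ∀ q ∈ primesIoc N M, ∀ o, (p * q).Coprime (sieveModulus D T o) := by
    intro p hp q hq o
    obtain ⟨hp1, hp2⟩ := Finset.mem_filter.1 hp
    obtain ⟨hq1, hq2⟩ := Finset.mem_filter.1 hq
    rw [Finset.mem_Ioc] at hp1 hq1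
    refine coprime_sieveModulus hDT (fun r hr hrd => ?_) o
    rcases (hr.dvd_mul).1 hrd with h | h
    · rw [(Nat.prime_dvd_prime_iff_eq hr hp2).1 h]; exact hp1.1
    · rw [(Nat.prime_dvd_prime_iff_eq hr hq2).1 h]; exact hTN.trans_lt hq1.1
  have hR : ∀ χ : CharFamily (sieveModulus D T),
      formCoeff c β w χ * (primeCharSum T N χ * primeLogCharSum N M χ)
        = ∑ p ∈ primesIoc T N, ∑ q ∈ primesIoc N M, formCoeff c β w χ *
          (1 / (p : ℂ) * charProd χ p * ((Real.log q / q : ℝ) * charProd χ q)) := fun χ => by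
    rw [primeCharSum, primeLogCharSum, Finset.sum_mul_sum, Finset.mul_sum]
    exact Finset.sum_congr rfl fun p _ => by rw [Finset.mul_sum]
  rw [Finset.sum_congr rfl fun χ _ => hR χ,
    Finset.sum_comm (s := (Finset.univ : Finset (CharFamily (sieveModulus D T)))),
    Complex.ofReal_sum]
  refine Finset.sum_congr rfl fun p hp' => ?_
  rw [Finset.sum_comm (s := (Finset.univ : Finset (CharFamily (sieveModulus D T)))),
    Complex.ofReal_sum]
  refine Finset.sum_congr rfl fun q hq' => ?_
  rw [Complex.ofReal_mul, ← sum_formCoeff_mul_charProd (hp p hp' q hq'), Finset.mul_sum]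
  refine Finset.sum_congr rfl fun χ _ => ?_
  rw [charProd_mul]
  push_cast
  ring

theorem prod_one_add_le_three_halves (hD : 0 < D) {k : ℕ} (hk : 8 * (k + 1) ^ 2 ≤ D) :
    ∏ i : primesIoc D T, (1 + 2 * ((k : ℝ) + 1) ^ 2 *
      (1 / (sieveModulus D T (some i) : ℝ)) ^ 2) ≤ 3 / 2 := by
  refine (prod_one_add_sieveModulus_sq_le hD (by positivity)).trans ?_
  have h1 : 2 * ((k : ℝ) + 1) ^ 2 / D ≤ 1 / 4 := by
    rw [div_le_iff₀ (by exact_mod_cast hD)]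
    have : (8 : ℝ) * ((k : ℝ) + 1) ^ 2 ≤ D := by exact_mod_cast hk
    linarith
  refine (Real.exp_le_exp.2 h1).trans ?_
  have h2 := Real.add_one_le_exp (-(1 / 4) : ℝ)
  rw [Real.exp_neg] at h2
  have h3 := Real.exp_pos (1 / 4)
  have h4 : (3 : ℝ) / 4 * Real.exp (1 / 4) ≤ 1 := by
    calc (3 : ℝ) / 4 * Real.exp (1 / 4) ≤ (Real.exp (1 / 4))⁻¹ * Real.exp (1 / 4) :=
          mul_le_mul_of_nonneg_right (by linarith) h3.le
      _ = 1 := inv_mul_cancel₀ h3.ne'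
  linarith

theorem norm_formCoeff_le_charWeight (hD : 2 ≤ D)
    (hJ : 8 * (Fintype.card J + 1) ^ 2 ≤ D)
    {c : ∀ j : primesIoc D T, J → ZMod (sieveModulus D T (some j))}
    (hc : ∀ i, Function.Injective (c i)) {m : J} (hm : ∀ i, c i m = 0)
    {β : ZMod (sieveModulus D T none)} (hβ : IsUnit β)
    {w : (primesIoc D T → Option J) → ℝ}
    {g : ℕ → ℝ} (hg0 : ∀ n, 0 ≤ g n) (hg : Antitone g) (hw0 : ∀ s, 0 ≤ w s)
    (hw : ∀ s, w s ≤ ∏ j, g (tupleEntry (fun i => sieveModulus D T (some i)) s j))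
    (χ : CharFamily (sieveModulus D T)) :
    ‖formCoeff c β w χ‖ ≤ 3 / 2 * (setSum (fun i : primesIoc D T => sieveModulus D T (some i)) g ^ 2
          * setSum (fun i : primesIoc D T => sieveModulus D T (some i)) (fun n => g n * g n)
            ^ (Fintype.card J - 1) / (primorial D).totient) *
        charWeight (4 * ((Fintype.card J : ℝ) + 1) ^ 2) χ := by
  have h := norm_formCoeff_le (a := sieveModulus D T) sieveModulus_prime
    (fun i => by have := lt_sieveModulus i; lia) hc hm hβ hg0 hg hw0 hw χ
  refine h.trans ?_
  set k : ℝ := (Fintype.card J : ℝ) with hk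
  set X := setSum (fun i : primesIoc D T => sieveModulus D T (some i)) g ^ 2
          * setSum (fun i : primesIoc D T => sieveModulus D T (some i)) (fun n => g n * g n)
            ^ (Fintype.card J - 1) with hX
  have hX0 : 0 ≤ X := mul_nonneg (sq_nonneg _) (pow_nonneg (setSum_nonneg fun n =>
    mul_nonneg (hg0 n) (hg0 n)) _)
  have hD0 : (0 : ℝ) < D := by exact_mod_cast (by lia : 0 < D)
  have hle : (∏ i : primesIoc D T, if i ∈ charSupport χ then
      4 * (k + 1) ^ 2 * (1 / (sieveModulus D T (some i) : ℝ))
        else 1 + 2 * (k + 1) ^ 2 * (1 / (sieveModulus D T (some i) : ℝ)) ^ 2)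
      ≤ charWeight (4 * (k + 1) ^ 2) χ * (3 / 2) := by
    have h2 : ∏ i : primesIoc D T, (1 + 2 * (k + 1) ^ 2 *
        (1 / (sieveModulus D T (some i) : ℝ)) ^ 2) ≤ 3 / 2 :=
      prod_one_add_le_three_halves (by lia) hJ
    refine le_trans ?_ (mul_le_mul_of_nonneg_left h2 (charWeight_nonneg (by positivity) χ))
    rw [charWeight, ← Finset.prod_mul_distrib]
    refine Finset.prod_le_prod (fun i _ => by split_ifs <;> positivity) fun i _ => ?_
    have h3 : 0 ≤ 2 * (k + 1) ^ 2 * (1 / (sieveModulus D T (some i) : ℝ)) ^ 2 := by positivity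
    split_ifs
    · exact le_mul_of_one_le_right (by positivity) (by linarith)
    · rw [one_mul]
  calc 1 / ((sieveModulus D T none).totient : ℝ) * (_ * X)
      ≤ 1 / ((sieveModulus D T none).totient : ℝ) *
        (charWeight (4 * (k + 1) ^ 2) χ * (3 / 2) * X) :=
        mul_le_mul_of_nonneg_left (mul_le_mul_of_nonneg_right hle hX0) (by positivity)
    _ = 1 / ((primorial D).totient : ℝ) * (charWeight (4 * (k + 1) ^ 2) χ * (3 / 2) * X) := rfl
    _ = _ := by ring

end PrimePairs

section LowerBound

variable {J : Type*} [Fintype J] [DecidableEq J]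

theorem unitForm_error_le {k l i e : ℕ} {Y B D : ℝ} (hk : k = 4 ^ i) (hl : l = 2 ^ i)
    (he : e = 68 * 4 ^ i * (i + 1)) (hY : 0 < Y) (hB : B ≤ 1 / D) (hD : 8 * ((k : ℝ) + 1) ^ 2 ≤ D) :
    ((l : ℝ) * Y + k * (16 * (i + 1) * Y)) / (e * Y) + (k : ℝ) ^ 2 * B ≤ 1 / 2 := by
  have hk0 : (0 : ℝ) ≤ k := k.cast_nonneg
  have hi0 : (0 : ℝ) ≤ i := i.cast_nonneg
  have hk1 : (1 : ℝ) ≤ k := by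
    rw [hk]; exact_mod_cast Nat.one_le_pow _ _ (by norm_num)
  have hlk : (l : ℝ) ≤ k := by
    rw [hk, hl]; exact_mod_cast Nat.pow_le_pow_left (by norm_num) i
  have he' : (e : ℝ) = 68 * k * (i + 1) := by rw [he, hk]; push_cast; ring
  have hD0 : 0 < D := lt_of_lt_of_le (by positivity) hD
  have e1 : ((l : ℝ) * Y + k * (16 * (i + 1) * Y)) / (e * Y) ≤ 1 / 4 := by
    rw [he', div_le_iff₀ (by positivity)]
    have h5 : (l : ℝ) ≤ k * (i + 1) := hlk.trans (le_mul_of_one_le_right hk0 (by linarith))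
    have := mul_le_mul_of_nonneg_right h5 hY.le
    linarith
  have e2 : (k : ℝ) ^ 2 * B ≤ 1 / 4 := by
    refine (mul_le_mul_of_nonneg_left hB (sq_nonneg _)).trans ?_
    rw [mul_one_div, div_le_iff₀ hD0]
    have : (k : ℝ) ^ 2 ≤ (k + 1) ^ 2 := pow_le_pow_left₀ hk0 (by linarith) 2
    linarith
  linarith

theorem le_unitForm_tupleWeight {D y i e : ℕ} (hJ : Fintype.card J = 4 ^ i)
    (he : e = 68 * 4 ^ i * (i + 1)) (hy : 1 < y) (hD : 8 * (Fintype.card J + 1) ^ 2 ≤ D)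
    {c : ∀ j : primesIoc D (y ^ 2 ^ i), J → ZMod (sieveModulus D (y ^ 2 ^ i) (some j))}
    (hc : ∀ j, Function.Injective (c j)) {m : J} (hm : ∀ j, c j m = 0)
    (hlam : setSum (fun j : primesIoc D (y ^ 2 ^ i) => sieveModulus D (y ^ 2 ^ i) (some j))
        (fun n => dyadicWeight y i n * dyadicWeight y i n * Real.log n)
      ≤ 16 * (i + 1) * Real.log y *
        setSum (fun j : primesIoc D (y ^ 2 ^ i) => sieveModulus D (y ^ 2 ^ i) (some j))
          (fun n => dyadicWeight y i n * dyadicWeight y i n))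
    (hlam' : setSum (fun j : primesIoc D (y ^ 2 ^ i) => sieveModulus D (y ^ 2 ^ i) (some j))
        (fun n => dyadicWeight y i n * Real.log n)
      ≤ 2 ^ i * Real.log y *
        setSum (fun j : primesIoc D (y ^ 2 ^ i) => sieveModulus D (y ^ 2 ^ i) (some j))
          (dyadicWeight y i)) :
    setSum (fun j : primesIoc D (y ^ 2 ^ i) => sieveModulus D (y ^ 2 ^ i) (some j))
        (dyadicWeight y i) ^ 2 *
      setSum (fun j : primesIoc D (y ^ 2 ^ i) => sieveModulus D (y ^ 2 ^ i) (some j))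
        (fun n => dyadicWeight y i n * dyadicWeight y i n) ^ (Fintype.card J - 1) / 24
      ≤ unitForm c (tupleWeight D y i e) (tupleWeight D y i e) := by
  have hP3 : ∀ j : primesIoc D (y ^ 2 ^ i), 3 ≤ sieveModulus D (y ^ 2 ^ i) (some j) :=
    fun j => by have := lt_sieveModulus j; nlinarith
  have he0 : e ≠ 0 := by rw [he]; positivity
  have hlogy : 0 < Real.log y := Real.log_pos (by exact_mod_cast hy)
  have hnum := unitForm_error_le (i := i) hJ rfl he hlogy
    (sum_one_div_sieveModulus_sq_le (D := D) (T := y ^ 2 ^ i) (by nlinarith))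
    (by exact_mod_cast hD)
  have hlogR : Real.log (y ^ e : ℕ) = e * Real.log y := by rw [Nat.cast_pow, Real.log_pow]
  rw [← hlogR, Nat.cast_pow 2 i, Nat.cast_ofNat] at hnum
  exact le_unitForm_self (P := fun j : primesIoc D (y ^ 2 ^ i) => sieveModulus D (y ^ 2 ^ i) (some j))
    (R := y ^ e) (lam := 16 * (i + 1) * Real.log y)
    (lam' := 2 ^ i * Real.log y) sieveModulus_prime hP3 hc hm dyadicWeight_nonneg
    antitone_dyadicWeight (one_le_dyadicWeight_one (by lia)) (Nat.one_lt_pow he0 hy)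
    (by positivity) hlam hlam' hnum (prod_one_add_le_three_halves (by nlinarith) hD) fun s => rfl

set_option maxHeartbeats 1000000 in
theorem le_sum_primePairs {D T N M R : ℕ} (hDT : D ≤ T) (hTN : T ≤ N) (hD2 : 2 ≤ D)
    (hD : 8 * (Fintype.card J + 1) ^ 2 ≤ D)
    {c : ∀ j : primesIoc D T, J → ZMod (sieveModulus D T (some j))}
    (hc : ∀ i, Function.Injective (c i)) {m : J} (hm : ∀ i, c i m = 0)
    {β : ZMod (sieveModulus D T none)} (hβ : IsUnit β)
    {w : (primesIoc D T → Option J) → ℝ}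
    {g : ℕ → ℝ} (hg0 : ∀ n, 0 ≤ g n) (hg : Antitone g) (hw0 : ∀ s, 0 ≤ w s)
    (hw : ∀ s, w s ≤ ∏ j, g (tupleEntry (fun i => sieveModulus D T (some i)) s j))
    (hR : ∀ s, R < tupleSize (fun i => sieveModulus D T (some i)) s → w s = 0)
    (hform : setSum (fun i : primesIoc D T => sieveModulus D T (some i)) g ^ 2
          * setSum (fun i : primesIoc D T => sieveModulus D T (some i)) (fun n => g n * g n)
            ^ (Fintype.card J - 1) / 24 ≤ unitForm c w w)
    {a L : ℝ} (ha : 1 ≤ a) (ha' : a / 4 ≤ ∑ p ∈ primesIoc T N, 1 / (p : ℝ)) (hL0 : 0 ≤ L)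
    (hL : L / 2 ≤ ∑ p ∈ primesIoc N M, Real.log p / p)
    (herr : ∀ 𝒢 : Finset (CharFamily (sieveModulus D T)), (∀ χ ∈ 𝒢, χ ≠ 1 ∧ charCond χ ≤ R ^ 2) →
      ∑ χ ∈ 𝒢, charWeight (4 * ((Fintype.card J : ℝ) + 1) ^ 2) χ * ‖primeCharSum T N χ‖
        * ‖primeLogCharSum N M χ‖ ≤ 1 / 576 * L) :
    setSum (fun i : primesIoc D T => sieveModulus D T (some i)) g ^ 2
          * setSum (fun i : primesIoc D T => sieveModulus D T (some i)) (fun n => g n * g n)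
            ^ (Fintype.card J - 1) / (primorial D).totient * L * a / 384
      ≤ ∑ p ∈ primesIoc T N, ∑ q ∈ primesIoc N M, 1 / (p : ℝ) * (Real.log q / q) *
          ((if ((p * q : ℕ) : ZMod (sieveModulus D T none)) = β then (1 : ℝ) else 0) *
            sieveWeight c w (fun _ => (p * q : ℕ)) ^ 2) := by
  have hφ : (0 : ℝ) < ((primorial D).totient : ℕ) := by
    exact_mod_cast Nat.totient_pos.2 (primorial_pos D)
  have hSeq := sum_primePairs_eq hDT hTN M c β w
  generalize (∑ p ∈ primesIoc T N, ∑ q ∈ primesIoc N M, 1 / (p : ℝ) * (Real.log q / q) *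
      ((if ((p * q : ℕ) : ZMod (sieveModulus D T none)) = β then (1 : ℝ) else 0) *
        sieveWeight c w (fun _ => (p * q : ℕ)) ^ 2)) = S at hSeq ⊢
  have hnorm := norm_formCoeff_le_charWeight hD2 hD hc hm hβ hg0 hg hw0 hw
  have hX0 : 0 ≤ setSum (fun i : primesIoc D T => sieveModulus D T (some i)) g ^ 2
          * setSum (fun i : primesIoc D T => sieveModulus D T (some i)) (fun n => g n * g n)
            ^ (Fintype.card J - 1) := mul_nonneg (sq_nonneg _) (pow_nonneg (setSum_nonneg fun n =>
    mul_nonneg (hg0 n) (hg0 n)) _)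
  generalize (setSum (fun i : primesIoc D T => sieveModulus D T (some i)) g ^ 2
          * setSum (fun i : primesIoc D T => sieveModulus D T (some i)) (fun n => g n * g n)
            ^ (Fintype.card J - 1)) = X at hform hnorm hX0 ⊢
  classical
  set 𝒢 : Finset (CharFamily (sieveModulus D T)) :=
    Finset.univ.filter fun χ => χ ≠ 1 ∧ charCond χ ≤ R ^ 2 with h𝒢
  have hsplit : ∑ χ, formCoeff c β w χ * (primeCharSum T N χ * primeLogCharSum N M χ)
      = formCoeff c β w 1 * (primeCharSum T N (1 : CharFamily (sieveModulus D T)) *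
          primeLogCharSum N M (1 : CharFamily (sieveModulus D T)))
        + ∑ χ ∈ 𝒢, formCoeff c β w χ * (primeCharSum T N χ * primeLogCharSum N M χ) := by
    rw [← Finset.add_sum_erase _ _ (Finset.mem_univ (1 : CharFamily (sieveModulus D T)))]
    refine congrArg _ (Finset.sum_subset (fun χ hχ => ?_) fun χ hχ hχ' => ?_).symm
    · exact Finset.mem_erase.2 ⟨(Finset.mem_filter.1 hχ).2.1, Finset.mem_univ _⟩
    · have h1 : R ^ 2 < charCond χ := by
        by_contra! hle
        exact hχ' (Finset.mem_filter.2 ⟨Finset.mem_univ _, Finset.ne_of_mem_erase hχ, hle⟩)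
      rw [formCoeff_eq_zero (R := R) sieveModulus_prime hR h1, zero_mul]
  rw [hsplit, formCoeff_one hβ, primeCharSum_one hDT le_rfl, primeLogCharSum_one hDT hTN] at hSeq
  generalize (∑ p ∈ primesIoc T N, 1 / (p : ℝ)) = a₁ at ha' hSeq
  generalize (∑ p ∈ primesIoc N M, Real.log p / p) = a₂ at hL hSeq
  have herr' : ‖∑ χ ∈ 𝒢, formCoeff c β w χ * (primeCharSum T N χ * primeLogCharSum N M χ)‖
        ≤ 3 / 2 * (X / (primorial D).totient) * (1 / 576 * L) := by
    have h1 := herr 𝒢 fun χ hχ => (Finset.mem_filter.1 hχ).2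
    refine le_trans ?_ (mul_le_mul_of_nonneg_left h1 (by positivity))
    rw [Finset.mul_sum]
    refine norm_sum_le_of_le _ fun χ _ => ?_
    rw [norm_mul, norm_mul, ← mul_assoc, ← mul_assoc, ← mul_assoc]
    exact mul_le_mul_of_nonneg_right (mul_le_mul_of_nonneg_right (hnorm χ) (norm_nonneg _))
      (norm_nonneg _)
  have hre := congrArg Complex.re hSeq
  rw [Complex.add_re, Complex.ofReal_re, ← Complex.ofReal_mul, ← Complex.ofReal_mul,
    Complex.ofReal_re] at hre
  have hre2 := (abs_le.1 ((Complex.abs_re_le_norm _).trans herr')).1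
  have hmain : X / 24 / (primorial D).totient * (a / 4 * (L / 2))
      ≤ unitForm c w w / (sieveModulus D T none).totient * (a₁ * a₂) := by
    change _ ≤ unitForm c w w / ((primorial D).totient : ℕ) * (a₁ * a₂)
    have hi0 : (0 : ℝ) ≤ a / 4 := by positivity
    exact mul_le_mul (div_le_div_of_nonneg_right hform hφ.le)
      (mul_le_mul ha' hL (by positivity) (hi0.trans ha')) (by positivity)
      (div_nonneg ((by positivity : (0 : ℝ) ≤ X / 24).trans hform) hφ.le)
  have hXL : 0 ≤ X / (primorial D).totient * L := by positivity
  have e5 : X / 24 / (primorial D).totient * (a / 4 * (L / 2))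
      = X / (primorial D).totient * L * (a / 192) := by ring
  have e6 : 3 / 2 * (X / (primorial D).totient) * (1 / 576 * L)
      = X / (primorial D).totient * L * (1 / 384) := by ring
  have e7 : X / (primorial D).totient * L * a / 384
      = X / (primorial D).totient * L * (a / 384) := by ring
  have e8 : X / (primorial D).totient * L * (a / 384) + X / (primorial D).totient * L * (1 / 384)
      ≤ X / (primorial D).totient * L * (a / 192) := by
    rw [← mul_add]
    exact mul_le_mul_of_nonneg_left (by linarith) hXL
  rw [e5] at hmain
  rw [e6] at hre2
  rw [e7]
  linarith

/-- The lower bound for the sum of squared sieve weights over products of two primes. -/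
theorem exists_le_sum_primePairs {i e : ℕ} (hi : 4 ≤ i) (hJ : Fintype.card J = 4 ^ i)
    (he : e = 68 * 4 ^ i * (i + 1)) : ∃ D₁ : ℕ, ∀ D : ℕ, D₁ ≤ D → ∃ x₀ : ℕ, ∀ x y : ℕ, x₀ ≤ x →
      y = x ^ (4 * e) →
      ∀ c : ∀ j : primesIoc D (y ^ 2 ^ i), J → ZMod (sieveModulus D (y ^ 2 ^ i) (some j)),
      (∀ j, Function.Injective (c j)) → ∀ m : J, (∀ j, c j m = 0) →
      ∀ β : ZMod (sieveModulus D (y ^ 2 ^ i) none), IsUnit β →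
      setSum (fun j : primesIoc D (y ^ 2 ^ i) => sieveModulus D (y ^ 2 ^ i) (some j))
          (dyadicWeight y i) ^ 2 *
        setSum (fun j : primesIoc D (y ^ 2 ^ i) => sieveModulus D (y ^ 2 ^ i) (some j))
          (fun n => dyadicWeight y i n * dyadicWeight y i n) ^ (Fintype.card J - 1) /
          (primorial D).totient * Real.log (y ^ (100 * e) : ℕ) * i / 384
        ≤ ∑ p ∈ primesIoc (y ^ 2 ^ i) (y ^ (100 * e)),
            ∑ q ∈ primesIoc (y ^ (100 * e)) (y ^ (200 * e)), 1 / (p : ℝ) * (Real.log q / q) *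
              ((if ((p * q : ℕ) : ZMod (sieveModulus D (y ^ 2 ^ i) none)) = β then (1 : ℝ) else 0) *
                sieveWeight c (tupleWeight D y i e) (fun _ => (p * q : ℕ)) ^ 2) := by
  have hu : 16 ≤ 2 ^ i := le_trans (by norm_num : 16 ≤ 2 ^ 4) (Nat.pow_le_pow_right two_pos hi)
  have h24 : 2 ^ i ≤ 4 ^ i := Nat.pow_le_pow_left (by norm_num) i
  have he1 : 4 ^ i ≤ e := by rw [he]; nlinarith
  have hue : 2 ^ i ≤ e := h24.trans he1
  have he0 : 0 < e := by lia
  obtain ⟨D₁, hD₁⟩ := exists_sum_charWeight_mul_mul_le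
    (c := 4 * ((Fintype.card J : ℝ) + 1) ^ 2)
    (by nlinarith [(Nat.cast_nonneg (Fintype.card J) : (0 : ℝ) ≤ Fintype.card J)]) hu hue
    (δ := 1 / 576) (by norm_num)
  refine ⟨max D₁ (8 * (Fintype.card J + 1) ^ 2), fun D hD => ?_⟩
  simp only [max_le_iff] at hD
  obtain ⟨hD1, hD2⟩ := hD
  obtain ⟨x₁, hx₁⟩ := hD₁ D hD1
  obtain ⟨x₂, hx₂⟩ := exists_setSum_dyadicWeight_bounds D
  obtain ⟨x₃, hx₃1, hx₃⟩ := exists_le_sum_primesIoc_one_div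
  obtain ⟨x₄, hx₄1, hx₄⟩ := exists_le_sum_primesIoc_log_div
  refine ⟨max (max x₁ x₂) (max (max x₃ x₄) (D + 2)), fun x y hx hxy c hc m hm β hβ => ?_⟩
  simp only [max_le_iff] at hx
  obtain ⟨⟨hx1, hx2⟩, ⟨hx3, hx4⟩, hx5⟩ := hx
  have hxy' : x ≤ y := by rw [hxy]; exact Nat.le_self_pow (by lia) x
  have hy1 : 1 < y := by lia
  have hyT : y ≤ y ^ 2 ^ i := Nat.le_self_pow (by lia) y
  have hTN : y ^ 2 ^ i ≤ y ^ (100 * e) := Nat.pow_le_pow_right (by lia) (by lia)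
  have hyN : y ≤ y ^ (100 * e) := hyT.trans hTN
  have hN2 : y ^ (200 * e) = (y ^ (100 * e)) ^ 2 := by rw [← pow_mul]; congr 1; lia
  obtain ⟨-, -, hlam, hlam'⟩ := hx₂ y i (by lia)
  have hRe : (y ^ e) ^ 2 = y ^ (2 * e) := by rw [← pow_mul, mul_comm e]
  refine le_sum_primePairs (R := y ^ e) (by lia) hTN (by nlinarith) hD2 hc hm hβ
    dyadicWeight_nonneg antitone_dyadicWeight tupleWeight_nonneg tupleWeight_le
    (fun s hs => if_neg (not_le.2 hs)) (le_unitForm_tupleWeight hJ he hy1 hD2 hc hm hlam hlam')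
    (by exact_mod_cast (by lia : 1 ≤ i)) (hx₃ _ _ i (by lia) ?_) (Real.log_natCast_nonneg _) ?_
    fun 𝒢 h𝒢 => hx₁ x y hx1 hxy 𝒢 fun χ hχ => hRe ▸ h𝒢 χ hχ
  · rw [← pow_mul]
    refine Nat.pow_le_pow_right (by lia) ?_
    have h4i : 2 ^ i * 2 ^ i = 4 ^ i := by rw [← mul_pow]; norm_num
    lia
  · rw [hN2]
    exact hx₄ _ (by lia)

end LowerBound

section Pairs

open Classical in
/-- A number has at most one representation as a product of a prime up to `N` and a prime
above `N`. -/
theorem sum_primePairs_log_le (T N n : ℕ) :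
    ∑ p ∈ primesIoc T N, ∑ q ∈ primesIoc N (N ^ 2), (if p * q = n then Real.log q else 0)
      ≤ 2 * Real.log N * if IsE2 n then 1 else 0 := by
  by_cases h : ∃ p ∈ primesIoc T N, ∃ q ∈ primesIoc N (N ^ 2), p * q = n
  · obtain ⟨p, hp, q, hq, rfl⟩ := h
    obtain ⟨hp1, hp2⟩ := Finset.mem_filter.1 hp
    obtain ⟨hq1, hq2⟩ := Finset.mem_filter.1 hq
    rw [Finset.mem_Ioc] at hp1 hq1
    have hE : IsE2 (p * q) := ⟨p, q, hp2, hq2, by lia, rfl⟩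
    rw [Finset.sum_eq_single_of_mem p hp, Finset.sum_eq_single_of_mem q hq, if_pos rfl, if_pos hE,
      mul_one]
    · rw [← Nat.cast_ofNat (R := ℝ), ← Real.log_pow]
      refine Real.log_le_log (by exact_mod_cast hq2.pos) (by exact_mod_cast hq1.2)
    · intro r hr hrq
      refine if_neg fun h => hrq ?_
      exact Nat.eq_of_mul_eq_mul_left hp2.pos h
    · intro r hr hrp
      refine Finset.sum_eq_zero fun s hs => if_neg fun h => ?_
      obtain ⟨hr1, hr2⟩ := Finset.mem_filter.1 hr
      rw [Finset.mem_Ioc] at hr1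
      rcases hr2.dvd_mul.1 (Dvd.intro _ h) with h1 | h1
      · exact hrp ((Nat.prime_dvd_prime_iff_eq hr2 hp2).1 h1)
      · have := (Nat.prime_dvd_prime_iff_eq hr2 hq2).1 h1
        lia
  · rw [Finset.sum_eq_zero fun p hp => Finset.sum_eq_zero fun q hq =>
      if_neg fun hpq => h ⟨p, hp, q, hq, hpq⟩]
    have := Real.log_natCast_nonneg N
    split_ifs <;> positivity

theorem sum_primePairs_shift_le {T N h : ℕ} (hh : h ≤ N) {F G : ℕ → ℝ} (hF : ∀ n, 0 ≤ F n)
    (hG : ∀ n, G (n + h) = F n) :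
    ∑ p ∈ primesIoc T N, ∑ q ∈ primesIoc N (N ^ 2), 1 / (p : ℝ) * (Real.log q / q) * G (p * q)
      ≤ ∑ n ∈ Finset.Ioc N (N ^ 3), 1 / (n : ℝ) * F n *
          ∑ p ∈ primesIoc T N, ∑ q ∈ primesIoc N (N ^ 2),
            (if p * q = n + h then Real.log q else 0) := by
  simp only [Finset.mul_sum]
  rw [Finset.sum_comm (s := Finset.Ioc N (N ^ 3))]
  refine Finset.sum_le_sum fun p hp => ?_
  rw [Finset.sum_comm (s := Finset.Ioc N (N ^ 3))]
  refine Finset.sum_le_sum fun q hq => ?_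
  obtain ⟨hp1, hp2⟩ := Finset.mem_filter.1 hp
  obtain ⟨hq1, hq2⟩ := Finset.mem_filter.1 hq
  rw [Finset.mem_Ioc] at hp1 hq1
  have h2 := hp2.two_le
  have h3 : 2 * q ≤ p * q := Nat.mul_le_mul_right q h2
  have h4 : p * q ≤ N * N ^ 2 := Nat.mul_le_mul hp1.2 hq1.2
  obtain ⟨n, hn⟩ : ∃ n, p * q = n + h := ⟨p * q - h, by lia⟩
  have hnN : N < n := by lia
  have hn3 : n ≤ N ^ 3 := by
    have : N ^ 3 = N * N ^ 2 := by ring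
    lia
  have hlog : 0 ≤ Real.log q := Real.log_natCast_nonneg q
  refine le_trans ?_ (Finset.single_le_sum (fun n' _ => ?_) (Finset.mem_Ioc.2 ⟨hnN, hn3⟩))
  · rw [if_pos hn, hn, hG]
    have hn0 : (0 : ℝ) < n := by exact_mod_cast (by lia : 0 < n)
    have hpq : 1 / (p : ℝ) * (Real.log q / q) = 1 / ((p * q : ℕ) : ℝ) * Real.log q := by
      push_cast
      rw [one_div_mul_eq_div, div_div, one_div_mul_eq_div, mul_comm (q : ℝ)]
    have hle : 1 / ((p * q : ℕ) : ℝ) ≤ 1 / n :=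
      one_div_le_one_div_of_le hn0 (by exact_mod_cast (by lia : n ≤ p * q))
    rw [hpq]
    calc 1 / ((p * q : ℕ) : ℝ) * Real.log q * F n ≤ 1 / n * Real.log q * F n :=
          mul_le_mul_of_nonneg_right (mul_le_mul_of_nonneg_right hle hlog) (hF n)
      _ = 1 / n * F n * Real.log q := by ring
  · refine mul_nonneg (mul_nonneg (by positivity) (hF n')) ?_
    split_ifs
    · exact hlog
    · exact le_rfl

open Classical in
theorem sum_card_isE2_le {J : Type*} [Fintype J] {h : J → ℕ} (hinj : Function.Injective h) {H : ℕ}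
    (hH : ∀ j, h j ≤ H) {n ρ : ℕ} (hρ : ((Finset.Icc n (n + H)).filter IsE2).card ≤ ρ) :
    ∑ m, (if IsE2 (n + h m) then (1 : ℝ) else 0) ≤ ρ := by
  rw [Finset.sum_boole]
  refine le_trans ?_ (Nat.cast_le.2 hρ)
  refine Nat.cast_le.2 (Finset.card_le_card_of_injOn (fun m => n + h m) (fun m hm => ?_)
    fun m _ m' _ hmm => hinj (Nat.add_left_cancel hmm))
  have := hH m
  simp only [Finset.coe_filter, Set.mem_ofPred_eq, Finset.mem_univ, true_and] at hm
  simp only [Finset.coe_filter, Set.mem_ofPred_eq, Finset.mem_Icc]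
  exact ⟨⟨by lia, by lia⟩, hm⟩

open Classical in
/-- The sum over all shifts, if short intervals contain few `E₂`-numbers. -/
theorem sum_sum_primePairs_le {J : Type*} [Fintype J] {h : J → ℕ} (hinj : Function.Injective h)
    {H : ℕ} (hH : ∀ j, h j ≤ H) {n₀ ρ : ℕ}
    (hρ : ∀ n, n₀ ≤ n → ((Finset.Icc n (n + H)).filter IsE2).card ≤ ρ) {T N : ℕ}
    (hHN : H ≤ N) (hnN : n₀ ≤ N) {F : ℕ → ℝ} {G : J → ℕ → ℝ} (hF : ∀ n, 0 ≤ F n)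
    (hG : ∀ m n, G m (n + h m) = F n) :
    ∑ m, ∑ p ∈ primesIoc T N, ∑ q ∈ primesIoc N (N ^ 2),
        1 / (p : ℝ) * (Real.log q / q) * G m (p * q)
      ≤ 2 * Real.log N * ρ * ∑ n ∈ Finset.Ioc N (N ^ 3), 1 / (n : ℝ) * F n := by
  refine (Finset.sum_le_sum fun m _ =>
    sum_primePairs_shift_le ((hH m).trans hHN) hF (hG m)).trans ?_
  rw [Finset.sum_comm, Finset.mul_sum]
  refine Finset.sum_le_sum fun n hn => ?_
  rw [← Finset.mul_sum, mul_comm (2 * Real.log N * ρ)]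
  refine mul_le_mul_of_nonneg_left ?_ (mul_nonneg (by positivity) (hF n))
  refine (Finset.sum_le_sum fun m _ => sum_primePairs_log_le T N (n + h m)).trans ?_
  rw [← Finset.mul_sum]
  refine mul_le_mul_of_nonneg_left (sum_card_isE2_le hinj hH (hρ n ?_)) ?_
  · have := (Finset.mem_Ioc.1 hn).1
    lia
  · have := Real.log_natCast_nonneg N
    positivity

end Pairs

section Shift

variable {J : Type*}

theorem sieveFactor_add {p : ℕ} (c : J → ZMod p) (d : ZMod p) (o : Option J) (x : ZMod p) :
    sieveFactor (fun j => c j + d) o (x + d) = sieveFactor c o x := by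
  cases o <;> simp [sieveFactor]

theorem sieveWeight_add {ι : Type*} [Fintype ι] [DecidableEq ι] [Fintype J] {P : ι → ℕ}
    (c : ∀ i, J → ZMod (P i)) (d : ∀ i, ZMod (P i)) (w : (ι → Option J) → ℝ)
    (x : ∀ i, ZMod (P i)) :
    sieveWeight (fun i j => c i j + d i) w (fun i => x i + d i) = sieveWeight c w x := by
  simp only [sieveWeight, sieveFactor_add]

theorem injective_neg_natCast {h : J → ℕ} (hinj : Function.Injective h) {H p : ℕ}
    (hH : ∀ j, h j ≤ H) (hp : H < p) : Function.Injective fun j => -(h j : ZMod p) := by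
  intro j j' hjj
  have h1 := (ZMod.natCast_eq_natCast_iff' _ _ _).1 (neg_injective hjj)
  rw [Nat.mod_eq_of_lt ((hH j).trans_lt hp), Nat.mod_eq_of_lt ((hH j').trans_lt hp)] at h1
  exact hinj h1

theorem exists_add_coprime_primorial {h : J → ℕ}
    (hadm : ∀ p : ℕ, p.Prime → ∃ v, ∀ j, ¬ p ∣ v + h j) (D : ℕ) :
    ∃ v, ∀ j, (v + h j).Coprime (primorial D) := by
  choose! a ha using hadm
  obtain ⟨v, hv⟩ := Nat.chineseRemainderOfFinset a id (primesIoc 0 D)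
    (fun p hp => (Finset.mem_filter.1 hp).2.ne_zero)
    (fun p hp q hq hpq => (Nat.coprime_primes (Finset.mem_filter.1 hp).2
      (Finset.mem_filter.1 hq).2).2 hpq)
  refine ⟨v, fun j => coprime_primorial_iff.2 fun p hp hpD hdvd => ha p hp j ?_⟩
  have h1 := hv p (Finset.mem_filter.2 ⟨Finset.mem_Ioc.2 ⟨hp.pos, hpD⟩, hp⟩)
  exact ((h1.add_right (h j)).dvd_iff dvd_rfl).1 hdvd

end Shift

section Core

theorem final_inequality {k i ρ κ ℓ b A L φ W : ℝ} {K : ℕ} (hK : 0 < K) (hk : 0 < k) (hi : 1 ≤ i)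
    (hρ : 0 ≤ ρ) (hℓ : 0 < ℓ) (hA : 1 ≤ A) (hφ : 0 < φ) (hW : 0 < W) (hκ : κ = φ / W)
    (hL : L = 6800 * k * (i + 1) * ℓ) (hb : (i + 1) * (κ * ℓ) ≤ 4 * b) (hA' : A ≤ 16 * (κ * ℓ))
    (h : k * (b ^ 2 * A ^ (K - 1) / φ * L * i / 384) ≤ 2 * L * ρ * (9 * L / W * A ^ K)) :
    i ^ 2 ≤ 2 * 10 ^ 10 * ρ := by
  obtain ⟨K, rfl⟩ := Nat.exists_eq_succ_of_ne_zero hK.ne'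
  rw [Nat.succ_sub_one, pow_succ A] at h
  have hκ0 : 0 < κ := by rw [hκ]; positivity
  have hL0 : 0 < L := by rw [hL]; positivity
  have hAK : 0 < A ^ K := pow_pos (by linarith) K
  have hX : 0 < L * A ^ K / φ := by positivity
  have h1 : L * A ^ K / φ * (k * b ^ 2 * i) ≤ L * A ^ K / φ * (6912 * ρ * L * κ * A) := by
    have e1 : k * (b ^ 2 * A ^ K / φ * L * i / 384)
        = L * A ^ K / φ * (k * b ^ 2 * i) / 384 := by ring
    have e2 : 2 * L * ρ * (9 * L / W * (A ^ K * A))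
        = L * A ^ K / φ * (6912 * ρ * L * κ * A) / 384 := by
      rw [hκ]; field_simp; ring
    rw [e1, e2] at h
    linarith
  have h2 : k * b ^ 2 * i ≤ 6912 * ρ * L * κ * A := le_of_mul_le_mul_left h1 hX
  have h3 : ((i + 1) * (κ * ℓ)) ^ 2 ≤ (4 * b) ^ 2 := pow_le_pow_left₀ (by positivity) hb 2
  have h4 : k * i * ((i + 1) * (κ * ℓ)) ^ 2 ≤ 16 * (6912 * ρ * L * κ * (16 * (κ * ℓ))) := by
    calc k * i * ((i + 1) * (κ * ℓ)) ^ 2 ≤ k * i * (4 * b) ^ 2 :=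
          mul_le_mul_of_nonneg_left h3 (by positivity)
      _ = 16 * (k * b ^ 2 * i) := by ring
      _ ≤ 16 * (6912 * ρ * L * κ * A) := by linarith
      _ ≤ 16 * (6912 * ρ * L * κ * (16 * (κ * ℓ))) := by
          refine mul_le_mul_of_nonneg_left (mul_le_mul_of_nonneg_left hA' ?_) (by norm_num)
          positivity
  have h5 : k * (i + 1) * (κ * ℓ) ^ 2 * (i * (i + 1))
      ≤ k * (i + 1) * (κ * ℓ) ^ 2 * (12032409600 * ρ) := by
    rw [hL] at h4
    calc _ = k * i * ((i + 1) * (κ * ℓ)) ^ 2 := by ring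
      _ ≤ _ := h4
      _ = _ := by ring
  have h6 : i * (i + 1) ≤ 12032409600 * ρ := le_of_mul_le_mul_left h5 (by positivity)
  nlinarith

open Classical in
/-- If short intervals contain at most `ρ` numbers that are products of two distinct primes,
then admissible tuples in them are short. -/
theorem sq_le_of_card_isE2_le {J : Type*} [Fintype J] {i : ℕ} (hi : 4 ≤ i)
    (hJ : Fintype.card J = 4 ^ i) {h : J → ℕ} (hinj : Function.Injective h) {H : ℕ}
    (hH : ∀ j, h j ≤ H) (hadm : ∀ p : ℕ, p.Prime → ∃ v, ∀ j, ¬ p ∣ v + h j) {n₀ ρ : ℕ}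
    (hρ : ∀ n, n₀ ≤ n → ((Finset.Icc n (n + H)).filter IsE2).card ≤ ρ) :
    (i : ℝ) ^ 2 ≤ 2 * 10 ^ 10 * ρ := by
  obtain ⟨e, he⟩ : ∃ e, e = 68 * 4 ^ i * (i + 1) := ⟨_, rfl⟩
  have he0 : 0 < e := by rw [he]; positivity
  obtain ⟨D₁, hD₁⟩ := exists_le_sum_primePairs hi hJ he
  obtain ⟨D, hD1, hDH, hD2⟩ : ∃ D, D₁ ≤ D ∧ H ≤ D ∧ 2 * (Fintype.card J + 1) ^ 2 ≤ D :=
    ⟨max D₁ (max H (2 * (Fintype.card J + 1) ^ 2)), by simp⟩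
  obtain ⟨v, hv⟩ := exists_add_coprime_primorial hadm D
  obtain ⟨x₁, hx₁⟩ := hD₁ D hD1
  obtain ⟨x₂, hx₂⟩ := exists_setSum_dyadicWeight_bounds D
  obtain ⟨x₃, hx₃⟩ := exists_sum_sieveWeight_sq_le (i := i) he0 hD2
  obtain ⟨x, hx1, hx2, hx3, hx4, hx5, hx6⟩ :
      ∃ x, x₁ ≤ x ∧ x₂ ≤ x ∧ x₃ ≤ x ∧ n₀ ≤ x ∧ H ≤ x ∧ 2 ≤ x :=
    ⟨max x₁ (max x₂ (max x₃ (max n₀ (max H 2)))), by simp⟩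
  obtain ⟨y, hxy⟩ : ∃ y, y = x ^ (4 * e) := ⟨_, rfl⟩
  have hxy' : x ≤ y := by rw [hxy]; exact Nat.le_self_pow (by lia) x
  have hyN : y ≤ y ^ (100 * e) := Nat.le_self_pow (by lia) y
  have hN2 : y ^ (200 * e) = (y ^ (100 * e)) ^ 2 := by rw [← pow_mul]; congr 1; lia
  obtain ⟨hb, hA, -, -⟩ := hx₂ y i (by lia)
  have hc : ∀ j : primesIoc D (y ^ 2 ^ i), Function.Injective
      fun l => -(h l : ZMod (sieveModulus D (y ^ 2 ^ i) (some j))) :=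
    fun j => injective_neg_natCast hinj hH (hDH.trans_lt (lt_sieveModulus j))
  have hS1 := hx₃ y (by lia) _ hc (v : ZMod (sieveModulus D (y ^ 2 ^ i) none))
  have hS2 := Finset.sum_le_sum fun m (_ : m ∈ (Finset.univ : Finset J)) =>
    hx₁ x y hx1 hxy
      (fun j l => -(h l : ZMod (sieveModulus D (y ^ 2 ^ i) (some j))) + (h m : ZMod _))
      (fun j l l' hl => hc j (add_right_cancel hl)) m (fun j => neg_add_cancel _)
      ((v + h m : ℕ) : ZMod (sieveModulus D (y ^ 2 ^ i) none))
      ((ZMod.isUnit_iff_coprime _ _).2 (hv m))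
  rw [Finset.sum_const, Finset.card_univ, nsmul_eq_mul, hN2] at hS2
  have hS3 := sum_sum_primePairs_le hinj hH hρ (T := y ^ 2 ^ i) (N := y ^ (100 * e))
    (by lia) (by lia)
    (F := fun n => (if (n : ZMod (sieveModulus D (y ^ 2 ^ i) none)) = v then (1 : ℝ) else 0) *
      sieveWeight (fun j l => -(h l : ZMod (sieveModulus D (y ^ 2 ^ i) (some j))))
        (tupleWeight D y i e) (fun _ => n) ^ 2)
    (G := fun m n => (if (n : ZMod (sieveModulus D (y ^ 2 ^ i) none)) = (v + h m : ℕ)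
        then (1 : ℝ) else 0) *
      sieveWeight (fun j l => -(h l : ZMod (sieveModulus D (y ^ 2 ^ i) (some j))) + (h m : ZMod _))
        (tupleWeight D y i e) (fun _ => n) ^ 2)
    (fun n => mul_nonneg (by split_ifs <;> norm_num) (sq_nonneg _))
    (fun m n => by
      have h1 := sieveWeight_add (fun j l => -(h l : ZMod (sieveModulus D (y ^ 2 ^ i) (some j))))
        (fun j => (h m : ZMod _)) (tupleWeight D y i e) (fun _ => (n : ZMod _))
      simp only [Nat.cast_add, add_left_inj] at h1 ⊢
      rw [h1])
  have hlogN : 0 ≤ Real.log (y ^ (100 * e) : ℕ) := Real.log_natCast_nonneg _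
  have hfin := hS2.trans (hS3.trans (mul_le_mul_of_nonneg_left hS1 (by positivity)))
  have hk : ((Fintype.card J : ℕ) : ℝ) = 4 ^ i := by rw [hJ]; push_cast; rfl
  refine final_inequality (K := Fintype.card J) (by rw [hJ]; positivity) (by rw [hk]; positivity)
    (by exact_mod_cast (by lia : 1 ≤ i)) ρ.cast_nonneg
    (Real.log_pos (by exact_mod_cast (by lia : 1 < y) : (1 : ℝ) < y))
    (one_le_setSum_dyadicWeight_sq (D := D) (y := y) (i := i) (by lia))
    (by exact_mod_cast Nat.totient_pos.2 (primorial_pos D)) (by exact_mod_cast primorial_pos D)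
    rfl ?_ hb hA hfin
  rw [Nat.cast_pow, Real.log_pow, he, hk]
  push_cast
  ring

end Core

section Admissible

/-- The primes in `(k, k ^ 16]` contain an admissible `k`-tuple. -/
theorem exists_admissible : ∃ M : ℕ, ∀ k, M ≤ k → ∃ t : Finset ℕ, t.card = k ∧
    (∀ p ∈ t, p ≤ k ^ 16) ∧ ∀ p : ℕ, p.Prime → ∃ v, ∀ q ∈ t, ¬ p ∣ v + q := by
  obtain ⟨M, hM1, hM⟩ := exists_le_sum_primesIoc_one_div
  refine ⟨M, fun k hk => ?_⟩
  have hk0 : (0 : ℝ) < k := by exact_mod_cast (by lia : 0 < k)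
  have h1 := hM k (k ^ 16) 4 hk le_rfl
  have h2 : ∑ p ∈ primesIoc k (k ^ 16), 1 / (p : ℝ) ≤ (primesIoc k (k ^ 16)).card • (1 / (k : ℝ)) :=
    Finset.sum_le_card_nsmul _ _ _ fun p hp => one_div_le_one_div_of_le hk0
      (by exact_mod_cast (Finset.mem_Ioc.1 (Finset.mem_filter.1 hp).1).1.le)
  have h3 : k ≤ (primesIoc k (k ^ 16)).card := by
    have h4 := h1.trans h2
    rw [nsmul_eq_mul, mul_one_div, le_div_iff₀ hk0] at h4
    norm_num at h4
    exact_mod_cast h4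
  obtain ⟨t, ht, htk⟩ := Finset.exists_subset_card_eq h3
  refine ⟨t, htk, fun p hp => (Finset.mem_Ioc.1 (Finset.mem_filter.1 (ht hp)).1).2,
    fun p hp => ?_⟩
  rcases le_or_gt p k with hpk | hpk
  · refine ⟨0, fun q hq hdvd => ?_⟩
    obtain ⟨hq1, hq2⟩ := Finset.mem_filter.1 (ht hq)
    rw [zero_add, Nat.prime_dvd_prime_iff_eq hp hq2] at hdvd
    have := (Finset.mem_Ioc.1 hq1).1
    lia
  · have := Fact.mk hp
    obtain ⟨x, hx⟩ : ∃ x : ZMod p, x ∉ t.image fun q : ℕ => -(q : ZMod p) := by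
      by_contra! hall
      have h5 := Finset.card_le_card (fun x _ => hall x : Finset.univ ⊆ _)
      rw [Finset.card_univ, ZMod.card] at h5
      have h6 := Finset.card_image_le (s := t) (f := fun q : ℕ => -(q : ZMod p))
      lia
    refine ⟨x.val, fun q hq hdvd => hx (Finset.mem_image.2 ⟨q, hq, ?_⟩)⟩
    rw [← ZMod.natCast_eq_zero_iff, Nat.cast_add, ZMod.natCast_zmod_val] at hdvd
    exact (eq_neg_of_add_eq_zero_left hdvd).symm

open Classical in
/-- Many `E₂`-numbers in intervals of bounded length. -/
theorem exists_lt_card_isE2 : ∃ i₀ : ℕ, ∀ i ρ : ℕ, i₀ ≤ i → 2 * 10 ^ 10 * ρ < i ^ 2 →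
    ∀ n₀, ∃ n, n₀ ≤ n ∧ ρ < ((Finset.Icc n (n + 4 ^ (16 * i))).filter IsE2).card := by
  obtain ⟨M, hM⟩ := exists_admissible
  refine ⟨max M 4, fun i ρ hi hρ n₀ => ?_⟩
  by_contra! hcon
  obtain ⟨t, htk, htH, hadm⟩ := hM (4 ^ i)
    (((le_max_left M 4).trans hi).trans (Nat.lt_pow_self (by norm_num)).le)
  have h1 := sq_le_of_card_isE2_le (J := t) ((le_max_right M 4).trans hi)
    ((Fintype.card_coe t).trans htk) (h := Subtype.val) Subtype.val_injective
    (H := 4 ^ (16 * i)) (fun j => by rw [mul_comm, pow_mul]; exact htH j j.2)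
    (fun p hp => (hadm p hp).imp fun v hv j => hv j j.2) hcon
  have h2 : (2 * 10 ^ 10 * ρ : ℝ) < (i : ℝ) ^ 2 := by exact_mod_cast hρ
  linarith

end Admissible

section Liminf

theorem infinite_isE2 : {n | IsE2 n}.Infinite := by
  refine Set.infinite_of_not_bddAbove fun ⟨B, hB⟩ => ?_
  obtain ⟨p, hp, hpp⟩ := Nat.exists_infinite_primes (B + 3)
  have := hB (show IsE2 (2 * p) from ⟨2, p, Nat.prime_two, hpp, by lia, rfl⟩)
  lia

open Classical in
theorem nth_sub_nth_count_le {p : ℕ → Prop} (hp : {n | p n}.Infinite) {n H ρ : ℕ}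
    (h : ρ < ((Finset.Icc n (n + H)).filter p).card) :
    (Nat.nth p (Nat.count p n + ρ) : ℝ) - Nat.nth p (Nat.count p n) ≤ H := by
  have h1 : n ≤ Nat.nth p (Nat.count p n) := Nat.le_nth_count hp n
  have h2 : Nat.count p n + ρ < Nat.count p (n + H + 1) := by
    rw [Nat.count_eq_card_filter_range, Nat.count_eq_card_filter_range]
    have hd : Disjoint ((Finset.range n).filter p) ((Finset.Icc n (n + H)).filter p) := by
      refine Finset.disjoint_left.2 fun a ha hb => ?_
      have h3 := Finset.mem_range.1 (Finset.mem_filter.1 ha).1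
      have h4 := Finset.mem_Icc.1 (Finset.mem_filter.1 hb).1
      lia
    refine lt_of_lt_of_le (Nat.add_lt_add_left h _) ?_
    rw [← Finset.card_union_of_disjoint hd, ← Finset.filter_union]
    refine Finset.card_le_card (Finset.filter_subset_filter _ fun a ha => ?_)
    simp only [Finset.mem_union, Finset.mem_range, Finset.mem_Icc] at ha ⊢
    lia
  have h3 : Nat.nth p (Nat.count p n + ρ) ≤ n + H := by
    have := Nat.nth_lt_of_lt_count h2
    lia
  have h4 : (Nat.nth p (Nat.count p n + ρ) : ℝ) ≤ n + H := by exact_mod_cast h3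
  have h5 : (n : ℝ) ≤ Nat.nth p (Nat.count p n) := by exact_mod_cast h1
  linarith

open Classical in
theorem liminf_nth_sub_nth_le {p : ℕ → Prop} (hp : {n | p n}.Infinite) {H ρ : ℕ} {c : ℝ}
    (hc : (H : ℝ) ≤ c)
    (h : ∀ n₀, ∃ n, n₀ ≤ n ∧ ρ < ((Finset.Icc n (n + H)).filter p).card) :
    liminf (fun n => (Nat.nth p (n + ρ) : ℝ) - Nat.nth p n) atTop ≤ c := by
  refine liminf_le_of_frequently_le (frequently_atTop.2 fun m => ?_)
    ⟨0, eventually_map.2 (Eventually.of_forall fun n => ?_)⟩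
  · obtain ⟨n, hn, hcard⟩ := h (Nat.nth p m)
    refine ⟨Nat.count p n, ?_, (nth_sub_nth_count_le hp hcard).trans hc⟩
    rw [← Nat.count_nth_of_infinite hp m]
    exact Nat.count_monotone p hn
  · exact sub_nonneg.2 (Nat.cast_le.2 ((Nat.nth_monotone hp) (Nat.le_add_right n ρ)))

theorem exists_exponent_le : ∃ R : ℝ, ∀ i₀ ρ : ℕ, R < ρ → (i₀ : ℝ) ^ 2 ≤ ρ →
    ∃ i : ℕ, i₀ ≤ i ∧ 2 * 10 ^ 10 * ρ < i ^ 2 ∧ ∀ ε : ℝ, 0 ≤ ε →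
      ((4 ^ (16 * i) : ℕ) : ℝ) ≤ Real.exp (2 * (2 + ε) * ρ / (3 * Real.log ρ)) := by
  have hlog := (isLittleO_log_rpow_atTop (r := 1 / 2) (by norm_num)).def
    (c := 1 / 4000000) (by norm_num)
  obtain ⟨R, hR⟩ := eventually_atTop.1 hlog
  refine ⟨max R 2, fun i₀ ρ hρ hi₀ => ?_⟩
  have hρR : R ≤ ρ := ((le_max_left R 2).trans_lt hρ).le
  have hρ2 : (2 : ℝ) < ρ := (le_max_right R 2).trans_lt hρ
  have hl := hR ρ hρR
  rw [← Real.sqrt_eq_rpow, Real.norm_of_nonneg (Real.sqrt_nonneg _),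
    Real.norm_of_nonneg (Real.log_natCast_nonneg ρ)] at hl
  have hs1 : 1 ≤ √(ρ : ℝ) := Real.one_le_sqrt.2 (by linarith)
  have hs2 : √(ρ : ℝ) * √(ρ : ℝ) = ρ := Real.mul_self_sqrt (by linarith)
  have hi₀' : (i₀ : ℝ) ≤ √(ρ : ℝ) := Real.le_sqrt_of_sq_le hi₀
  have hl0 : 0 < Real.log ρ := Real.log_pos (by linarith)
  generalize √(ρ : ℝ) = s at *
  obtain ⟨i, hi⟩ : ∃ i, i = ⌊150000 * s⌋₊ + 1 := ⟨_, rfl⟩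
  have hi1 : 150000 * s < i := by rw [hi]; push_cast; exact Nat.lt_floor_add_one _
  have hi2 : (i : ℝ) ≤ 150001 * s := by
    rw [hi]; push_cast
    have := Nat.floor_le (by linarith : 0 ≤ 150000 * s)
    linarith
  refine ⟨i, by exact_mod_cast (by linarith : (i₀ : ℝ) ≤ i), ?_, fun ε hε => ?_⟩
  · have h1 : (2 * 10 ^ 10 * ρ : ℝ) < (i : ℝ) ^ 2 := by nlinarith
    exact_mod_cast h1
  · have h4 : Real.log 4 ≤ 2 := by
      have := Real.log_two_lt_d9
      rw [show (4 : ℝ) = 2 ^ 2 by norm_num, Real.log_pow]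
      push_cast
      linarith
    have h5 : ((4 ^ (16 * i) : ℕ) : ℝ) = Real.exp (16 * i * Real.log 4) := by
      rw [mul_comm (16 * (i : ℝ)), Real.exp_mul, Real.exp_log (by norm_num)]
      exact_mod_cast (Real.rpow_natCast 4 (16 * i)).symm
    rw [h5]
    refine Real.exp_le_exp.2 ?_
    rw [le_div_iff₀ (by linarith)]
    have h6 : 16 * (i : ℝ) * Real.log 4 ≤ 32 * (150001 * s) := by
      have := mul_le_mul_of_nonneg_left h4 (by positivity : (0 : ℝ) ≤ 16 * i)
      linarith
    calc 16 * (i : ℝ) * Real.log 4 * (3 * Real.log ρ)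
        ≤ 32 * (150001 * s) * (3 * (1 / 4000000 * s)) :=
          mul_le_mul h6 (by linarith) (by linarith) (by linarith)
      _ ≤ 4 * (s * s) := by nlinarith
      _ ≤ 2 * (2 + ε) * ρ := by rw [hs2]; nlinarith

end Liminf

/-- **Theorem 1.1, unconditional form.** For every `ε > 0` there is `ρ_ε > 0` such that for
every integer `ρ > ρ_ε` one has `liminf (q_{n+ρ} - q_n) ≤ exp(2(2+ε)ρ / (3 log ρ))`,
where `q_n` is the `n`-th `E₂`-number. -/
theorem smallGapsE2_unconditional :
    ∀ ε : ℝ, 0 < ε → ∃ ρε : ℝ, 0 < ρε ∧ ∀ ρ : ℕ, ρε < (ρ : ℝ) →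
      Filter.liminf (fun n => ((Nat.nth IsE2 (n + ρ) : ℝ) - (Nat.nth IsE2 n : ℝ)))
          Filter.atTop
        ≤ Real.exp (2 * (2 + ε) * ρ / (3 * Real.log ρ)) := by
  intro ε hε
  obtain ⟨R, hR⟩ := exists_exponent_le
  obtain ⟨i₀, hi₀⟩ := exists_lt_card_isE2
  refine ⟨max R ((i₀ : ℝ) ^ 2 + 1), lt_of_lt_of_le (by positivity) (le_max_right _ _),
    fun ρ hρ => ?_⟩
  obtain ⟨i, hi, hiρ, hexp⟩ := hR i₀ ρ ((le_max_left _ _).trans_lt hρ)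
    (by linarith [(le_max_right R ((i₀ : ℝ) ^ 2 + 1)).trans_lt hρ])
  exact liminf_nth_sub_nth_le infinite_isE2 (hexp ε hε.le) (hi₀ i ρ hi hiρ)
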